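/- arXiv:1005.4736 — 5 statements merged into one kernel-verified Lean document; each statement's English description precedes it below -/
import Mathlib

section
/- Let A and B be groups that are n-element order separable for every positive integer n, and suppose that |a| ≠ |b| for every nontrivial a ∈ A and every nontrivial b ∈ B whose orders |a| and |b| are both finite. Then the free product G = A ∗ B is 3-element order separable. -/
/-- A group `G` is `n`-element order separable if for all elements `u 0, ..., u (n-1)` of `G`
such that for `i ≠ j` the element `u i` is conjugate neither to `u j` nor to `(u j)⁻¹`,
there is a homomorphism of `G` onto a finite group under which the orders of the images
of the `u i` are pairwise different. -/
def OrderSeparable (G : Type*) [Group G] (n : ℕ) : Prop :=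
  ∀ u : Fin n → G,
    (∀ i j, i ≠ j → ¬ IsConj (u i) (u j) ∧ ¬ IsConj (u i) (u j)⁻¹) →
    ∃ (H : Type) (_ : Group H) (_ : Finite H) (φ : G →* H),
      Function.Surjective φ ∧
      ∀ i j, i ≠ j → orderOf (φ (u i)) ≠ orderOf (φ (u j))

/-- Conjugacy up to inversion. -/
def ConjInv {G : Type*} [Group G] (x y : G) : Prop :=
  IsConj x y ∨ IsConj x y⁻¹

namespace ConjInv

variable {G : Type*} [Group G] {x y z : G}

theorem _root_.IsConj.inv_inv (h : IsConj x y) : IsConj x⁻¹ y⁻¹ := by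
  obtain ⟨c, rfl⟩ := isConj_iff.1 h
  exact isConj_iff.2 ⟨c, by group⟩

@[refl]
theorem refl (x : G) : ConjInv x x := Or.inl (IsConj.refl x)

@[symm]
theorem symm (h : ConjInv x y) : ConjInv y x :=
  h.imp IsConj.symm fun h => by simpa using h.inv_inv.symm

@[trans]
theorem trans (h : ConjInv x y) (h' : ConjInv y z) : ConjInv x z := by
  rcases h with h | h <;> rcases h' with h' | h'
  · exact Or.inl (h.trans h')
  · exact Or.inr (h.trans h')
  · exact Or.inr (h.trans h'.inv_inv)
  · exact Or.inl (by simpa using h.trans h'.inv_inv)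

theorem map {H : Type*} [Group H] (h : ConjInv x y) (f : G →* H) : ConjInv (f x) (f y) :=
  h.imp (fun h => f.map_isConj h) fun h => by simpa using f.map_isConj h

theorem orderOf_eq (h : ConjInv x y) : orderOf x = orderOf y := by
  rcases h with h | h <;> obtain ⟨c, h⟩ := isConj_iff.1 h
  · rw [← h, ← MulAut.conj_apply, MulEquiv.orderOf_eq]
  · rw [← orderOf_inv y, ← h, ← MulAut.conj_apply, MulEquiv.orderOf_eq]

theorem eq_one (h : ConjInv x 1) : x = 1 := by
  rw [← orderOf_eq_one_iff, h.orderOf_eq, orderOf_one]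

/-- Conjugacy up to inversion as a setoid. -/
def setoid (G : Type*) [Group G] : Setoid G where
  r := ConjInv
  iseqv := ⟨refl, symm, trans⟩

end ConjInv

section FiniteSets

variable {G : Type*} [Group G] (hG : ∀ n : ℕ, 0 < n → OrderSeparable G n)
include hG

theorem exists_orderOf_map_ne (S : Finset G) :
    ∃ (H : Type) (_ : Group H) (_ : Finite H) (φ : G →* H),
      ∀ x ∈ S, ∀ y ∈ S, ¬ ConjInv x y → orderOf (φ x) ≠ orderOf (φ y) := by
  classical
  obtain rfl | ⟨x₀, hx₀⟩ := S.eq_empty_or_nonempty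
  · exact ⟨Unit, inferInstance, inferInstance, 1, by simp⟩
  let T := S.image (Quotient.mk (ConjInv.setoid G))
  have hT : 0 < T.card := Finset.card_pos.2 ⟨_, Finset.mem_image_of_mem _ hx₀⟩
  let u : Fin T.card → G := fun i => (T.equivFin.symm i).1.out
  have hu : ∀ i, Quotient.mk (ConjInv.setoid G) (u i) = T.equivFin.symm i := fun i =>
    Quotient.out_eq _
  obtain ⟨H, _, _, φ, -, hφ⟩ := hG _ hT u fun i j hij => by
    rw [← not_or]
    intro h
    apply hij
    apply T.equivFin.symm.injective
    rw [← Subtype.coe_inj, ← hu, ← hu]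
    exact Quotient.sound h
  have hS : ∀ x ∈ S, ∃ i, ConjInv x (u i) := fun x hx => by
    refine ⟨T.equivFin ⟨_, Finset.mem_image_of_mem _ hx⟩, ?_⟩
    have h1 := hu (T.equivFin ⟨_, Finset.mem_image_of_mem _ hx⟩)
    rw [Equiv.symm_apply_apply] at h1
    exact ConjInv.symm (Quotient.exact h1)
  refine ⟨H, inferInstance, inferInstance, φ, fun x hx y hy hxy => ?_⟩
  obtain ⟨i, hi⟩ := hS x hx
  obtain ⟨j, hj⟩ := hS y hy
  rw [(hi.map φ).orderOf_eq, (hj.map φ).orderOf_eq]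
  refine hφ i j ?_
  rintro rfl
  exact hxy (hi.trans hj.symm)

theorem exists_lt_card_divisors_orderOf {x : G} (hx : ¬ IsOfFinOrder x) (n : ℕ) :
    ∃ (H : Type) (_ : Group H) (_ : Finite H) (φ : G →* H),
      n < (orderOf (φ x)).divisors.card := by
  classical
  induction n with
  | zero => exact ⟨Unit, inferInstance, inferInstance, 1, by simp [isOfFinOrder_of_finite]⟩
  | succ n ih =>
    obtain ⟨H, _, _, φ, hφ⟩ := ih
    have h1 : x ^ orderOf (φ x) ≠ 1 := fun h =>
      hx (isOfFinOrder_iff_pow_eq_one.2 ⟨_, orderOf_pos _, h⟩)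
    obtain ⟨H', _, _, ψ, hψ⟩ := exists_orderOf_map_ne hG {x ^ orderOf (φ x), 1}
    have h2 := hψ _ (by simp) 1 (by simp) fun h => h1 h.eq_one
    refine ⟨H × H', inferInstance, inferInstance, φ.prod ψ, lt_of_le_of_lt hφ ?_⟩
    refine Finset.card_lt_card ((Finset.ssubset_iff_of_subset ?_).2 ⟨orderOf (φ.prod ψ x), ?_, ?_⟩)
    · exact Nat.divisors_subset_of_dvd (orderOf_pos _).ne' (orderOf_map_dvd (MonoidHom.fst H H') _)
    · exact Nat.mem_divisors_self _ (orderOf_pos _).ne'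
    · intro h
      have h3 := orderOf_dvd_iff_pow_eq_one.1 (Nat.dvd_of_mem_divisors h)
      apply h2
      rw [map_pow, map_one, orderOf_one, orderOf_eq_one_iff]
      exact congrArg Prod.snd h3

/-- A finite set of elements has a finite quotient which keeps the orders of non-conjugate elements
apart, preserves finite orders and makes infinite orders large. -/
theorem exists_hom_finite (S : Finset G) (K : ℕ) :
    ∃ (H : Type) (_ : Group H) (_ : Finite H) (φ : G →* H),
      (∀ x ∈ S, ∀ y ∈ S, ¬ ConjInv x y → orderOf (φ x) ≠ orderOf (φ y)) ∧
      (∀ x ∈ S, x ≠ 1 → φ x ≠ 1) ∧ (∀ x ∈ S, IsOfFinOrder x → orderOf (φ x) = orderOf x) ∧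
      ∀ x ∈ S, ¬ IsOfFinOrder x → K < orderOf (φ x) := by
  classical
  have h1 : ∀ x : G, ∃ D : Finset ℕ, ¬ IsOfFinOrder x → K < D.card ∧
      ∀ d ∈ D, ∀ e ∈ D, d ≠ e → ¬ ConjInv (x ^ d) (x ^ e) := by
    intro x
    by_cases hx : IsOfFinOrder x
    · exact ⟨∅, fun h => absurd hx h⟩
    obtain ⟨H, _, _, ψ, hψ⟩ := exists_lt_card_divisors_orderOf hG hx K
    refine ⟨_, fun _ => ⟨hψ, fun d hd e he hde h => hde ?_⟩⟩
    have h2 := (h.map ψ).orderOf_eq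
    have hd := Nat.dvd_of_mem_divisors hd
    have he := Nat.dvd_of_mem_divisors he
    have h0 := orderOf_pos (ψ x)
    rw [map_pow, map_pow, orderOf_pow_of_dvd (Nat.pos_of_dvd_of_pos hd h0).ne' hd,
      orderOf_pow_of_dvd (Nat.pos_of_dvd_of_pos he h0).ne' he] at h2
    rw [← Nat.div_div_self hd h0.ne', h2, Nat.div_div_self he h0.ne']
  choose D hD using h1
  obtain ⟨H, _, _, φ, hφ⟩ := exists_orderOf_map_ne hG (insert 1 (S ∪ (S.biUnion fun x =>
    (Finset.range (orderOf x) ∪ D x).image (x ^ ·))))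
  have hone : ∀ x ∈ S, ∀ n ∈ Finset.range (orderOf x) ∪ D x, φ (x ^ n) = 1 → x ^ n = 1 := by
    intro x hx n hn h
    by_contra h2
    refine hφ (x ^ n) ?_ 1 (Finset.mem_insert_self _ _) (fun h3 => h2 h3.eq_one) (by simp [h])
    exact Finset.mem_insert_of_mem (Finset.mem_union_right _ (Finset.mem_biUnion.2
      ⟨x, hx, Finset.mem_image_of_mem _ hn⟩))
  refine ⟨H, inferInstance, inferInstance, φ, fun x hx y hy => ?_, fun x hx hx1 h => ?_,
    fun x hx hfin => ?_, fun x hx hinf => ?_⟩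
  · exact hφ x (by simp [hx]) y (by simp [hy])
  · exact hφ x (by simp [hx]) 1 (by simp) (fun h3 => hx1 h3.eq_one) (by simp [h])
  · refine le_antisymm (Nat.le_of_dvd hfin.orderOf_pos (orderOf_map_dvd φ x)) ?_
    by_contra! h
    have h2 := hone x hx (orderOf (φ x)) (by simp [h]) (by rw [map_pow, pow_orderOf_eq_one])
    exact h.not_ge (orderOf_le_of_pow_eq_one (orderOf_pos _) h2)
  · obtain ⟨h2, h3⟩ := hD x hinf
    refine h2.trans_le ((Finset.card_le_card_of_injOn (fun d => orderOf (φ (x ^ d)))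
      (t := (orderOf (φ x)).divisors) ?_ ?_).trans (Nat.card_divisors_le_self _))
    · intro d hd
      refine Nat.mem_divisors.2 ⟨?_, (orderOf_pos _).ne'⟩
      simp only [map_pow]
      exact orderOf_pow_dvd _
    · intro d hd e he hde
      by_contra hne
      have hmem : ∀ n ∈ D x, x ^ n ∈ insert 1 (S ∪ (S.biUnion fun x =>
          (Finset.range (orderOf x) ∪ D x).image (x ^ ·))) := fun n hn =>
        Finset.mem_insert_of_mem (Finset.mem_union_right _ (Finset.mem_biUnion.2
          ⟨x, hx, Finset.mem_image_of_mem _ (Finset.mem_union_right _ hn)⟩))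
      exact hφ _ (hmem d hd) _ (hmem e he) (h3 d hd e he hne) hde

end FiniteSets

theorem exists_mem_ker_forall_ne_zero {k V ι : Type*} [Field k] [AddCommGroup V] [Module k V]
    [Finite ι] (F₀ : V →ₗ[k] k) (F : ι → V →ₗ[k] k) (hF : ∀ i (r : k), F i ≠ r • F₀)
    (hk : Nat.card ι < ENat.card k) : ∃ x, F₀ x = 0 ∧ ∀ i, F i x ≠ 0 := by
  classical
  cases nonempty_fintype ι
  have h1 : ∀ i, LinearMap.ker (F i ∘ₗ (LinearMap.ker F₀).subtype) ≠ ⊤ := by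
    intro i hi
    have h2 : F i ∈ Submodule.span k (Set.range fun _ : Unit => F₀) := by
      apply mem_span_of_iInf_ker_le_ker
      intro x hx
      have hx' : x ∈ LinearMap.ker F₀ := by simpa using hx
      rw [LinearMap.ker_eq_top] at hi
      exact LinearMap.congr_fun hi ⟨x, hx'⟩
    rw [Set.range_const, Submodule.mem_span_singleton] at h2
    obtain ⟨r, hr⟩ := h2
    exact hF i r hr.symm
  have h3 := Submodule.iUnion_ssubset_of_forall_ne_top_of_card_lt Finset.univ
    (fun i => LinearMap.ker (F i ∘ₗ (LinearMap.ker F₀).subtype)) h1 (by simpa using hk)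
  obtain ⟨x, -, hx⟩ := Set.exists_of_ssubset h3
  simp only [Finset.mem_univ, Set.iUnion_true, Set.mem_iUnion, not_exists] at hx
  exact ⟨x, x.2, fun i hi => hx i hi⟩

/-- A cyclically reduced word of syllable length `2 * len` in the free product of `A` and `B`. -/
structure CyclicWord (A B : Type*) [Group A] [Group B] where
  len : ℕ
  [len_neZero : NeZero len]
  left : ZMod len → A
  right : ZMod len → B
  left_ne_one : ∀ i, left i ≠ 1
  right_ne_one : ∀ i, right i ≠ 1

namespace CyclicWord

variable {A B : Type*} [Group A] [Group B]

attribute [instance] CyclicWord.len_neZero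

/-- The image in `K` of the product of the first `2 * i` letters of the periodic word. -/
def pre (w : CyclicWord A B) {K : Type*} [Group K] (α : A →* K) (β : B →* K) : ℕ → K
  | 0 => 1
  | i + 1 => β (w.right i) * (α (w.left i) * pre w α β i)

/-- The image in `K` of the product of the first `2 * i + 1` letters of the periodic word. -/
def odd (w : CyclicWord A B) {K : Type*} [Group K] (α : A →* K) (β : B →* K) (i : ℕ) : K :=
  α (w.left i) * w.pre α β i

/-- The element of `K` represented by a cyclic word. -/
def val (w : CyclicWord A B) {K : Type*} [Group K] (α : A →* K) (β : B →* K) : K :=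
  w.pre α β w.len

section Basic

variable (w : CyclicWord A B) {K K' : Type*} [Group K] [Group K'] (α : A →* K) (β : B →* K)

@[simp]
theorem pre_zero : w.pre α β 0 = 1 := rfl

theorem pre_succ (i : ℕ) : w.pre α β (i + 1) = β (w.right i) * w.odd α β i := rfl

theorem map_pre (f : K →* K') (i : ℕ) :
    f (w.pre α β i) = w.pre (f.comp α) (f.comp β) i := by
  induction i with
  | zero => simp
  | succ i ih => simp [pre_succ, odd, ih]

theorem map_val (f : K →* K') : f (w.val α β) = w.val (f.comp α) (f.comp β) :=
  w.map_pre α β f _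

theorem lift_pre (i : ℕ) :
    Monoid.Coprod.lift α β (w.pre Monoid.Coprod.inl Monoid.Coprod.inr i) = w.pre α β i := by
  rw [map_pre, Monoid.Coprod.lift_comp_inl, Monoid.Coprod.lift_comp_inr]

theorem lift_val :
    Monoid.Coprod.lift α β (w.val Monoid.Coprod.inl Monoid.Coprod.inr) = w.val α β :=
  w.lift_pre α β _

theorem pre_add_len (i : ℕ) : w.pre α β (i + w.len) = w.pre α β i * w.val α β := by
  induction i with
  | zero => simp [val]
  | succ i ih =>
    rw [add_right_comm, pre_succ, odd, ih, pre_succ, odd]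
    simp [mul_assoc]

theorem pre_add_mul_len (i s : ℕ) :
    w.pre α β (i + s * w.len) = w.pre α β i * w.val α β ^ s := by
  induction s with
  | zero => simp
  | succ s ih => rw [Nat.succ_mul, ← add_assoc, pre_add_len, ih, pow_succ, mul_assoc]

theorem pre_mul_len (s : ℕ) : w.pre α β (s * w.len) = w.val α β ^ s := by
  simpa using w.pre_add_mul_len α β 0 s

theorem odd_add_mul_len (i s : ℕ) :
    w.odd α β (i + s * w.len) = w.odd α β i * w.val α β ^ s := by
  simp [odd, pre_add_mul_len, mul_assoc]

/-- The cyclic word labels a simple closed path in the graph whose edges are the elements of `K`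
and whose vertices are the right cosets of the images of `A` and `B`. -/
structure IsSimple : Prop where
  left_ne : ∀ i, α (w.left i) ≠ 1
  right_ne : ∀ i, β (w.right i) ≠ 1
  left_eq : ∀ i j x, w.pre α β j = α x * w.pre α β i → (i : ZMod w.len) = j ∧ α x = 1
  right_eq : ∀ i j x, w.pre α β j = β x * w.pre α β i → (i : ZMod w.len) = j ∧ β x = 1

variable {w α β} in
theorem IsSimple.of_comp {f : K →* K'} (h : w.IsSimple (f.comp α) (f.comp β))
    (hα : ∀ x, f (α x) = 1 → α x = 1) (hβ : ∀ x, f (β x) = 1 → β x = 1) : w.IsSimple α β where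
  left_ne i hi := h.left_ne i (by simp [hi])
  right_ne i hi := h.right_ne i (by simp [hi])
  left_eq i j x hx := by
    have := h.left_eq i j x (by rw [← map_pre, hx, map_mul, map_pre]; rfl)
    exact ⟨this.1, hα x this.2⟩
  right_eq i j x hx := by
    have := h.right_eq i j x (by rw [← map_pre, hx, map_mul, map_pre]; rfl)
    exact ⟨this.1, hβ x this.2⟩

end Basic

theorem exists_isSimple_perm (w : CyclicWord A B) {A' B' : Type} [Group A'] [Group B'] [Finite A']
    [Finite B'] (φ : A →* A') (ψ : B →* B') (hφ : ∀ i, φ (w.left i) ≠ 1)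
    (hψ : ∀ i, ψ (w.right i) ≠ 1) :
    ∃ (X : Type) (_ : Finite X) (α : A' →* Equiv.Perm X) (β : B' →* Equiv.Perm X),
      Function.Injective α ∧ Function.Injective β ∧ w.IsSimple (α.comp φ) (β.comp ψ) := by
  classical
  have hXY : Nonempty (((ZMod w.len × B') × A') ≃ ((ZMod w.len × A') × B')) :=
    ⟨{ toFun := fun p => ((p.1.1, p.2), p.1.2), invFun := fun p => ((p.1.1, p.2), p.1.2),
       left_inv := fun _ => rfl, right_inv := fun _ => rfl }⟩
  obtain ⟨e⟩ := hXY
  let f : ZMod w.len × Bool → (ZMod w.len × A') × B' := fun p =>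
    ((p.1, if p.2 then φ (w.left p.1) else 1), 1)
  let g : ZMod w.len × Bool → (ZMod w.len × B') × A' := fun p =>
    if p.2 then ((p.1, 1), 1) else ((p.1 - 1, ψ (w.right (p.1 - 1))), 1)
  have hf : Function.Injective f := by
    rintro ⟨i, _ | _⟩ ⟨j, _ | _⟩ h <;> simp [f] at h ⊢
    · exact h
    · obtain ⟨rfl, h⟩ := h
      exact hφ _ h.symm
    · obtain ⟨rfl, h⟩ := h
      exact hφ _ h
    · exact h.1
  have hg : Function.Injective g := by
    rintro ⟨i, _ | _⟩ ⟨j, _ | _⟩ h <;> simp [g] at h ⊢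
    · exact h.1
    · exact hψ _ h.2
    · obtain ⟨rfl, h⟩ := h
      exact hψ _ h.symm
    · exact h
  obtain ⟨τ, hτ⟩ := Equiv.Perm.exists_extending_pair f (e ∘ g) hf (e.injective.comp hg)
  let σ : ((ZMod w.len × A') × B') ≃ ((ZMod w.len × B') × A') := τ.trans e.symm
  have hσ : ∀ p, σ (f p) = g p := fun p => by simp [σ, hτ]
  let α : A' →* Equiv.Perm ((ZMod w.len × A') × B') :=
    { toFun := fun x => ((Equiv.refl _).prodCongr (Equiv.mulLeft x)).prodCongr (Equiv.refl _)
      map_one' := by ext p <;> simp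
      map_mul' := fun x y => by ext p <;> simp [mul_assoc] }
  let β₀ : B' →* Equiv.Perm ((ZMod w.len × B') × A') :=
    { toFun := fun x => ((Equiv.refl _).prodCongr (Equiv.mulLeft x)).prodCongr (Equiv.refl _)
      map_one' := by ext p <;> simp
      map_mul' := fun x y => by ext p <;> simp [mul_assoc] }
  let β : B' →* Equiv.Perm ((ZMod w.len × A') × B') := σ.symm.permCongrHom.toMonoidHom.comp β₀
  have hα : ∀ x i c d, α x ((i, c), d) = ((i, x * c), d) := fun _ _ _ _ => rfl
  have hβ₀ : ∀ x i c d, β₀ x ((i, c), d) = ((i, x * c), d) := fun _ _ _ _ => rfl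
  have hβ : ∀ x p, σ (β x p) = β₀ x (σ p) := fun x p => by
    simp [β, Equiv.permCongrHom]
  have hpre : ∀ i : ℕ, w.pre (α.comp φ) (β.comp ψ) i (f (0, false)) = f (i, false) := by
    intro i
    induction i with
    | zero => simp
    | succ i ih =>
      have h1 : w.odd (α.comp φ) (β.comp ψ) i (f (0, false)) = f (i, true) := by
        rw [odd, Equiv.Perm.mul_apply, ih]
        simp [f, hα]
      rw [pre_succ, Equiv.Perm.mul_apply, h1]
      apply σ.injective
      rw [MonoidHom.comp_apply, hβ, hσ, hσ]
      simp [g, hβ₀]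
  have hα' : Function.Injective α := fun x y h => by
    have := congrArg (fun p : Equiv.Perm ((ZMod w.len × A') × B') => p (f (0, false))) h
    simpa [f, hα] using this
  have hβ' : Function.Injective β := fun x y h => by
    have := congrArg (fun p : Equiv.Perm ((ZMod w.len × A') × B') => σ (p (f (0, false)))) h
    simpa [hβ, hσ, g, hβ₀] using this
  refine ⟨_, inferInstance, α, β, hα', hβ', fun i hi => hφ i (hα' (by simpa using hi)),
    fun i hi => hψ i (hβ' (by simpa using hi)), fun i j x h => ?_, fun i j x h => ?_⟩
  · have h1 := congrArg (fun p : Equiv.Perm ((ZMod w.len × A') × B') => p (f (0, false))) h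
    simp only [Equiv.Perm.mul_apply, hpre] at h1
    simp only [f, MonoidHom.comp_apply, hα, Prod.mk.injEq, and_true] at h1
    refine ⟨h1.1.symm, ?_⟩
    have h2 : φ x = 1 := by simpa using h1.2.symm
    simp [h2]
  · have h1 := congrArg (fun p : Equiv.Perm ((ZMod w.len × A') × B') => σ (p (f (0, false)))) h
    simp only [Equiv.Perm.mul_apply, hpre, MonoidHom.comp_apply, hβ, hσ] at h1
    simp only [g, hβ₀, Prod.mk.injEq, and_true, Bool.false_eq_true, if_false, sub_left_inj] at h1
    obtain ⟨h1, h3⟩ := h1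
    refine ⟨h1.symm, ?_⟩
    rw [h1] at h3
    have h2 : ψ x = 1 := by simpa using h3.symm
    simp [h2]

end CyclicWord

section Twist

/-- Permutations of `Y` acting on the first factor of `Y × C`. -/
def permProd (Y C : Type*) : Equiv.Perm Y →* Equiv.Perm (Y × C) where
  toFun σ := σ.prodCongr (Equiv.refl C)
  map_one' := by ext p <;> simp
  map_mul' σ τ := by ext p <;> simp

theorem permProd_injective (Y C : Type*) [Nonempty C] : Function.Injective (permProd Y C) := by
  intro σ τ h
  ext y
  obtain ⟨c⟩ := ‹Nonempty C›
  exact congrArg (fun ρ : Equiv.Perm (Y × C) => (ρ (y, c)).1) h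

theorem permProd_comp_apply {Y C A : Type*} [Group A] (α : A →* Equiv.Perm Y) (x : A) (y : Y)
    (s : C) : (permProd Y C).comp α x (y, s) = (α x y, s) := rfl

variable {Y C : Type*} [AddCommGroup C]

/-- The permutation of `Y × C` that translates the fibre over `y` by `m y`. -/
def shear (m : Y → C) : Equiv.Perm (Y × C) :=
  (Equiv.refl Y).prodShear fun y => Equiv.addRight (m y)

/-- The action on `Y × C` obtained from an action on `Y` by conjugating with `shear m`. -/
def twist {B : Type*} [Group B] (β : B →* Equiv.Perm Y) (m : Y → C) : B →* Equiv.Perm (Y × C) :=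
  (MulAut.conj (shear m)).toMonoidHom.comp ((permProd Y C).comp β)

theorem twist_apply {B : Type*} [Group B] (β : B →* Equiv.Perm Y) (m : Y → C) (x : B) (y : Y)
    (s : C) : twist β m x (y, s) = (β x y, s + (m (β x y) - m y)) := by
  have : (shear m)⁻¹ (y, s) = (y, s - m y) := by
    rw [Equiv.Perm.inv_eq_iff_eq]
    simp [shear, Equiv.prodShear]
  simp only [twist, MonoidHom.comp_apply, MulEquiv.coe_toMonoidHom, MulAut.conj_apply,
    Equiv.Perm.mul_apply, this]
  simp [shear, permProd, Equiv.prodShear]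
  abel

theorem orderOf_permProd_comp {A : Type*} [Group A] (α : A →* Equiv.Perm Y) (x : A) :
    orderOf ((permProd Y C).comp α x) = orderOf (α x) :=
  orderOf_injective (permProd Y C) (permProd_injective Y C) _

theorem orderOf_twist {B : Type*} [Group B] (β : B →* Equiv.Perm Y) (m : Y → C) (x : B) :
    orderOf (twist β m x) = orderOf (β x) := by
  rw [← orderOf_permProd_comp (C := C) β x]
  exact orderOf_injective (MulAut.conj (shear m)).toMonoidHom (MulAut.conj (shear m)).injective _

end Twist

namespace CyclicWord

variable {A B : Type*} [Group A] [Group B]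

section Layer

variable (w : CyclicWord A B) {Y C : Type*} [AddCommGroup C] (α : A →* Equiv.Perm Y)
  (β : B →* Equiv.Perm Y) (m : Y → C)

/-- The total change of the `C`-coordinate along the first `2 * i` letters, starting over `y`. -/
def drift (i : ℕ) (y : Y) : C :=
  ∑ j ∈ Finset.range i, (m (w.pre α β (j + 1) y) - m (w.odd α β j y))

theorem pre_twist_apply (i : ℕ) (y : Y) (s : C) :
    w.pre ((permProd Y C).comp α) (twist β m) i (y, s) =
      (w.pre α β i y, s + w.drift α β m i y) := by
  induction i with
  | zero => simp [drift]
  | succ i ih =>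
    rw [pre_succ, odd, Equiv.Perm.mul_apply, Equiv.Perm.mul_apply, ih, permProd_comp_apply,
      twist_apply, add_assoc, drift, drift, Finset.sum_range_succ]
    rfl

theorem odd_twist_apply (i : ℕ) (y : Y) (s : C) :
    w.odd ((permProd Y C).comp α) (twist β m) i (y, s) =
      (w.odd α β i y, s + w.drift α β m i y) := by
  rw [odd, Equiv.Perm.mul_apply, pre_twist_apply, permProd_comp_apply]
  rfl

theorem drift_of_pre_eq (i : ℕ) (y : Y) (h : w.pre α β i y = y) :
    w.drift α β m i y = ∑ j ∈ Finset.range i, (m (w.pre α β j y) - m (w.odd α β j y)) := by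
  rw [drift, Finset.sum_sub_distrib, Finset.sum_sub_distrib]
  congr 1
  have h1 := Finset.sum_range_succ (fun j => m (w.pre α β j y)) i
  rw [Finset.sum_range_succ'] at h1
  simpa [h] using h1

theorem val_twist_pow_apply (k : ℕ) (y : Y) (s : C) :
    (w.val ((permProd Y C).comp α) (twist β m) ^ k) (y, s) =
      ((w.val α β ^ k) y, s + w.drift α β m (k * w.len) y) := by
  rw [← pre_mul_len, ← pre_mul_len, pre_twist_apply]

theorem val_twist_pow_pow_apply (k r : ℕ) (y : Y) (s : C) (h : (w.val α β ^ k) y = y) :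
    ((w.val ((permProd Y C).comp α) (twist β m) ^ k) ^ r) (y, s) =
      (y, s + r • w.drift α β m (k * w.len) y) := by
  induction r with
  | zero => simp
  | succ r ih =>
    rw [pow_succ', Equiv.Perm.mul_apply, ih, val_twist_pow_apply, h, add_assoc, succ_nsmul]

theorem val_pow_eq_one_of_twist [Nonempty C] (N : ℕ)
    (h : w.val ((permProd Y C).comp α) (twist β m) ^ N = 1) : w.val α β ^ N = 1 := by
  ext y
  obtain ⟨s⟩ := ‹Nonempty C›
  have h1 := w.val_twist_pow_apply α β m N y s
  rw [h] at h1
  exact (congrArg Prod.fst h1).symm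

theorem val_twist_pow_mul_eq_one {c : ℕ} (m : Y → ZMod c) (N : ℕ) (h : w.val α β ^ N = 1) :
    w.val ((permProd Y (ZMod c)).comp α) (twist β m) ^ (N * c) = 1 := by
  ext1 ⟨y, s⟩
  rw [pow_mul, val_twist_pow_pow_apply _ _ _ _ _ _ _ _ (by simp [h])]
  simp

theorem dvd_orderOf_val_twist {c : ℕ} (m : Y → ZMod c) (k : ℕ) (hk : k ∣ orderOf (w.val α β))
    (y : Y) (hy : (w.val α β ^ k) y = y) (h : w.drift α β m (k * w.len) y = 1) :
    c ∣ orderOf (w.val ((permProd Y (ZMod c)).comp α) (twist β m)) := by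
  set N := orderOf (w.val ((permProd Y (ZMod c)).comp α) (twist β m)) with hN
  have h1 : w.val ((permProd Y (ZMod c)).comp α) (twist β m) ^ N = 1 := pow_orderOf_eq_one _
  obtain ⟨r, hr⟩ := hk.trans (orderOf_dvd_of_pow_eq_one (w.val_pow_eq_one_of_twist α β m N h1))
  have h2 := w.val_twist_pow_pow_apply α β m k r y 0 hy
  rw [← pow_mul, ← hr, h1, h] at h2
  have h3 : ((r : ℕ) : ZMod c) = 0 := by simpa using (congrArg Prod.snd h2).symm
  rw [hr]
  exact ((ZMod.natCast_eq_zero_iff _ _).1 h3).mul_left _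

end Layer

namespace IsSimple

variable {w : CyclicWord A B} {K : Type*} [Group K] {α : A →* K} {β : B →* K}

theorem pre_eq_iff (h : w.IsSimple α β) {i j : ℕ} :
    w.pre α β i = w.pre α β j ↔ i ≡ j [MOD orderOf (w.val α β) * w.len] := by
  wlog hij : i ≤ j generalizing i j
  · rw [eq_comm, Nat.ModEq.comm, this (le_of_not_ge hij)]
  have key : w.pre α β i = w.pre α β j → (w.len : ℕ) ∣ j - i := fun he => by
    have := (h.left_eq i j 1 (by simp [he])).1
    exact (Nat.modEq_iff_dvd' hij).1 ((ZMod.natCast_eq_natCast_iff _ _ _).1 this)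
  rw [Nat.modEq_iff_dvd' hij]
  constructor
  · intro he
    obtain ⟨s, hs⟩ := key he
    obtain rfl : j = i + s * w.len := by rw [mul_comm, ← hs]; omega
    rw [pre_add_mul_len, left_eq_mul] at he
    rw [hs, mul_comm]
    exact Nat.mul_dvd_mul_left _ (orderOf_dvd_of_pow_eq_one he)
  · rintro ⟨s, hs⟩
    obtain rfl : j = i + (orderOf (w.val α β) * s) * w.len := by
      rw [mul_right_comm, ← hs]; omega
    rw [pre_add_mul_len, pow_mul, pow_orderOf_eq_one, one_pow, mul_one]

theorem natCast_eq_of_modEq {i j : ℕ} (hij : i ≡ j [MOD orderOf (w.val α β) * w.len]) :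
    (i : ZMod w.len) = j :=
  (ZMod.natCast_eq_natCast_iff _ _ _).2 (hij.of_mul_left _)

theorem pre_eq_of_pre_eq_left (h : w.IsSimple α β) {i j : ℕ} {x : A}
    (hx : w.pre α β j = α x * w.pre α β i) :
    (i : ZMod w.len) = j ∧ w.pre α β i = w.pre α β j ∧ α x = 1 := by
  obtain ⟨h1, h2⟩ := h.left_eq i j x hx
  exact ⟨h1, by simp [hx, h2], h2⟩

theorem odd_eq_left (h : w.IsSimple α β) {i j : ℕ} {x : A}
    (hx : w.odd α β j = α x * w.pre α β i) :
    w.odd α β j = w.odd α β i ∧ α x = α (w.left i) := by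
  have h1 : w.pre α β j = α ((w.left j)⁻¹ * x) * w.pre α β i := by
    rw [map_mul, mul_assoc, ← hx, odd]
    simp
  obtain ⟨h2, h3, h4⟩ := h.pre_eq_of_pre_eq_left h1
  rw [map_mul, map_inv, inv_mul_eq_one] at h4
  rw [hx, odd, ← h4, h2]
  exact ⟨rfl, rfl⟩

theorem pre_ne_odd (h : w.IsSimple α β) (i j : ℕ) : w.pre α β i ≠ w.odd α β j :=
  fun he => h.left_ne _ (h.left_eq j i _ he).2

theorem odd_eq_iff (h : w.IsSimple α β) {i j : ℕ} :
    w.odd α β i = w.odd α β j ↔ i ≡ j [MOD orderOf (w.val α β) * w.len] := by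
  constructor
  · intro he
    have h1 : w.pre α β i = α ((w.left i)⁻¹ * w.left j) * w.pre α β j := by
      rw [map_mul, mul_assoc, ← odd, ← he, odd]
      simp
    exact (h.pre_eq_iff.1 (h.pre_eq_of_pre_eq_left h1).2.1).symm
  · intro he
    rw [odd, odd, h.pre_eq_iff.2 he, natCast_eq_of_modEq he]

theorem odd_eq_right (h : w.IsSimple α β) {i j : ℕ} {x : B}
    (hx : w.odd α β j = β x * w.odd α β i) :
    w.odd α β j = w.odd α β i ∧ β x = 1 := by
  have h1 : w.pre α β (j + 1) = β (w.right j * x * (w.right i)⁻¹) * w.pre α β (i + 1) := by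
    rw [pre_succ, pre_succ, hx]
    simp [mul_assoc]
  obtain ⟨h2, h3⟩ := h.right_eq _ _ _ h1
  have h4 : (i : ZMod w.len) = j := by simpa using h2
  have h5 : β x = 1 := by
    rw [h4, map_mul, map_mul, map_inv, mul_inv_eq_one, mul_eq_left] at h3
    exact h3
  exact ⟨by rw [hx, h5, one_mul], h5⟩

theorem pre_succ_eq_right (h : w.IsSimple α β) {i j : ℕ} {x : B}
    (hx : w.pre α β (j + 1) = β x * w.odd α β i) :
    w.pre α β (j + 1) = w.pre α β (i + 1) ∧ β x = β (w.right i) := by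
  have h1 : w.odd α β j = β ((w.right j)⁻¹ * x) * w.odd α β i := by
    rw [map_mul, mul_assoc, ← hx, pre_succ]
    simp
  obtain ⟨h2, h3⟩ := h.odd_eq_right h1
  have h4 := natCast_eq_of_modEq (h.odd_eq_iff.1 h2)
  rw [map_mul, map_inv, inv_mul_eq_one] at h3
  rw [hx, pre_succ, ← h3, h4]
  exact ⟨rfl, rfl⟩

end IsSimple

section Chain

variable (w : CyclicWord A B) {K : Type*} [Group K] (α : A →* K) (β : B →* K)
  (R : Type*) [CommRing R]

/-- The sum along the closed path of a cyclic word through `g` of a function on the edges, edges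
being counted with alternating signs. -/
noncomputable def chain (g : K) : (K → R) →ₗ[R] R :=
  ∑ j ∈ Finset.range (orderOf (w.val α β) * w.len),
    (LinearMap.proj (R := R) (φ := fun _ => R) (w.pre α β j * g) -
      LinearMap.proj (R := R) (φ := fun _ => R) (w.odd α β j * g))

theorem chain_apply (g : K) (f : K → R) :
    w.chain α β R g f = ∑ j ∈ Finset.range (orderOf (w.val α β) * w.len),
      (f (w.pre α β j * g) - f (w.odd α β j * g)) := by
  simp [chain, LinearMap.sum_apply]

variable {w α β}

theorem period_pos [Finite K] : 0 < orderOf (w.val α β) * w.len :=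
  Nat.mul_pos (orderOf_pos _) (Nat.pos_of_ne_zero (NeZero.ne _))

variable [Finite K] [DecidableEq K] (h : w.IsSimple α β) (g : K)
include h

theorem IsSimple.chain_single_pre (i : ℕ) :
    w.chain α β R g (Pi.single (w.pre α β i * g) 1) = 1 := by
  rw [chain_apply, Finset.sum_eq_single (i % (orderOf (w.val α β) * w.len))]
  · have h1 : w.pre α β (i % (orderOf (w.val α β) * w.len)) = w.pre α β i :=
      h.pre_eq_iff.2 (Nat.mod_modEq _ _)
    rw [h1, Pi.single_eq_same, Pi.single_eq_of_ne, sub_zero]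
    exact fun he => h.pre_ne_odd _ _ (mul_right_cancel he).symm
  · intro j hj hji
    rw [Pi.single_eq_of_ne, Pi.single_eq_of_ne, sub_zero]
    · exact fun he => h.pre_ne_odd _ _ (mul_right_cancel he).symm
    · intro he
      have := h.pre_eq_iff.1 (mul_right_cancel he)
      exact hji (by rw [← this, Nat.mod_eq_of_lt (Finset.mem_range.1 hj)])
  · intro hi
    exact absurd (Finset.mem_range.2 (Nat.mod_lt _ period_pos)) hi

theorem IsSimple.chain_single_odd (i : ℕ) :
    w.chain α β R g (Pi.single (w.odd α β i * g) 1) = -1 := by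
  rw [chain_apply, Finset.sum_eq_single (i % (orderOf (w.val α β) * w.len))]
  · have h1 : w.odd α β (i % (orderOf (w.val α β) * w.len)) = w.odd α β i :=
      h.odd_eq_iff.2 (Nat.mod_modEq _ _)
    rw [h1, Pi.single_eq_same, Pi.single_eq_of_ne, zero_sub]
    exact fun he => h.pre_ne_odd _ _ (mul_right_cancel he)
  · intro j hj hji
    rw [Pi.single_eq_of_ne, Pi.single_eq_of_ne, sub_zero]
    · intro he
      have := h.odd_eq_iff.1 (mul_right_cancel he)
      exact hji (by rw [← this, Nat.mod_eq_of_lt (Finset.mem_range.1 hj)])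
    · exact fun he => h.pre_ne_odd _ _ (mul_right_cancel he)
  · intro hi
    exact absurd (Finset.mem_range.2 (Nat.mod_lt _ period_pos)) hi

omit h [Finite K] in
theorem chain_single_cases (x : K) :
    (∃ i, x = w.pre α β i * g) ∨ (∃ i, x = w.odd α β i * g) ∨
      w.chain α β R g (Pi.single x 1) = 0 := by
  by_contra! hx
  refine hx.2.2 ?_
  rw [chain_apply]
  refine Finset.sum_eq_zero fun j _ => ?_
  rw [Pi.single_eq_of_ne (hx.1 j).symm, Pi.single_eq_of_ne (hx.2.1 j).symm, sub_zero]

end Chain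

/-- Equalities between the letters of `u` and the letters of `v` and their inverses are detected
by `α` and `β`. -/
structure Separates (u v : CyclicWord A B) {K : Type*} [Group K] (α : A →* K) (β : B →* K) :
    Prop where
  left : ∀ i j, α (u.left i) = α (v.left j) → u.left i = v.left j
  left_inv : ∀ i j, α (u.left i) = α (v.left j)⁻¹ → u.left i = (v.left j)⁻¹
  right : ∀ i j, β (u.right i) = β (v.right j) → u.right i = v.right j
  right_inv : ∀ i j, β (u.right i) = β (v.right j)⁻¹ → u.right i = (v.right j)⁻¹

section Matching

variable {u v : CyclicWord A B} {K : Type*} [Group K] {α : A →* K} {β : B →* K}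
  {K' : Type*} [Group K'] (α' : A →* K') (β' : B →* K')

theorem isConj_pow_of_letters_eq {J : ℕ}
    (hJ : ∀ i : ℕ, u.left i = v.left (J + i : ℕ) ∧ u.right i = v.right (J + i : ℕ)) {s t : ℕ}
    (hst : s * u.len = t * v.len) : IsConj (u.val α' β' ^ s) (v.val α' β' ^ t) := by
  have key : ∀ i, u.pre α' β' i * v.pre α' β' J = v.pre α' β' (J + i) := by
    intro i
    induction i with
    | zero => simp
    | succ i ih =>
      rw [pre_succ, odd, mul_assoc, mul_assoc, ih, (hJ i).1, (hJ i).2]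
      rfl
  have h1 := key (s * u.len)
  rw [pre_mul_len, hst, pre_add_mul_len] at h1
  rw [isConj_comm, isConj_iff]
  exact ⟨v.pre α' β' J, by rw [← h1, mul_inv_cancel_right]⟩

theorem isConj_pow_inv_of_letters_eq {J : ℕ}
    (hJ : ∀ i < J, u.left i = (v.left (J - i : ℕ))⁻¹ ∧
      u.right i = (v.right (J - (i + 1) : ℕ))⁻¹) {s t : ℕ}
    (hst : s * u.len = t * v.len) (htJ : t * v.len ≤ J) :
    IsConj (u.val α' β' ^ s) (v.val α' β' ^ t)⁻¹ := by
  have key : ∀ i ≤ J, u.pre α' β' i * v.odd α' β' J = v.odd α' β' (J - i) := by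
    intro i
    induction i with
    | zero => simp
    | succ i ih =>
      intro hi
      have h1 : v.odd α' β' (J - i) = α' (v.left (J - i : ℕ)) *
          (β' (v.right (J - (i + 1) : ℕ)) * v.odd α' β' (J - (i + 1))) := by
        rw [← pre_succ, odd, Nat.sub_add_eq, Nat.sub_add_cancel (by omega)]
      rw [pre_succ, odd, mul_assoc, mul_assoc, ih (by omega), (hJ i hi).1, (hJ i hi).2, h1]
      simp
  have h1 := key _ (hst.le.trans htJ)
  obtain ⟨d, rfl⟩ := Nat.exists_eq_add_of_le' htJ
  rw [pre_mul_len, hst, Nat.add_sub_cancel, odd_add_mul_len] at h1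
  rw [isConj_comm, isConj_iff]
  exact ⟨v.odd α' β' d, by rw [mul_inv_eq_iff_eq_mul, ← mul_inv_eq_iff_eq_mul.2 h1.symm]; group⟩

variable [Finite K] {R : Type*} [Field R] (hu : u.IsSimple α β) (hv : v.IsSimple α β)
  (huv : u.Separates v α β)
include hu hv huv

theorem exists_letters_eq (g : K) (hc : u.chain α β R g = v.chain α β R 1) (hR : (1 : R) ≠ -1) :
    ∃ J : ℕ, ∀ i : ℕ, u.left i = v.left (J + i : ℕ) ∧ u.right i = v.right (J + i : ℕ) := by
  classical
  have hpre : ∀ i, ∃ j, u.pre α β i * g = v.pre α β j := by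
    intro i
    have h1 := hu.chain_single_pre R g i
    rw [hc] at h1
    obtain ⟨j, hj⟩ | ⟨j, hj⟩ | h2 := v.chain_single_cases (α := α) (β := β) R 1 (u.pre α β i * g)
    · exact ⟨j, by simpa using hj⟩
    · rw [hj, hv.chain_single_odd R] at h1
      exact absurd h1.symm hR
    · exact absurd (h1.symm.trans h2) one_ne_zero
  have hodd : ∀ i, ∃ j, u.odd α β i * g = v.odd α β j := by
    intro i
    have h1 := hu.chain_single_odd R g i
    rw [hc] at h1
    obtain ⟨j, hj⟩ | ⟨j, hj⟩ | h2 := v.chain_single_cases (α := α) (β := β) R 1 (u.odd α β i * g)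
    · rw [hj, hv.chain_single_pre R] at h1
      exact absurd h1 hR
    · exact ⟨j, by simpa using hj⟩
    · exact absurd (h2.symm.trans h1) (by simp)
  have hleft : ∀ i J, u.pre α β i * g = v.pre α β J →
      u.odd α β i * g = v.odd α β J ∧ u.left i = v.left J := by
    intro i J h
    obtain ⟨j, hj⟩ := hodd i
    have h1 : v.odd α β j = α (u.left i) * v.pre α β J := by rw [← hj, odd, mul_assoc, h]
    obtain ⟨h2, h3⟩ := hv.odd_eq_left h1
    exact ⟨hj.trans h2, huv.left _ _ h3⟩
  have hright : ∀ i J, u.odd α β i * g = v.odd α β J →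
      u.pre α β (i + 1) * g = v.pre α β (J + 1) ∧ u.right i = v.right J := by
    intro i J h
    obtain ⟨j, hj⟩ := hpre (i + 1)
    have hj' : u.pre α β (i + 1) * g = v.pre α β (j + orderOf (v.val α β) * v.len) := by
      rw [hj, hv.pre_eq_iff]
      simp
    obtain ⟨k, hk⟩ := Nat.exists_eq_succ_of_ne_zero (n := j + orderOf (v.val α β) * v.len)
      (by have := v.period_pos (α := α) (β := β); omega)
    rw [hk] at hj'
    have h1 : v.pre α β (k + 1) = β (u.right i) * v.odd α β J := by
      rw [← hj', pre_succ, mul_assoc, h]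
    obtain ⟨h2, h3⟩ := hv.pre_succ_eq_right h1
    exact ⟨hj'.trans h2, huv.right _ _ h3⟩
  obtain ⟨J, hJ⟩ := hpre 0
  have key : ∀ i, u.pre α β i * g = v.pre α β (J + i) := by
    intro i
    induction i with
    | zero => exact hJ
    | succ i ih => exact (hright _ _ (hleft _ _ ih).1).1
  exact ⟨J, fun i => ⟨(hleft _ _ (key i)).2, (hright _ _ (hleft _ _ (key i)).1).2⟩⟩

theorem exists_letters_eq_inv (g : K) (hc : u.chain α β R g = -v.chain α β R 1)
    (hR : (1 : R) ≠ -1) (N : ℕ) :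
    ∃ J ≥ N, ∀ i < J, u.left i = (v.left (J - i : ℕ))⁻¹ ∧
      u.right i = (v.right (J - (i + 1) : ℕ))⁻¹ := by
  classical
  have hpre : ∀ i, ∃ j, u.pre α β i * g = v.odd α β j := by
    intro i
    have h1 := hu.chain_single_pre R g i
    rw [hc, LinearMap.neg_apply] at h1
    obtain ⟨j, hj⟩ | ⟨j, hj⟩ | h2 := v.chain_single_cases (α := α) (β := β) R 1 (u.pre α β i * g)
    · rw [hj, hv.chain_single_pre R] at h1
      exact absurd h1.symm hR
    · exact ⟨j, by simpa using hj⟩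
    · rw [h2, neg_zero] at h1
      exact absurd h1.symm one_ne_zero
  have hodd : ∀ i, ∃ j, u.odd α β i * g = v.pre α β j := by
    intro i
    have h1 := hu.chain_single_odd R g i
    rw [hc, LinearMap.neg_apply, neg_inj] at h1
    obtain ⟨j, hj⟩ | ⟨j, hj⟩ | h2 := v.chain_single_cases (α := α) (β := β) R 1 (u.odd α β i * g)
    · exact ⟨j, by simpa using hj⟩
    · rw [hj, hv.chain_single_odd R] at h1
      exact absurd h1.symm hR
    · exact absurd (h1.symm.trans h2) one_ne_zero
  have hleft : ∀ i J, u.pre α β i * g = v.odd α β J →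
      u.odd α β i * g = v.pre α β J ∧ u.left i = (v.left J)⁻¹ := by
    intro i J h
    obtain ⟨j, hj⟩ := hodd i
    have h1 : v.pre α β j = α (u.left i * v.left J) * v.pre α β J := by
      rw [← hj, odd, mul_assoc, h, map_mul, odd, mul_assoc]
    obtain ⟨-, h2, h3⟩ := hv.pre_eq_of_pre_eq_left h1
    refine ⟨hj.trans h2.symm, huv.left_inv _ _ ?_⟩
    rwa [map_inv, ← mul_eq_one_iff_eq_inv, ← map_mul]
  have hright : ∀ i J, u.odd α β i * g = v.pre α β (J + 1) →
      u.pre α β (i + 1) * g = v.odd α β J ∧ u.right i = (v.right J)⁻¹ := by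
    intro i J h
    obtain ⟨j, hj⟩ := hpre (i + 1)
    have h1 : v.odd α β j = β (u.right i * v.right J) * v.odd α β J := by
      rw [← hj, pre_succ, mul_assoc, h, map_mul, pre_succ, mul_assoc]
    obtain ⟨h2, h3⟩ := hv.odd_eq_right h1
    refine ⟨hj.trans h2, huv.right_inv _ _ ?_⟩
    rwa [map_inv, ← mul_eq_one_iff_eq_inv, ← map_mul]
  obtain ⟨J₀, hJ₀⟩ := hpre 0
  have hJ : ∃ J ≥ N, u.pre α β 0 * g = v.odd α β J := by
    refine ⟨J₀ + N * (orderOf (v.val α β) * v.len), ?_, ?_⟩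
    · exact (Nat.le_mul_of_pos_right N period_pos).trans (Nat.le_add_left _ _)
    · rw [hJ₀, hv.odd_eq_iff]
      simp
  obtain ⟨J, hJN, hJ⟩ := hJ
  have key : ∀ i ≤ J, u.pre α β i * g = v.odd α β (J - i) := by
    intro i
    induction i with
    | zero => exact fun _ => hJ
    | succ i ih =>
      intro hi
      have h1 := (hleft _ _ (ih (by omega))).1
      rw [← Nat.sub_add_cancel (show 1 ≤ J - i by omega)] at h1
      exact (hright _ _ h1).1
  refine ⟨J, hJN, fun i hi => ?_⟩
  obtain ⟨h1, h2⟩ := hleft _ _ (key i hi.le)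
  refine ⟨h2, (hright i _ ?_).2⟩
  rw [h1]
  congr 1
  omega

/-- If the closed paths of two cyclic words have proportional alternating sums, then the cyclic
words have conjugate powers, up to inversion. -/
theorem isConj_of_chain_eq_smul (g : K) (r : R) (hc : u.chain α β R g = r • v.chain α β R 1)
    (hR : (1 : R) ≠ -1) {s t : ℕ} (hst : s * u.len = t * v.len) :
    IsConj (u.val α' β' ^ s) (v.val α' β' ^ t) ∨ IsConj (u.val α' β' ^ s) (v.val α' β' ^ t)⁻¹ := by
  classical
  have h1 := hu.chain_single_pre R g 0
  rw [hc, LinearMap.smul_apply, smul_eq_mul] at h1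
  obtain ⟨j, hj⟩ | ⟨j, hj⟩ | h2 := v.chain_single_cases (α := α) (β := β) R 1 (u.pre α β 0 * g)
  · rw [hj, hv.chain_single_pre R, mul_one] at h1
    rw [h1, one_smul] at hc
    obtain ⟨J, hJ⟩ := exists_letters_eq hu hv huv g hc hR
    exact Or.inl (isConj_pow_of_letters_eq α' β' hJ hst)
  · rw [hj, hv.chain_single_odd R, mul_neg_one, neg_eq_iff_eq_neg] at h1
    replace hc : u.chain α β R g = -v.chain α β R 1 := LinearMap.ext fun f => by
      rw [hc, h1, LinearMap.smul_apply, LinearMap.neg_apply, neg_smul, one_smul]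
    obtain ⟨J, hJN, hJ⟩ := exists_letters_eq_inv hu hv huv g hc hR (t * v.len)
    exact Or.inr (isConj_pow_inv_of_letters_eq α' β' hJ hst hJN)
  · rw [h2, mul_zero] at h1
    exact absurd h1.symm one_ne_zero

end Matching

section Layers

variable {Q : Type} [Group Q] (w : CyclicWord A B) (α : A →* Q) (β : B →* Q)

theorem pre_regular_apply (i : ℕ) (g : Q) :
    w.pre ((MulAction.toPermHom Q Q).comp α) ((MulAction.toPermHom Q Q).comp β) i g =
      w.pre α β i * g := by
  rw [← map_pre]
  rfl

theorem odd_regular_apply (i : ℕ) (g : Q) :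
    w.odd ((MulAction.toPermHom Q Q).comp α) ((MulAction.toPermHom Q Q).comp β) i g =
      w.odd α β i * g := by
  rw [odd, Equiv.Perm.mul_apply, pre_regular_apply, odd, mul_assoc]
  rfl

theorem toPermHom_injective (Q : Type*) [Group Q] :
    Function.Injective (MulAction.toPermHom Q Q) := fun x y h => by
  simpa using congrArg (fun σ : Equiv.Perm Q => σ 1) h

theorem val_regular :
    w.val ((MulAction.toPermHom Q Q).comp α) ((MulAction.toPermHom Q Q).comp β) =
      MulAction.toPermHom Q Q (w.val α β) := (w.map_val α β _).symm

theorem orderOf_val_regular :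
    orderOf (w.val ((MulAction.toPermHom Q Q).comp α) ((MulAction.toPermHom Q Q).comp β)) =
      orderOf (w.val α β) := by
  rw [val_regular, orderOf_injective _ (toPermHom_injective Q)]

theorem drift_regular {R : Type*} [CommRing R] (m : Q → R) (g : Q) :
    w.drift ((MulAction.toPermHom Q Q).comp α) ((MulAction.toPermHom Q Q).comp β) m
      (orderOf (w.val α β) * w.len) g = w.chain α β R g m := by
  rw [drift_of_pre_eq, chain_apply]
  · simp only [pre_regular_apply, odd_regular_apply]
  · rw [pre_regular_apply, pre_mul_len, pow_orderOf_eq_one, one_mul]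

theorem drift_mul_len {Y C : Type*} [AddCommGroup C] (α : A →* Equiv.Perm Y)
    (β : B →* Equiv.Perm Y) (m : Y → C) (k n : ℕ) (y : Y) :
    w.drift α β m (n * (k * w.len)) y =
      ∑ r ∈ Finset.range n, w.drift α β m (k * w.len) ((w.val α β ^ (r * k)) y) := by
  induction n with
  | zero => simp [drift]
  | succ n ih =>
    rw [Finset.sum_range_succ, ← ih, Nat.succ_mul, drift, drift, drift, Finset.sum_range_add]
    congr 1
    refine Finset.sum_congr rfl fun x _ => ?_
    rw [add_comm (n * (k * w.len)) x, add_right_comm, ← mul_assoc, pre_add_mul_len,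
      odd_add_mul_len]
    rfl

theorem sum_range_add_mul_zmod {q : ℕ} [Fact q.Prime] {C : Type*} [AddCommMonoid C]
    (f : ZMod q → C) (t : ZMod q) {d : ZMod q} (hd : d ≠ 0) :
    ∑ r ∈ Finset.range q, f (t + r * d) = ∑ z, f z := by
  rw [← ((Equiv.mulRight₀ d hd).trans (Equiv.addLeft t)).sum_comp f]
  exact Finset.sum_nbij' (fun r => (r : ZMod q)) ZMod.val (by simp)
    (fun z _ => Finset.mem_range.2 z.val_lt)
    (fun r hr => ZMod.val_cast_of_lt (Finset.mem_range.1 hr)) (by simp) (by simp)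

theorem exists_dvd_orderOf_val [Finite Q] (M : ℕ) (hM : M ≠ 0) :
    ∃ (X : Type) (_ : Finite X) (α' : A →* Equiv.Perm X) (β' : B →* Equiv.Perm X),
      (∀ x, orderOf (α' x) = orderOf (α x)) ∧ (∀ x, orderOf (β' x) = orderOf (β x)) ∧
      (∀ w : CyclicWord A B, w.val α' β' ^ (Nat.card Q * M) = 1) ∧
      ∀ w : CyclicWord A B, w.IsSimple α β → M ∣ orderOf (w.val α' β') := by
  classical
  have : NeZero M := ⟨hM⟩
  set ρ := MulAction.toPermHom Q Q
  refine ⟨Q × ZMod M, inferInstance, (permProd Q (ZMod M)).comp (ρ.comp α),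
    twist (ρ.comp β) (Pi.single 1 1), fun x => ?_, fun x => ?_, fun w => ?_, fun w hw => ?_⟩
  · rw [orderOf_permProd_comp]
    exact orderOf_injective _ (toPermHom_injective Q) _
  · rw [orderOf_twist]
    exact orderOf_injective _ (toPermHom_injective Q) _
  · apply val_twist_pow_mul_eq_one
    rw [val_regular, ← map_pow, pow_card_eq_one', map_one]
  · refine w.dvd_orderOf_val_twist _ _ _ (orderOf (w.val α β)) ?_ 1 ?_ ?_
    · rw [orderOf_val_regular]
    · rw [← pre_mul_len, pre_regular_apply, pre_mul_len, pow_orderOf_eq_one, one_mul]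
    · rw [drift_regular]
      simpa using hw.chain_single_pre (ZMod M) 1 0

end Layers

section Separation

variable {Q : Type} [Group Q] [Finite Q] {α : A →* Q} {β : B →* Q}

/-- If the closed paths of `u` and `v` do not have proportional alternating sums, then the order
of the value of `v` can be made divisible by `p`, while a power of the value of `u` not depending on
`p` becomes trivial. -/
theorem exists_dvd_orderOf_val_and_pow_eq_one {u v : CyclicWord A B} (hv : v.IsSimple α β)
    {q : ℕ} (hq : q.Prime) (hQ : Nat.card Q < q)
    (huv : ∀ (g : Q) (r : ZMod q), u.chain α β (ZMod q) g ≠ r • v.chain α β (ZMod q) 1)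
    (p : ℕ) (hp : p ≠ 0) :
    ∃ (X : Type) (_ : Finite X) (α' : A →* Equiv.Perm X) (β' : B →* Equiv.Perm X),
      (∀ x, orderOf (α' x) = orderOf (α x)) ∧ (∀ x, orderOf (β' x) = orderOf (β x)) ∧
      (∀ w : CyclicWord A B, w.val α' β' ^ (Nat.card Q * q * p) = 1) ∧
      p ∣ orderOf (v.val α' β') ∧ u.val α' β' ^ (Nat.card Q * q) = 1 := by
  classical
  have : NeZero p := ⟨hp⟩
  have : Fact q.Prime := ⟨hq⟩
  obtain ⟨l, hl₀, hl⟩ := exists_mem_ker_forall_ne_zero (v.chain α β (ZMod q) 1)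
    (fun g => u.chain α β (ZMod q) g) huv (by simpa using hQ)
  set ρ := MulAction.toPermHom Q Q with hρ
  let α₁ := (permProd Q (ZMod q)).comp (ρ.comp α)
  let β₁ := twist (ρ.comp β) l
  let m : Q × ZMod q → ZMod p := fun y =>
    if y.1 = 1 then (if y.2 = 0 then 1 else 0) - (if y.2 = 1 then 1 else 0) else 0
  have hm : ∀ x, ∑ z, m (x, z) = 0 := by
    intro x
    by_cases hx : x = 1 <;> simp [m, hx]
  have hpow : ∀ w : CyclicWord A B, w.val α₁ β₁ ^ (Nat.card Q * q) = 1 := fun w => by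
    apply val_twist_pow_mul_eq_one
    rw [val_regular, ← map_pow, pow_card_eq_one', map_one]
  have hval : ∀ (w : CyclicWord A B) (g : Q) (s : ZMod q),
      (w.val α₁ β₁ ^ orderOf (w.val α β)) (g, s) = (g, s + w.chain α β (ZMod q) g l) := by
    intro w g s
    rw [val_twist_pow_apply, drift_regular, ← pre_mul_len, pre_regular_apply, pre_mul_len,
      pow_orderOf_eq_one, one_mul]
  refine ⟨(Q × ZMod q) × ZMod p, inferInstance, (permProd _ (ZMod p)).comp α₁,
    twist β₁ m, fun x => ?_, fun x => ?_, fun w => ?_, ?_, ?_⟩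
  · rw [orderOf_permProd_comp, orderOf_permProd_comp]
    exact orderOf_injective _ (toPermHom_injective Q) _
  · rw [orderOf_twist, orderOf_twist]
    exact orderOf_injective _ (toPermHom_injective Q) _
  · exact w.val_twist_pow_mul_eq_one _ _ _ _ (hpow w)
  · have h1 : (v.val α₁ β₁ ^ orderOf (v.val α β)) (1, 0) = (1, 0) := by simp [hval, hl₀]
    refine v.dvd_orderOf_val_twist _ _ _ (orderOf (v.val α β)) ?_ (1, 0) h1 ?_
    · rw [← orderOf_val_regular]
      exact orderOf_dvd_of_pow_eq_one (v.val_pow_eq_one_of_twist _ _ _ _ (pow_orderOf_eq_one _))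
    · rw [drift_of_pre_eq _ _ _ _ _ _ (by rw [pre_mul_len, h1]), Finset.sum_eq_single 0]
      · have h2 := hv.pre_ne_odd 0 0
        rw [odd_twist_apply, odd_regular_apply]
        simp only [pre_zero, ne_eq] at h2
        simp [m, Ne.symm h2]
      · intro j hj hj0
        have h2 := hv.pre_ne_odd 0 j
        have h3 : v.pre α β j ≠ 1 := fun h => by
          have h4 : v.pre α β j = v.pre α β 0 := by simpa using h
          have h5 := hv.pre_eq_iff.1 h4
          rw [Nat.ModEq, Nat.mod_eq_of_lt (Finset.mem_range.1 hj), Nat.zero_mod] at h5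
          exact hj0 h5
        rw [odd_twist_apply, odd_regular_apply, pre_twist_apply, pre_regular_apply]
        simp only [pre_zero, ne_eq] at h2
        simp [m, Ne.symm h2, h3]
      · intro h
        exact absurd (Finset.mem_range.2 period_pos) h
  · obtain ⟨c, hc⟩ := orderOf_dvd_natCard (u.val α β)
    have h1 : Nat.card Q * q = q * orderOf (u.val α β) * c := by rw [hc]; ring
    suffices h : u.val ((permProd _ (ZMod p)).comp α₁) (twist β₁ m) ^
        (q * orderOf (u.val α β)) = 1 by rw [h1, pow_mul, h, one_pow]
    have hr : ∀ (r : ℕ) (g : Q) (s : ZMod q), (u.val α₁ β₁ ^ (r * orderOf (u.val α β))) (g, s) =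
        (g, s + r * u.chain α β (ZMod q) g l) := by
      intro r g s
      rw [mul_comm, pow_mul]
      induction r with
      | zero => simp
      | succ r ih =>
        rw [pow_succ', Equiv.Perm.mul_apply, ih, hval]
        push_cast
        rw [add_mul, one_mul, add_assoc]
    ext1 ⟨⟨g, s⟩, t⟩
    rw [val_twist_pow_apply, hr, mul_assoc, drift_mul_len]
    have h2 : ∑ r ∈ Finset.range q, u.drift α₁ β₁ m (orderOf (u.val α β) * u.len)
        ((u.val α₁ β₁ ^ (r * orderOf (u.val α β))) (g, s)) = 0 := by
      simp only [hr, drift]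
      rw [Finset.sum_comm]
      refine Finset.sum_eq_zero fun j _ => ?_
      rw [Finset.sum_sub_distrib]
      have h3 : ∀ (x : Q) (c : ZMod q), ∑ r ∈ Finset.range q,
          m (x, s + r * u.chain α β (ZMod q) g l + c) = 0 := by
        intro x c
        simp only [add_right_comm s _ c]
        rw [sum_range_add_mul_zmod (fun z => m (x, z)) (s + c) (hl g), hm]
      simp only [α₁, β₁, pre_twist_apply, odd_twist_apply]
      rw [h3, h3, sub_zero]
    rw [h2]
    simp

end Separation

end CyclicWord

section NormalForm

open Monoid.Coprod (inl inr)

variable {A B : Type*} [Group A] [Group B]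

/-- The product in the free product of a list of syllable pairs. -/
def syllableProd (l : List (B × A)) : Monoid.Coprod A B :=
  (l.map fun p => inr p.1 * inl p.2).prod

@[simp]
theorem syllableProd_cons (p : B × A) (l : List (B × A)) :
    syllableProd (p :: l) = inr p.1 * inl p.2 * syllableProd l := by
  simp [syllableProd]

@[simp]
theorem syllableProd_nil : syllableProd ([] : List (B × A)) = 1 := rfl

@[simp]
theorem syllableProd_append (l l' : List (B × A)) :
    syllableProd (l ++ l') = syllableProd l * syllableProd l' := by
  simp [syllableProd]

theorem exists_syllableProd_eq (x : Monoid.Coprod A B) : ∃ l, syllableProd l = x := by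
  induction x using Monoid.Coprod.induction_on' with
  | one => exact ⟨[], rfl⟩
  | inl_mul a x ih =>
    obtain ⟨l, rfl⟩ := ih
    exact ⟨(1, a) :: l, by simp⟩
  | inr_mul b x ih =>
    obtain ⟨l, rfl⟩ := ih
    exact ⟨(b, 1) :: l, by simp⟩

theorem isConj_mul_comm {G : Type*} [Group G] (x y : G) : IsConj (x * y) (y * x) :=
  isConj_iff.2 ⟨y, by group⟩

theorem exists_cyclicWord_val_eq (l : List (B × A)) (hl : l ≠ [])
    (h : ∀ p ∈ l, p.1 ≠ 1 ∧ p.2 ≠ 1) :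
    ∃ w : CyclicWord A B, w.val inl inr = syllableProd l.reverse := by
  have hlen : NeZero l.length := ⟨by simpa using hl⟩
  let w : CyclicWord A B :=
    { len := l.length
      left := fun i => (l[i.val]'(ZMod.val_lt i)).2
      right := fun i => (l[i.val]'(ZMod.val_lt i)).1
      left_ne_one := fun i => (h _ (List.getElem_mem _)).2
      right_ne_one := fun i => (h _ (List.getElem_mem _)).1 }
  have key : ∀ i ≤ l.length, w.pre inl inr i = syllableProd (l.take i).reverse := by
    intro i
    induction i with
    | zero => simp
    | succ i ih =>
      intro hi
      have h1 : ((i : ZMod l.length)).val = i := ZMod.val_natCast_of_lt hi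
      have h2 : w.left i = (l[i]).2 := by simp only [w, h1]
      have h3 : w.right i = (l[i]).1 := by simp only [w, h1]
      rw [CyclicWord.pre_succ, CyclicWord.odd, ih (by omega), h2, h3,
        List.take_succ_eq_append_getElem hi, List.reverse_append, List.reverse_singleton,
        List.singleton_append, syllableProd_cons, mul_assoc]
  refine ⟨w, ?_⟩
  have := key l.length le_rfl
  rwa [List.take_length] at this

/-- Every element of a free product is conjugate to an element of a factor or to a cyclically
reduced word. -/
theorem isConj_inl_or_inr_or_cyclicWord (x : Monoid.Coprod A B) :
    (∃ a, IsConj x (inl a)) ∨ (∃ b, IsConj x (inr b)) ∨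
      ∃ w : CyclicWord A B, IsConj x (w.val inl inr) := by
  obtain ⟨l, rfl⟩ := exists_syllableProd_eq x
  induction hn : l.length using Nat.strong_induction_on generalizing l with
  | _ n ih =>
    subst hn
    have step : ∀ l', l'.length < l.length → IsConj (syllableProd l) (syllableProd l') →
        (∃ a, IsConj (syllableProd l) (inl a)) ∨ (∃ b, IsConj (syllableProd l) (inr b)) ∨
          ∃ w : CyclicWord A B, IsConj (syllableProd l) (w.val inl inr) := by
      intro l' hl' hc
      exact (ih _ hl' l' rfl).imp (fun ⟨a, ha⟩ => ⟨a, hc.trans ha⟩)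
        (Or.imp (fun ⟨b, hb⟩ => ⟨b, hc.trans hb⟩) fun ⟨w, hw⟩ => ⟨w, hc.trans hw⟩)
    by_cases hl : ∀ p ∈ l, p.1 ≠ 1 ∧ p.2 ≠ 1
    · by_cases hnil : l = []
      · subst hnil
        exact Or.inl ⟨1, by simp⟩
      · obtain ⟨w, hw⟩ := exists_cyclicWord_val_eq l.reverse (by simpa using hnil)
          fun p hp => hl p (by simpa using hp)
        rw [List.reverse_reverse] at hw
        exact Or.inr (Or.inr ⟨w, by rw [hw]⟩)
    · push Not at hl
      obtain ⟨⟨b, a⟩, hp, hba⟩ := hl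
      obtain ⟨l₁, l₂, rfl⟩ := List.append_of_mem hp
      have hc : IsConj (syllableProd (l₁ ++ (b, a) :: l₂))
          (inr b * inl a * syllableProd (l₂ ++ l₁)) := by
        simpa [mul_assoc] using isConj_mul_comm (syllableProd l₁) (syllableProd ((b, a) :: l₂))
      have hlen : (l₁ ++ (b, a) :: l₂).length = (l₂ ++ l₁).length + 1 := by
        simp only [List.length_append, List.length_cons]
        omega
      rw [hlen] at step
      generalize syllableProd (l₁ ++ (b, a) :: l₂) = x at hc step ⊢
      generalize l₂ ++ l₁ = t at hc step
      by_cases hb : b = 1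
      · subst hb
        obtain rfl | ⟨t, ⟨b', a'⟩, rfl⟩ := t.eq_nil_or_concat
        · exact Or.inl ⟨a, by simpa using hc⟩
        · refine step (t ++ [(b', a' * a)]) (by simp) (hc.trans ?_)
          simpa [mul_assoc] using isConj_mul_comm (inl a) (syllableProd (t ++ [(b', a')]))
      · obtain rfl : a = 1 := hba hb
        obtain _ | ⟨⟨b', a'⟩, t⟩ := t
        · exact Or.inr (Or.inl ⟨b, by simpa using hc⟩)
        · exact step ((b * b', a') :: t) (by simp) (by simpa [mul_assoc] using hc)

end NormalForm

section Main

open Monoid.Coprod (inl inr)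

variable {A B : Type*} [Group A] [Group B]

theorem exists_primes (ι : Type*) [Finite ι] (N : ℕ) :
    ∃ p : ι → ℕ, Function.Injective p ∧ (∀ i, (p i).Prime) ∧ ∀ i, N < p i := by
  refine ⟨fun i => Nat.nth Nat.Prime (N + Finite.equivFin ι i), fun i j h => ?_, fun i => ?_,
    fun i => ?_⟩
  · have := Nat.nth_injective Nat.infinite_setOfPred_prime h
    exact (Finite.equivFin ι).injective (Fin.ext (by omega))
  · exact Nat.prime_nth_prime _
  · have := Nat.add_two_le_nth_prime (N + Finite.equivFin ι i)
    exact lt_of_lt_of_le (by omega) this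

/-- Finite quotients of the factors in which the orders of the elements of given finite sets are
kept apart and which are faithful on another given finite set. -/
theorem exists_hom_pair (hA : ∀ n : ℕ, 0 < n → OrderSeparable A n)
    (hB : ∀ n : ℕ, 0 < n → OrderSeparable B n)
    (hord : ∀ (a : A) (b : B), a ≠ 1 → b ≠ 1 →
      IsOfFinOrder a → IsOfFinOrder b → orderOf a ≠ orderOf b)
    (S : Finset A) (T : Finset B) :
    ∃ (A' B' : Type) (_ : Group A') (_ : Group B') (_ : Finite A') (_ : Finite B')
      (φ : A →* A') (ψ : B →* B'),
      (∀ x ∈ S, ∀ y ∈ S, ¬ ConjInv x y → orderOf (φ x) ≠ orderOf (φ y)) ∧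
      (∀ x ∈ T, ∀ y ∈ T, ¬ ConjInv x y → orderOf (ψ x) ≠ orderOf (ψ y)) ∧
      (∀ x ∈ S, ∀ y ∈ T, x ≠ 1 ∨ y ≠ 1 → orderOf (φ x) ≠ orderOf (ψ y)) ∧
      (∀ x ∈ S, x ≠ 1 → φ x ≠ 1) ∧ ∀ x ∈ T, x ≠ 1 → ψ x ≠ 1 := by
  obtain ⟨A', _, _, φ, hφ, hφ₁, hφfin, hφinf⟩ := exists_hom_finite hA S (T.sup orderOf)
  obtain ⟨B', _, _, ψ, hψ, hψ₁, hψfin, hψinf⟩ := exists_hom_finite hB T (Nat.card A')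
  refine ⟨A', B', inferInstance, inferInstance, inferInstance, inferInstance, φ, ψ, hφ, hψ,
    fun x hx y hy hxy h => ?_, hφ₁, hψ₁⟩
  have hx1 : x ≠ 1 := by
    rintro rfl
    rw [map_one, orderOf_one, eq_comm, orderOf_eq_one_iff] at h
    exact hψ₁ y hy (by simpa using hxy) h
  have hy1 : y ≠ 1 := by
    rintro rfl
    rw [map_one, orderOf_one, orderOf_eq_one_iff] at h
    exact hφ₁ x hx hx1 h
  by_cases hyf : IsOfFinOrder y
  · rw [hψfin y hy hyf] at h
    by_cases hxf : IsOfFinOrder x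
    · rw [hφfin x hx hxf] at h
      exact hord x y hx1 hy1 hxf hyf h
    · have h1 := hφinf x hx hxf
      rw [h] at h1
      exact h1.not_ge (Finset.le_sup hy)
  · have h1 := hψinf y hy hyf
    rw [← h] at h1
    exact h1.not_ge (Nat.le_of_dvd Nat.card_pos (orderOf_dvd_natCard _))

/-- Finitely many cyclic words label simple closed paths in a common finite quotient, in which the
orders of the elements of the factors are as in given quotients of the factors. -/
theorem exists_isSimple {ι : Type} [Finite ι] (w : ι → CyclicWord A B) {A' B' : Type} [Group A']
    [Group B'] [Finite A'] [Finite B'] (φ : A →* A') (ψ : B →* B')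
    (hφ : ∀ i j, φ ((w i).left j) ≠ 1) (hψ : ∀ i j, ψ ((w i).right j) ≠ 1) :
    ∃ (Q : Type) (_ : Group Q) (_ : Finite Q) (f : A' →* Q) (g : B' →* Q),
      Function.Injective f ∧ Function.Injective g ∧
      ∀ i, (w i).IsSimple (f.comp φ) (g.comp ψ) := by
  choose X hX α β hα hβ hw using fun i => (w i).exists_isSimple_perm φ ψ (hφ i) (hψ i)
  refine ⟨(∀ i, Equiv.Perm (X i)) × A' × B', inferInstance, inferInstance,
    (MonoidHom.pi α).prod (MonoidHom.inl A' B'), (MonoidHom.pi β).prod (MonoidHom.inr A' B'),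
    fun x y h => ?_, fun x y h => ?_, fun i => ?_⟩
  · exact congrArg (fun z => z.2.1) h
  · exact congrArg (fun z => z.2.2) h
  · refine CyclicWord.IsSimple.of_comp
      (f := (Pi.evalMonoidHom _ i).comp (MonoidHom.fst _ (A' × B'))) (hw i) (fun x hx => ?_)
      fun x hx => ?_
    · have h1 : φ x = 1 := hα i (by rw [map_one]; exact hx)
      rw [MonoidHom.comp_apply, h1, map_one]
    · have h1 : ψ x = 1 := hβ i (by rw [map_one]; exact hx)
      rw [MonoidHom.comp_apply, h1, map_one]

theorem orderOf_val_comp_dvd (w : CyclicWord A B) {K K' : Type*} [Group K] [Group K']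
    (α : A →* K) (β : B →* K) (f : K →* K') :
    orderOf (w.val (f.comp α) (f.comp β)) ∣ orderOf (w.val α β) := by
  rw [← CyclicWord.map_val]
  exact orderOf_map_dvd f _

theorem orderOf_prod_pi_eq {κ K₀ : Type*} {K : κ → Type*} [Group K₀] [∀ k, Group (K k)]
    (α₀ : A →* K₀) (α₁ : ∀ k, A →* K k) (x : A)
    (h : ∀ k, orderOf (α₁ k x) ∣ orderOf (α₀ x)) :
    orderOf (α₀.prod (MonoidHom.pi α₁) x) = orderOf (α₀ x) := by
  refine Nat.dvd_antisymm (orderOf_dvd_of_pow_eq_one (Prod.ext ?_ (funext fun k => ?_)))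
    (orderOf_map_dvd (MonoidHom.fst _ _) (α₀.prod (MonoidHom.pi α₁) x))
  · exact pow_orderOf_eq_one (α₀ x)
  · exact orderOf_dvd_iff_pow_eq_one.1 (h k)

/-- Pairs of homomorphisms combine to a pair of homomorphisms into the product. -/
theorem exists_hom_prod_pi {κ K₀ : Type} [Finite κ] {K : κ → Type} [Group K₀] [∀ k, Group (K k)]
    [Finite K₀] [∀ k, Finite (K k)] (α₀ : A →* K₀) (β₀ : B →* K₀) (α₁ : ∀ k, A →* K k)
    (β₁ : ∀ k, B →* K k) (hα : ∀ k x, orderOf (α₁ k x) ∣ orderOf (α₀ x))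
    (hβ : ∀ k x, orderOf (β₁ k x) ∣ orderOf (β₀ x)) :
    ∃ (H : Type) (_ : Group H) (_ : Finite H) (α' : A →* H) (β' : B →* H),
      (∀ x, orderOf (α' x) = orderOf (α₀ x)) ∧ (∀ x, orderOf (β' x) = orderOf (β₀ x)) ∧
      ∀ w : CyclicWord A B, orderOf (w.val α₀ β₀) ∣ orderOf (w.val α' β') ∧
        (∀ k, orderOf (w.val (α₁ k) (β₁ k)) ∣ orderOf (w.val α' β')) ∧
        ∀ N, w.val α₀ β₀ ^ N = 1 → (∀ k, w.val (α₁ k) (β₁ k) ^ N = 1) →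
          orderOf (w.val α' β') ∣ N := by
  refine ⟨K₀ × ∀ k, K k, inferInstance, inferInstance, α₀.prod (MonoidHom.pi α₁),
    β₀.prod (MonoidHom.pi β₁), fun x => orderOf_prod_pi_eq _ _ _ fun k => hα k x,
    fun x => orderOf_prod_pi_eq _ _ _ fun k => hβ k x, fun w => ⟨?_, fun k => ?_, ?_⟩⟩
  · exact orderOf_val_comp_dvd w _ _ (MonoidHom.fst K₀ (∀ k, K k))
  · exact orderOf_val_comp_dvd w _ _ ((Pi.evalMonoidHom K k).comp (MonoidHom.snd K₀ (∀ k, K k)))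
  · intro N h₀ h₁
    refine orderOf_dvd_of_pow_eq_one (Prod.ext ?_ (funext fun k => ?_))
    · refine Eq.trans ?_ h₀
      exact congrArg (· ^ N) (CyclicWord.map_val w _ _ (MonoidHom.fst K₀ (∀ k, K k)))
    · refine Eq.trans ?_ (h₁ k)
      exact congrArg (· ^ N) (CyclicWord.map_val w _ _
        ((Pi.evalMonoidHom K k).comp (MonoidHom.snd K₀ (∀ k, K k))))

/-- Finitely many cyclic words labelling simple closed paths in a finite quotient are separated, up
to conjugacy and inversion, by their orders in another one, where the orders of the elements of the
factors are unchanged. -/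
theorem exists_orderOf_val_ne {ι : Type} [Finite ι] (w : ι → CyclicWord A B) {Q : Type} [Group Q]
    [Finite Q] (α : A →* Q) (β : B →* Q) (hw : ∀ i, (w i).IsSimple α β)
    (hs : ∀ i j, (w i).Separates (w j) α β) :
    ∃ (H : Type) (_ : Group H) (_ : Finite H) (α' : A →* H) (β' : B →* H),
      (∀ x, orderOf (α' x) = orderOf (α x)) ∧ (∀ x, orderOf (β' x) = orderOf (β x)) ∧
      (∀ i, Nat.card Q < orderOf ((w i).val α' β')) ∧
      ∀ i j, ¬ ConjInv ((w i).val inl inr : Monoid.Coprod A B) ((w j).val inl inr) →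
        orderOf ((w i).val α' β') ≠ orderOf ((w j).val α' β') := by
  classical
  cases nonempty_fintype ι
  set M := (Nat.card Q + 1) * ∏ i, (w i).len with hM
  have hprod : ∏ i, (w i).len ≠ 0 := Finset.prod_ne_zero_iff.2 fun i _ => NeZero.ne _
  have hM₀ : M ≠ 0 := Nat.mul_ne_zero (by simp) hprod
  have hQM : Nat.card Q < M :=
    Nat.lt_of_succ_le (Nat.le_mul_of_pos_right _ (Nat.pos_of_ne_zero hprod))
  have hlen : ∀ i, (w i).len ∣ M := fun i =>
    (Finset.dvd_prod_of_mem (fun i => (w i).len) (Finset.mem_univ i)).mul_left _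
  obtain ⟨q, hqQ, hq⟩ := Nat.exists_infinite_primes (Nat.card Q + 3)
  have hQ₀ : Nat.card Q ≠ 0 := Nat.card_pos.ne'
  obtain ⟨p, hpinj, hp, hpN⟩ := exists_primes (ι × ι) (Nat.card Q * q * M)
  have : Fact q.Prime := ⟨hq⟩
  obtain ⟨X, _, α₀, β₀, hα₀, hβ₀, hone₀, hdvd₀⟩ :=
    CyclicWord.exists_dvd_orderOf_val α β M hM₀
  let unmatched : ι × ι → Prop := fun k => ∀ (g : Q) (r : ZMod q),
    (w k.1).chain α β (ZMod q) g ≠ r • (w k.2).chain α β (ZMod q) 1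
  have hfactor : ∀ k : ι × ι, ∃ (X : Type) (_ : Finite X) (α' : A →* Equiv.Perm X)
      (β' : B →* Equiv.Perm X), (∀ x, orderOf (α' x) ∣ orderOf (α x)) ∧
      (∀ x, orderOf (β' x) ∣ orderOf (β x)) ∧
      (∀ i, (w i).val α' β' ^ (Nat.card Q * q * p k) = 1) ∧
      (unmatched k → p k ∣ orderOf ((w k.2).val α' β') ∧
        (w k.1).val α' β' ^ (Nat.card Q * q) = 1) := by
    intro k
    by_cases hk : unmatched k
    · obtain ⟨X, hX, α', β', h1, h2, h3, h4⟩ :=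
        CyclicWord.exists_dvd_orderOf_val_and_pow_eq_one (hw k.2) hq (by omega) hk (p k)
          (hp k).ne_zero
      exact ⟨X, hX, α', β', fun x => (h1 x).dvd, fun x => (h2 x).dvd, fun i => h3 _, fun _ => h4⟩
    · exact ⟨Unit, inferInstance, 1, 1, by simp, by simp, fun _ => Subsingleton.elim _ _,
        fun h => absurd h hk⟩
  choose Y hY α₁ β₁ hα₁ hβ₁ hone₁ hdvd₁ using hfactor
  obtain ⟨H, _, _, α', β', hα', hβ', hval⟩ := exists_hom_prod_pi α₀ β₀ α₁ β₁
    (fun k x => (hα₀ x).symm ▸ hα₁ k x) (fun k x => (hβ₀ x).symm ▸ hβ₁ k x)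
  have hMdvd : ∀ i, M ∣ orderOf ((w i).val α' β') := fun i =>
    (hdvd₀ _ (hw i)).trans (hval (w i)).1
  have hunmatched : ∀ i j, unmatched (i, j) →
      orderOf ((w i).val α' β') ≠ orderOf ((w j).val α' β') := by
    intro i j hij h
    have h1 : p (i, j) ∣ orderOf ((w j).val α' β') :=
      (hdvd₁ (i, j) hij).1.trans ((hval (w j)).2.1 _)
    have h2 : orderOf ((w i).val α' β') ∣
        Nat.card Q * q * M * ∏ k ∈ Finset.univ.erase (i, j), p k := by
      refine (hval (w i)).2.2 _ ?_ fun k => ?_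
      · have h3 : Nat.card Q * q * M * ∏ k ∈ Finset.univ.erase (i, j), p k =
            Nat.card Q * M * (q * ∏ k ∈ Finset.univ.erase (i, j), p k) := by ring
        rw [h3, pow_mul, hone₀, one_pow]
      · by_cases hk : k = (i, j)
        · subst hk
          rw [mul_assoc, pow_mul, (hdvd₁ (i, j) hij).2, one_pow]
        · obtain ⟨c, hc⟩ := Finset.dvd_prod_of_mem p (Finset.mem_erase.2 ⟨hk, Finset.mem_univ k⟩)
          have h3 : Nat.card Q * q * M * (p k * c) = Nat.card Q * q * p k * (M * c) := by ring
          rw [hc, h3, pow_mul, hone₁, one_pow]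
    rw [h] at h2
    rcases (hp (i, j)).dvd_mul.1 (h1.trans h2) with h3 | h3
    · exact (Nat.le_of_dvd (Nat.pos_of_ne_zero (by simp [hQ₀, hq.ne_zero, hM₀])) h3).not_gt
        (hpN (i, j))
    · obtain ⟨k, hk, h4⟩ := ((hp (i, j)).prime.dvd_finsetProd_iff _).1 h3
      exact (Finset.mem_erase.1 hk).1
        (hpinj ((Nat.prime_dvd_prime_iff_eq (hp (i, j)) (hp k)).1 h4)).symm
  refine ⟨H, inferInstance, inferInstance, α', β', fun x => (hα' x).trans (hα₀ x),
    fun x => (hβ' x).trans (hβ₀ x), fun i => ?_, fun i j hij h => ?_⟩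
  · exact hQM.trans_le (Nat.le_of_dvd (orderOf_pos _) (hMdvd i))
  · by_cases hk : unmatched (i, j)
    · exact hunmatched i j hk h
    simp only [unmatched] at hk
    push Not at hk
    obtain ⟨g, r, hc⟩ := hk
    have hR : (1 : ZMod q) ≠ -1 := by
      have : Fact (2 < q) := ⟨by omega⟩
      exact (ZMod.neg_one_ne_one).symm
    have hconj : ∀ s t, s * (w i).len = t * (w j).len →
        ConjInv ((w i).val inl inr ^ s : Monoid.Coprod A B) ((w j).val inl inr ^ t) :=
      fun s t hst => CyclicWord.isConj_of_chain_eq_smul (K' := Monoid.Coprod A B) inl inr (hw i)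
        (hw j) (hs i j) g r hc hR hst
    have h1 := ((hconj (w j).len (w i).len (mul_comm _ _)).map
      (Monoid.Coprod.lift α' β')).orderOf_eq
    have hdi := (hlen i).trans (hMdvd j)
    have hdj := (hlen j).trans (hMdvd j)
    rw [map_pow, map_pow, CyclicWord.lift_val, CyclicWord.lift_val,
      orderOf_pow_of_dvd (NeZero.ne _) (h ▸ hdj), orderOf_pow_of_dvd (NeZero.ne _) hdi, h] at h1
    have h2 : (w j).len = (w i).len := by
      rw [← Nat.div_div_self hdj (orderOf_pos _).ne', h1, Nat.div_div_self hdi (orderOf_pos _).ne']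
    have h3 := hconj 1 1 (by rw [h2])
    rw [pow_one, pow_one] at h3
    exact hij h3

theorem eq_of_map_eq_of_ne_one {G H : Type*} [Group G] [Group H] {S L : Finset G} {φ : G →* H}
    (hφ : ∀ x ∈ S, x ≠ 1 → φ x ≠ 1) (hL : ∀ x ∈ L, ∀ y ∈ L, x * y⁻¹ ∈ S) {x y : G}
    (hx : x ∈ L) (hy : y ∈ L) (h : φ x = φ y) : x = y := by
  by_contra hxy
  exact hφ _ (hL x hx y hy) (fun h1 => hxy (mul_inv_eq_one.1 h1)) (by simp [h])

theorem exists_finset_letters {G ι : Type*} (l : ι → G) [Finite ι] [Group G] (S : Finset G) :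
    ∃ T L : Finset G, S ⊆ T ∧ (∀ i, l i ∈ T) ∧ (∀ i, l i ∈ L) ∧ (∀ i, (l i)⁻¹ ∈ L) ∧
      ∀ x ∈ L, ∀ y ∈ L, x * y⁻¹ ∈ T := by
  classical
  cases nonempty_fintype ι
  let L := Finset.univ.image l ∪ Finset.univ.image fun i => (l i)⁻¹
  exact ⟨S ∪ Finset.univ.image l ∪ Finset.image₂ (fun x y => x * y⁻¹) L L, L,
    fun x hx => by simp [hx], fun i => by simp, fun i => by simp [L], fun i => by simp [L],
    fun x hx y hy => Finset.mem_union_right _ (Finset.mem_image₂_of_mem hx hy)⟩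

theorem exists_hom_coprod (hA : ∀ n : ℕ, 0 < n → OrderSeparable A n)
    (hB : ∀ n : ℕ, 0 < n → OrderSeparable B n)
    (hord : ∀ (a : A) (b : B), a ≠ 1 → b ≠ 1 →
      IsOfFinOrder a → IsOfFinOrder b → orderOf a ≠ orderOf b)
    (S : Finset A) (T : Finset B) {ι : Type} [Finite ι] (w : ι → CyclicWord A B) :
    ∃ (H : Type) (_ : Group H) (_ : Finite H) (Φ : Monoid.Coprod A B →* H),
      (∀ x ∈ S, ∀ y ∈ S, ¬ ConjInv x y → orderOf (Φ (inl x)) ≠ orderOf (Φ (inl y))) ∧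
      (∀ x ∈ T, ∀ y ∈ T, ¬ ConjInv x y → orderOf (Φ (inr x)) ≠ orderOf (Φ (inr y))) ∧
      (∀ x ∈ S, ∀ y ∈ T, x ≠ 1 ∨ y ≠ 1 → orderOf (Φ (inl x)) ≠ orderOf (Φ (inr y))) ∧
      (∀ x i, orderOf (Φ (inl x)) ≠ orderOf (Φ ((w i).val inl inr))) ∧
      (∀ x i, orderOf (Φ (inr x)) ≠ orderOf (Φ ((w i).val inl inr))) ∧
      ∀ i j, ¬ ConjInv ((w i).val inl inr : Monoid.Coprod A B) ((w j).val inl inr) →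
        orderOf (Φ ((w i).val inl inr)) ≠ orderOf (Φ ((w j).val inl inr)) := by
  classical
  have : ∀ i, Finite (ZMod (w i).len) := fun i => inferInstance
  obtain ⟨S', L, hSS', hlS, hlL, hlL', hL⟩ :=
    exists_finset_letters (fun p : Σ i, ZMod (w i).len => (w p.1).left p.2) S
  obtain ⟨T', R, hTT', hrT, hrR, hrR', hR⟩ :=
    exists_finset_letters (fun p : Σ i, ZMod (w i).len => (w p.1).right p.2) T
  obtain ⟨A', B', _, _, _, _, φ, ψ, hφ, hψ, hφψ, hφ₁, hψ₁⟩ := exists_hom_pair hA hB hord S' T'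
  obtain ⟨Q, _, _, f, g, hf, hg, hw⟩ := exists_isSimple w φ ψ
    (fun i j => hφ₁ _ (hlS ⟨i, j⟩) ((w i).left_ne_one j))
    (fun i j => hψ₁ _ (hrT ⟨i, j⟩) ((w i).right_ne_one j))
  have hs : ∀ i j, (w i).Separates (w j) (f.comp φ) (g.comp ψ) := fun i j =>
    { left := fun k l h => eq_of_map_eq_of_ne_one hφ₁ hL (hlL ⟨i, k⟩) (hlL ⟨j, l⟩) (hf h)
      left_inv := fun k l h => eq_of_map_eq_of_ne_one hφ₁ hL (hlL ⟨i, k⟩) (hlL' ⟨j, l⟩) (hf h)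
      right := fun k l h => eq_of_map_eq_of_ne_one hψ₁ hR (hrR ⟨i, k⟩) (hrR ⟨j, l⟩) (hg h)
      right_inv := fun k l h =>
        eq_of_map_eq_of_ne_one hψ₁ hR (hrR ⟨i, k⟩) (hrR' ⟨j, l⟩) (hg h) }
  obtain ⟨H, _, _, α, β, hα, hβ, hlt, hne⟩ := exists_orderOf_val_ne w _ _ hw hs
  have hα' : ∀ x, orderOf (α x) = orderOf (φ x) := fun x =>
    (hα x).trans (orderOf_injective f hf (φ x))
  have hβ' : ∀ x, orderOf (β x) = orderOf (ψ x) := fun x =>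
    (hβ x).trans (orderOf_injective g hg (ψ x))
  refine ⟨H, inferInstance, inferInstance, Monoid.Coprod.lift α β, ?_⟩
  simp only [Monoid.Coprod.lift_apply_inl, Monoid.Coprod.lift_apply_inr, CyclicWord.lift_val]
  refine ⟨fun x hx y hy => ?_, fun x hx y hy => ?_, fun x hx y hy => ?_, fun x i h => ?_,
    fun x i h => ?_, hne⟩
  · rw [hα', hα']
    exact hφ x (hSS' hx) y (hSS' hy)
  · rw [hβ', hβ']
    exact hψ x (hTT' hx) y (hTT' hy)
  · rw [hα', hβ']
    exact hφψ x (hSS' hx) y (hTT' hy)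
  · have h1 := hlt i
    rw [← h, hα] at h1
    exact h1.not_ge (Nat.le_of_dvd Nat.card_pos (orderOf_dvd_natCard _))
  · have h1 := hlt i
    rw [← h, hβ] at h1
    exact h1.not_ge (Nat.le_of_dvd Nat.card_pos (orderOf_dvd_natCard _))

/-- The element of the free product given by an element of a factor or by a cyclic word. -/
def normalFormVal : A ⊕ B ⊕ CyclicWord A B → Monoid.Coprod A B
  | .inl a => inl a
  | .inr (.inl b) => inr b
  | .inr (.inr w) => w.val inl inr

theorem orderSeparable_coprod (hA : ∀ n : ℕ, 0 < n → OrderSeparable A n)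
    (hB : ∀ n : ℕ, 0 < n → OrderSeparable B n)
    (hord : ∀ (a : A) (b : B), a ≠ 1 → b ≠ 1 →
      IsOfFinOrder a → IsOfFinOrder b → orderOf a ≠ orderOf b) (n : ℕ) :
    OrderSeparable (Monoid.Coprod A B) n := by
  classical
  intro u hu
  have hc : ∀ i, ∃ c : A ⊕ B ⊕ CyclicWord A B, ConjInv (u i) (normalFormVal c) := by
    intro i
    obtain ⟨a, h⟩ | ⟨b, h⟩ | ⟨w, h⟩ := isConj_inl_or_inr_or_cyclicWord (u i)
    · exact ⟨.inl a, Or.inl h⟩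
    · exact ⟨.inr (.inl b), Or.inl h⟩
    · exact ⟨.inr (.inr w), Or.inl h⟩
  choose c hc using hc
  let S : Finset A := Finset.univ.biUnion fun i => match c i with
    | .inl a => {a}
    | _ => ∅
  let T : Finset B := Finset.univ.biUnion fun i => match c i with
    | .inr (.inl b) => {b}
    | _ => ∅
  have hS : ∀ i a, c i = .inl a → a ∈ S := fun i a h =>
    Finset.mem_biUnion.2 ⟨i, Finset.mem_univ i, by simp [h]⟩
  have hT : ∀ i b, c i = .inr (.inl b) → b ∈ T := fun i b h =>
    Finset.mem_biUnion.2 ⟨i, Finset.mem_univ i, by simp [h]⟩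
  let ι := {i : Fin n // ∃ w, c i = .inr (.inr w)}
  choose w hw using fun i : ι => i.2
  have hι : ∀ i v, c i = .inr (.inr v) → ∃ k, v = w k := fun i v h =>
    ⟨⟨i, v, h⟩, by simpa [h] using hw ⟨i, v, h⟩⟩
  obtain ⟨H, _, _, Φ, hAA, hBB, hAB, hAw, hBw, hww⟩ := exists_hom_coprod hA hB hord S T w
  refine ⟨Φ.range, inferInstance, inferInstance, Φ.rangeRestrict, Φ.rangeRestrict_surjective,
    fun i j hij => ?_⟩
  have h0 : ∀ x, orderOf (Φ.rangeRestrict x) = orderOf (Φ x) := fun x =>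
    (orderOf_injective Φ.range.subtype Subtype.val_injective _).symm
  have h1 : ¬ ConjInv (normalFormVal (c i)) (normalFormVal (c j)) := fun h =>
    (not_or.2 (hu i j hij)) ((hc i).trans (h.trans (hc j).symm))
  rw [h0, h0, ((hc i).map Φ).orderOf_eq, ((hc j).map Φ).orderOf_eq]
  have hne : ∀ (x : A) (y : B), ¬ ConjInv (inl x : Monoid.Coprod A B) (inr y) →
      x ≠ 1 ∨ y ≠ 1 := fun x y h => by
    by_contra! hxy
    exact h (by rw [hxy.1, hxy.2, map_one, map_one])
  rcases hci : c i with a | b | v <;> rcases hcj : c j with a' | b' | v' <;>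
    rw [hci, hcj] at h1 <;> simp only [normalFormVal] at h1 ⊢
  · exact hAA a (hS i a hci) a' (hS j a' hcj) fun h => h1 (h.map (inl : A →* Monoid.Coprod A B))
  · exact hAB a (hS i a hci) b' (hT j b' hcj) (hne a b' h1)
  · obtain ⟨k, rfl⟩ := hι j v' hcj
    exact hAw a k
  · exact (hAB a' (hS j a' hcj) b (hT i b hci) (hne a' b fun h => h1 h.symm)).symm
  · exact hBB b (hT i b hci) b' (hT j b' hcj) fun h => h1 (h.map (inr : B →* Monoid.Coprod A B))
  · obtain ⟨k, rfl⟩ := hι j v' hcj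
    exact hBw b k
  · obtain ⟨k, rfl⟩ := hι i v hci
    exact (hAw a' k).symm
  · obtain ⟨k, rfl⟩ := hι i v hci
    exact (hBw b' k).symm
  · obtain ⟨k, rfl⟩ := hι i v hci
    obtain ⟨l, rfl⟩ := hι j v' hcj
    exact hww k l h1

end Main

/-- If `A` and `B` are `n`-element order separable for every positive `n`, and no nontrivial
element of `A` of finite order has the same order as a nontrivial element of `B` of finite
order, then the free product `A ∗ B` is `3`-element order separable. -/
theorem coprod_three_element_orderSeparable (A B : Type*) [Group A] [Group B]
    (hAsep : ∀ n : ℕ, 0 < n → OrderSeparable A n)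
    (hBsep : ∀ n : ℕ, 0 < n → OrderSeparable B n)
    (hord : ∀ (a : A) (b : B), a ≠ 1 → b ≠ 1 →
      IsOfFinOrder a → IsOfFinOrder b → orderOf a ≠ orderOf b) :
    OrderSeparable (Monoid.Coprod A B) 3 := by
  exact orderSeparable_coprod hAsep hBsep hord 3
end

section
/- The infinite dihedral group, i.e. the free product of two cyclic groups of order 2, is not 3-element order separable: there exist elements u_1, u_2, u_3 of this group, with u_i conjugate neither to u_j nor to u_j⁻¹ for all i ≠ j, such that for every homomorphism φ of the group onto a finite group the orders of φ(u_1), φ(u_2), φ(u_3) are not pairwise different. -/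
open Monoid.Coprod in
theorem not_isConj_of_toProd_ne {M N : Type*} [CommGroup M] [CommGroup N]
    {x y : Monoid.Coprod M N} (h : toProd x ≠ toProd y) : ¬ IsConj x y :=
  fun hc => h (isConj_iff_eq.mp (toProd.map_isConj hc))

theorem orderOf_map_mul_eq_of_sq_eq_one {G H : Type*} [Group G] [Group H] (φ : G →* H) {a b : G}
    (ha : a ^ 2 = 1) (hb : b ^ 2 = 1) (h : orderOf (φ a) ≠ orderOf (φ b)) :
    orderOf (φ a) = orderOf (φ (a * b)) ∨ orderOf (φ b) = orderOf (φ (a * b)) := by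
  by_cases h₁ : φ a = 1
  · simp [h₁]
  by_cases h₂ : φ b = 1
  · simp [h₂]
  refine absurd ?_ h
  rw [orderOf_eq_prime (by rw [← map_pow, ha, map_one]) h₁,
    orderOf_eq_prime (by rw [← map_pow, hb, map_one]) h₂]

/-- The infinite dihedral group, the free product of two cyclic groups of order 2,
is not 3-element order separable: there exist three elements, pairwise conjugate
neither to each other nor to each other's inverses, such that under every homomorphism
onto a finite group their images fail to have pairwise different orders. -/
theorem infiniteDihedral_not_three_element_orderSeparable :
    ∃ u₁ u₂ u₃ : Monoid.Coprod (Multiplicative (ZMod 2)) (Multiplicative (ZMod 2)),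
      (¬ IsConj u₁ u₂ ∧ ¬ IsConj u₁ u₂⁻¹) ∧
      (¬ IsConj u₁ u₃ ∧ ¬ IsConj u₁ u₃⁻¹) ∧
      (¬ IsConj u₂ u₃ ∧ ¬ IsConj u₂ u₃⁻¹) ∧
      ∀ (H : Type) (_ : Group H) (_ : Finite H)
        (φ : Monoid.Coprod (Multiplicative (ZMod 2)) (Multiplicative (ZMod 2)) →* H),
        Function.Surjective φ →
        ¬ (orderOf (φ u₁) ≠ orderOf (φ u₂) ∧ orderOf (φ u₁) ≠ orderOf (φ u₃) ∧
            orderOf (φ u₂) ≠ orderOf (φ u₃)) := by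
  let g : Multiplicative (ZMod 2) := Multiplicative.ofAdd 1
  have hg : g ^ 2 = 1 := by decide
  have ha : (Monoid.Coprod.inl g : Monoid.Coprod _ (Multiplicative (ZMod 2))) ^ 2 = 1 := by
    rw [← map_pow, hg, map_one]
  have hb : (Monoid.Coprod.inr g : Monoid.Coprod (Multiplicative (ZMod 2)) _) ^ 2 = 1 := by
    rw [← map_pow, hg, map_one]
  refine ⟨.inl g, .inr g, .inl g * .inr g, ⟨?_, ?_⟩, ⟨?_, ?_⟩, ⟨?_, ?_⟩, ?_⟩
  iterate 6
    apply not_isConj_of_toProd_ne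
    simp only [map_inv, map_mul, Monoid.Coprod.toProd_apply_inl, Monoid.Coprod.toProd_apply_inr]
    decide
  rintro H _ _ φ - ⟨h₁, h₂, h₃⟩
  exact (orderOf_map_mul_eq_of_sq_eq_one φ ha hb h₁).elim h₂ h₃
end

section
/- Let G = A ∗ B be the free product of two finite groups A and B, let w_1, ..., w_k be nontrivial elements of the Cartesian subgroup C of G, let p be a prime number, and let N be a positive integer. Then there exists a homomorphism φ of G onto a finite group such that for each i the image φ(w_i) is a p-element and the order of φ(w_i) is greater than p^N. -/
/-- The Cartesian subgroup of the free product `A ∗ B`: the kernel of the natural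
homomorphism `A ∗ B → A × B`. -/
def cartesianSubgroup (A B : Type*) [Group A] [Group B] :
    Subgroup (Monoid.Coprod A B) :=
  (Monoid.Coprod.toProd : Monoid.Coprod A B →* A × B).ker

section Unipotent

theorem exists_pow_prime_pow_eq_one_of_isNilpotent_sub_one {R : Type*} [Ring R] (p : ℕ)
    [Fact p.Prime] [CharP R p] {u : Rˣ} (hu : IsNilpotent ((u : R) - 1)) :
    ∃ n : ℕ, u ^ p ^ n = 1 := by
  obtain ⟨n, hn⟩ := hu
  refine ⟨n, Units.ext ?_⟩
  have h := add_pow_char_pow_of_commute (p := p) (n := n) (Commute.one_right ((u : R) - 1))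
  rw [sub_add_cancel, pow_eq_zero_of_le (Nat.lt_pow_self (Fact.out : p.Prime).one_lt).le hn,
    zero_add, one_pow] at h
  simpa using h

/-- For a non-unital subring `J` of nilpotent elements in a ring of prime characteristic `p`,
the group `1 + J`. -/
def oneAddSubgroup {R : Type*} [Ring R] (p : ℕ) [Fact p.Prime] [CharP R p]
    (J : NonUnitalSubring R) (hJ : ∀ x ∈ J, IsNilpotent x) : Subgroup Rˣ :=
  let S : Submonoid Rˣ :=
    { carrier := {u | (u : R) - 1 ∈ J}
      one_mem' := by simp [J.zero_mem]
      mul_mem' := by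
        intro u v hu hv
        have h : ((u * v : Rˣ) : R) - 1
            = ((u : R) - 1) * ((v : R) - 1) + ((u : R) - 1) + ((v : R) - 1) := by
          push_cast; noncomm_ring
        simp only [Set.mem_ofPred_eq] at hu hv ⊢
        rw [h]
        exact J.add_mem (J.add_mem (J.mul_mem hu hv) hu) hv }
  { S with
    inv_mem' := by
      intro u hu
      obtain ⟨m, hm⟩ := exists_pow_prime_pow_eq_one_of_isNilpotent_sub_one p (hJ _ hu)
      have h : u⁻¹ = u ^ (p ^ m - 1) := by
        rw [inv_eq_iff_mul_eq_one, ← pow_succ',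
          Nat.sub_add_cancel (pow_pos (Fact.out : p.Prime).pos m), hm]
      rw [h]
      exact S.pow_mem hu _ }

theorem mem_oneAddSubgroup {R : Type*} [Ring R] {p : ℕ} [Fact p.Prime] [CharP R p]
    {J : NonUnitalSubring R} {hJ : ∀ x ∈ J, IsNilpotent x} {u : Rˣ} :
    u ∈ oneAddSubgroup p J hJ ↔ (u : R) - 1 ∈ J := Iff.rfl

theorem isPGroup_oneAddSubgroup {R : Type*} [Ring R] {p : ℕ} [Fact p.Prime] [CharP R p]
    {J : NonUnitalSubring R} {hJ : ∀ x ∈ J, IsNilpotent x} :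
    IsPGroup p (oneAddSubgroup p J hJ) := by
  rintro ⟨u, hu⟩
  obtain ⟨n, hn⟩ := exists_pow_prime_pow_eq_one_of_isNilpotent_sub_one p (hJ _ hu)
  exact ⟨n, Subtype.ext hn⟩

/-- The strictly upper triangular matrices. -/
def strictUpperTriangular (n : ℕ) (R : Type*) [Ring R] :
    NonUnitalSubring (Matrix (Fin n) (Fin n) R) where
  carrier := {M | ∀ i j, j ≤ i → M i j = 0}
  zero_mem' := by simp
  add_mem' := by
    intro M N hM hN i j hij
    simp [hM i j hij, hN i j hij]
  neg_mem' := by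
    intro M hM i j hij
    simp [hM i j hij]
  mul_mem' := by
    intro M N hM hN i j hij
    rw [Matrix.mul_apply]
    refine Finset.sum_eq_zero fun k _ => ?_
    rcases le_or_gt k i with h | h
    · rw [hM i k h, zero_mul]
    · rw [hN k j (hij.trans h.le), mul_zero]

theorem isNilpotent_of_mem_strictUpperTriangular {n : ℕ} {R : Type*} [Ring R]
    {M : Matrix (Fin n) (Fin n) R} (hM : M ∈ strictUpperTriangular n R) : IsNilpotent M := by
  have key : ∀ (k : ℕ) (i j : Fin n), (j : ℕ) < i + k → (M ^ k) i j = 0 := by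
    intro k
    induction k with
    | zero =>
      intro i j h
      rw [pow_zero, Matrix.one_apply_ne]
      rintro rfl
      omega
    | succ k ih =>
      intro i j h
      rw [pow_succ, Matrix.mul_apply]
      refine Finset.sum_eq_zero fun l _ => ?_
      rcases lt_or_ge (l : ℕ) (i + k) with hl | hl
      · rw [ih i l hl, zero_mul]
      · rw [hM l j (Fin.le_def.2 (by omega)), mul_zero]
  exact ⟨n, Matrix.ext fun i j => key n i j (by omega)⟩

/-- Words in a free group all of whose syllables are `±1` powers of generators are detected by
finite `p`-groups. -/
theorem FreeGroup.exists_isPGroup_lift_mk_ne_one {α : Type*} (p : ℕ) [Fact p.Prime]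
    {L : List (α × Bool)} (hL : L.IsChain fun x y => x.1 ≠ y.1) (hne : L ≠ []) :
    ∃ (P : Type) (_ : Group P) (_ : Finite P) (t : α → P),
      IsPGroup p P ∧ FreeGroup.lift t (FreeGroup.mk L) ≠ 1 := by
  classical
  set n := L.length with hn
  let X (q : α) : Matrix (Fin (n + 1)) (Fin (n + 1)) (ZMod p) := fun i j =>
    if (j : ℕ) = i + 1 ∧ (L[(i : ℕ)]?).map Prod.fst = some q then 1 else 0
  have hX (q : α) : X q ∈ strictUpperTriangular (n + 1) (ZMod p) := by
    intro i j hij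
    have : (j : ℕ) ≤ i := hij
    exact if_neg (by omega)
  have hXX (q : α) : X q * X q = 0 := by
    ext i j
    rw [Matrix.mul_apply]
    refine Finset.sum_eq_zero fun k _ => ?_
    simp only [X]
    by_cases h1 : (k : ℕ) = i + 1 ∧ (L[(i : ℕ)]?).map Prod.fst = some q
    · by_cases h2 : (j : ℕ) = k + 1 ∧ (L[(k : ℕ)]?).map Prod.fst = some q
      · exfalso
        obtain ⟨hk, h1⟩ := h1
        obtain ⟨hj, h2⟩ := h2
        rw [hk] at h2
        have hlt : (i : ℕ) + 1 < L.length := by omega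
        rw [List.getElem?_eq_getElem hlt] at h2
        rw [List.getElem?_eq_getElem (by omega)] at h1
        simp only [Option.map_some, Option.some.injEq] at h1 h2
        exact List.isChain_iff_getElem.1 hL i hlt (h1.trans h2.symm)
      · rw [if_neg h2, mul_zero]
    · rw [if_neg h1, zero_mul]
  let u (q : α) : (Matrix (Fin (n + 1)) (Fin (n + 1)) (ZMod p))ˣ :=
    ⟨1 + X q, 1 - X q, by noncomm_ring; simp [hXX], by noncomm_ring; simp [hXX]⟩
  let P := oneAddSubgroup p (strictUpperTriangular (n + 1) (ZMod p))
    fun _ => isNilpotent_of_mem_strictUpperTriangular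
  let t (q : α) : P := ⟨u q, by rw [mem_oneAddSubgroup]; simpa [u] using hX q⟩
  refine ⟨P, inferInstance, inferInstance, t, isPGroup_oneAddSubgroup, ?_⟩
  let ε (x : α × Bool) : ZMod p := cond x.2 1 (-1)
  let f (x : α × Bool) : Matrix (Fin (n + 1)) (Fin (n + 1)) (ZMod p) := 1 + ε x • X x.1
  have hf : (((FreeGroup.lift t (FreeGroup.mk L) : P) :
      (Matrix (Fin (n + 1)) (Fin (n + 1)) (ZMod p))ˣ) :
      Matrix (Fin (n + 1)) (Fin (n + 1)) (ZMod p)) = (L.map f).prod := by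
    rw [FreeGroup.lift_mk, ← Subgroup.coe_subtype, map_list_prod, ← Units.coeHom_apply,
      map_list_prod, List.map_map, List.map_map]
    congr 1
    refine List.map_congr_left ?_
    rintro ⟨q, b⟩ -
    cases b
    · simp [f, ε, t, u, sub_eq_add_neg]
    · simp [f, ε, t, u]
  have key (k : ℕ) (hk : k ≤ n) :
      (∀ j : Fin (n + 1), k < j → ((L.take k).map f).prod 0 j = 0) ∧
        ((L.take k).map f).prod 0 ⟨k, by omega⟩ ≠ 0 := by
    induction k with
    | zero =>
      refine ⟨fun j hj => ?_, ?_⟩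
      · rw [List.take_zero, List.map_nil, List.prod_nil, Matrix.one_apply_ne]
        rintro rfl
        simp at hj
      · simp
    | succ k ih =>
      obtain ⟨ih0, ih1⟩ := ih (by omega)
      have hkL : k < L.length := by omega
      rw [List.take_succ_eq_append_getElem hkL, List.map_append, List.prod_append,
        List.map_singleton, List.prod_singleton]
      set M := ((L.take k).map f).prod
      have hM (j : Fin (n + 1)) : (M * f L[k]) 0 j = M 0 j + ε L[k] * (M * X L[k].1) 0 j := by
        simp [f, mul_add]
      refine ⟨fun j hj => ?_, ?_⟩
      · rw [hM, ih0 j (by omega), Matrix.mul_apply, Finset.sum_eq_zero, mul_zero, add_zero]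
        intro l _
        rcases lt_or_ge k (l : ℕ) with hl | hl
        · rw [ih0 l hl, zero_mul]
        · rw [show X L[k].1 l j = 0 from if_neg (by omega), mul_zero]
      · rw [hM, ih0 _ (by simp), Matrix.mul_apply, Finset.sum_eq_single ⟨k, by omega⟩, zero_add]
        · have : X L[k].1 ⟨k, by omega⟩ ⟨k + 1, by omega⟩ = 1 :=
            if_pos (by simp [List.getElem?_eq_getElem hkL])
          rw [this, mul_one]
          refine mul_ne_zero ?_ ih1
          cases h : L[k].2 <;> simp [ε, h]
        · intro l _ hl
          rw [show X L[k].1 l ⟨k + 1, by omega⟩ = 0 from if_neg ?_, mul_zero]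
          rintro ⟨h, -⟩
          exact hl (Fin.ext (by simpa using h.symm))
        · simp
  intro h1
  have hpos : 0 < n := List.length_pos_iff.2 hne
  have h2 := (key n le_rfl).2
  rw [List.take_of_length_le hn.ge, ← hf, h1] at h2
  refine h2 (Matrix.one_apply_ne ?_)
  intro h
  have := congrArg Fin.val h
  simp at this
  omega

end Unipotent

section Wreath

variable {A B : Type*} [Group A] [Group B]

/-- The homomorphism from `A ∗ B` to the regular wreath product of `P` by `A × B` that embeds `A`
in the standard way, and `B` as its standard copy conjugated by the base element `t`. -/
def Monoid.Coprod.toWreath {P : Type*} [Group P] (t : A × B → P) :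
    Monoid.Coprod A B →* P ≀ᵣ (A × B) :=
  Monoid.Coprod.lift (RegularWreathProduct.inl.comp (MonoidHom.inl A B))
    ((MulAut.conj (⟨t, 1⟩ : P ≀ᵣ (A × B))).toMonoidHom.comp
      (RegularWreathProduct.inl.comp (MonoidHom.inr A B)))

theorem Monoid.Coprod.right_toWreath {P : Type*} [Group P] (t : A × B → P)
    (w : Monoid.Coprod A B) : (toWreath t w).right = toProd w := by
  have : RegularWreathProduct.rightHom.comp (toWreath t) = toProd := by
    ext a <;> simp [toWreath]
  exact DFunLike.congr_fun this w

theorem RegularWreathProduct.pow_left_of_right_eq_one {D Q : Type*} [Group D] [Group Q]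
    {g : D ≀ᵣ Q} (hg : g.right = 1) (m : ℕ) (x : Q) : (g ^ m).left x = g.left x ^ m := by
  induction m with
  | zero => simp
  | succ m ih => rw [pow_succ', pow_succ', mul_left, Pi.mul_apply, hg, inv_one, one_mul, ih]

theorem RegularWreathProduct.pow_eq_one_of_right_eq_one {D Q : Type*} [Group D] [Group Q]
    {g : D ≀ᵣ Q} (hg : g.right = 1) {m : ℕ} (hm : ∀ d : D, d ^ m = 1) : g ^ m = 1 := by
  ext x
  · rw [pow_left_of_right_eq_one hg, hm, one_left, Pi.one_apply]
  · change rightHom (g ^ m) = 1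
    rw [map_pow, rightHom_eq_right, hg, one_pow]

/-- The element `a₁ b₁ a₂ b₂ ⋯ aₙ bₙ` of `A ∗ B`. -/
def alternatingProd (L : List (A × B)) : Monoid.Coprod A B :=
  (L.map fun x => Monoid.Coprod.inl x.1 * Monoid.Coprod.inr x.2).prod

/-- Every element of `A ∗ B` has a normal form `a₁ b₁ ⋯ aₙ bₙ a`, in which only `a₁` and `a` are
allowed to be trivial. -/
theorem exists_eq_alternatingProd_mul_inl (w : Monoid.Coprod A B) :
    ∃ (L : List (A × B)) (a : A), (∀ x ∈ L, x.2 ≠ 1) ∧ (∀ x ∈ L.tail, x.1 ≠ 1) ∧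
      w = alternatingProd L * Monoid.Coprod.inl a := by
  induction w using Monoid.Coprod.induction_on' with
  | one => exact ⟨[], 1, by simp, by simp, by simp [alternatingProd]⟩
  | inl_mul c w ih =>
    obtain ⟨L, a, h2, h1, rfl⟩ := ih
    match L with
    | [] => exact ⟨[], c * a, by simp, by simp, by simp [alternatingProd]⟩
    | (a', b') :: L =>
      refine ⟨(c * a', b') :: L, a, ?_, h1, by simp [alternatingProd, mul_assoc]⟩
      simpa using h2
  | inr_mul c w ih =>
    obtain ⟨L, a, h2, h1, rfl⟩ := ih
    by_cases hc : c = 1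
    · exact ⟨L, a, h2, h1, by simp [hc]⟩
    match L with
    | [] => exact ⟨[(1, c)], a, by simpa using hc, by simp, by simp [alternatingProd]⟩
    | (a', b') :: L =>
      rw [List.forall_mem_cons] at h2
      rw [List.tail_cons] at h1
      by_cases ha : a' = 1
      · subst ha
        by_cases hb : c * b' = 1
        · refine ⟨L, a, h2.2, fun x hx => h1 x (List.mem_of_mem_tail hx), ?_⟩
          simp [alternatingProd, ← mul_assoc, ← map_mul, hb]
        · refine ⟨(1, c * b') :: L, a, ?_, h1, by simp [alternatingProd, mul_assoc]⟩
          exact List.forall_mem_cons.2 ⟨hb, h2.2⟩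
      · refine ⟨(1, c) :: (a', b') :: L, a, ?_, ?_, by simp [alternatingProd, mul_assoc]⟩
        · exact List.forall_mem_cons.2 ⟨hc, List.forall_mem_cons.2 h2⟩
        · exact List.forall_mem_cons.2 ⟨ha, h1⟩

/-- The word in the letters `A × B` that computes the base coordinate at `x` of the image of
`alternatingProd L` under `Monoid.Coprod.toWreath`. -/
def baseWord (x : A × B) : List (A × B) → List ((A × B) × Bool)
  | [] => []
  | y :: L => ((y.1, 1)⁻¹ * x, true) :: (y⁻¹ * x, false) :: baseWord (y⁻¹ * x) L

theorem left_toWreath_alternatingProd {P : Type*} [Group P] (t : A × B → P) (L : List (A × B))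
    (a : A) (x : A × B) :
    (Monoid.Coprod.toWreath t (alternatingProd L * Monoid.Coprod.inl a)).left x =
      FreeGroup.lift t (FreeGroup.mk (baseWord x L)) := by
  induction L generalizing x with
  | nil => simp [alternatingProd, baseWord, Monoid.Coprod.toWreath]
  | cons y L ih =>
    have h : alternatingProd (y :: L) * Monoid.Coprod.inl a = Monoid.Coprod.inl y.1 *
        Monoid.Coprod.inr y.2 * (alternatingProd L * Monoid.Coprod.inl a) := by
      simp [alternatingProd, mul_assoc]
    have h' : (y.1, y.2)⁻¹ * x = (1, y.2)⁻¹ * ((y.1, 1)⁻¹ * x) := by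
      ext <;> simp
    have hy : Monoid.Coprod.toProd (Monoid.Coprod.inl y.1 * Monoid.Coprod.inr y.2) = y := by
      simp
    rw [h, map_mul, RegularWreathProduct.mul_left, Pi.mul_apply, Monoid.Coprod.right_toWreath,
      hy, ih]
    simp only [FreeGroup.lift_mk, baseWord, List.map_cons, List.prod_cons, ← mul_assoc]
    congr 1
    simp [Monoid.Coprod.toWreath, h', mul_assoc]

theorem isChain_cons_baseWord {L : List (A × B)} (h2 : ∀ y ∈ L, y.2 ≠ 1) (h1 : ∀ y ∈ L, y.1 ≠ 1)
    (x : A × B) (s : Bool) : ((x, s) :: baseWord x L).IsChain fun u v => u.1 ≠ v.1 := by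
  induction L generalizing x s with
  | nil => simp [baseWord]
  | cons y L ih =>
    rw [List.forall_mem_cons] at h1 h2
    refine List.isChain_cons_cons.2 ⟨?_, List.isChain_cons_cons.2 ⟨?_, ih h2.2 h1.2 _ _⟩⟩
    · simpa [Prod.ext_iff] using h1.1
    · simpa [Prod.ext_iff] using h2.1

theorem isChain_baseWord {L : List (A × B)} (h2 : ∀ y ∈ L, y.2 ≠ 1) (h1 : ∀ y ∈ L.tail, y.1 ≠ 1)
    (x : A × B) : (baseWord x L).IsChain fun u v => u.1 ≠ v.1 := by
  cases L with
  | nil => simp [baseWord]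
  | cons y L =>
    rw [List.forall_mem_cons] at h2
    refine List.isChain_cons_cons.2 ⟨?_, isChain_cons_baseWord h2.2 h1 _ _⟩
    simpa [Prod.ext_iff] using h2.1

/-- On a nontrivial element of the Cartesian subgroup, the base coordinate at `1` of
`Monoid.Coprod.toWreath t` is given by a word in the values of `t` with all syllables `±1`. -/
theorem exists_left_toWreath_eq_lift_mk {v : Monoid.Coprod A B} (hv : v ∈ cartesianSubgroup A B)
    (hv1 : v ≠ 1) :
    ∃ W : List ((A × B) × Bool), W.IsChain (fun u v => u.1 ≠ v.1) ∧ W ≠ [] ∧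
      ∀ {P : Type _} [Group P] (t : A × B → P),
        (Monoid.Coprod.toWreath t v).left 1 = FreeGroup.lift t (FreeGroup.mk W) := by
  obtain ⟨L, a, h2, h1, rfl⟩ := exists_eq_alternatingProd_mul_inl v
  refine ⟨baseWord 1 L, isChain_baseWord h2 h1 1, ?_, fun t =>
    left_toWreath_alternatingProd t L a 1⟩
  cases L with
  | nil =>
    have ha : a = 1 := by
      simpa [cartesianSubgroup, alternatingProd, MonoidHom.mem_ker] using hv
    simp [alternatingProd, ha] at hv1
  | cons y L => simp [baseWord]

theorem pow_ne_one_of_mem_cartesianSubgroup {v : Monoid.Coprod A B}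
    (hv : v ∈ cartesianSubgroup A B) (hv1 : v ≠ 1) {m : ℕ} (hm : m ≠ 0) : v ^ m ≠ 1 := by
  obtain ⟨W, hW, hne, h⟩ := exists_left_toWreath_eq_lift_mk hv hv1
  have hW1 : FreeGroup.mk W ≠ 1 := by
    intro hW1
    have : Fact (Nat.Prime 2) := ⟨Nat.prime_two⟩
    obtain ⟨P, _, _, t, -, ht⟩ := FreeGroup.exists_isPGroup_lift_mk_ne_one 2 hW hne
    exact ht (by rw [hW1, map_one])
  intro hpow
  have hr : (Monoid.Coprod.toWreath (FreeGroup.of : A × B → _) v).right = 1 := by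
    rwa [Monoid.Coprod.right_toWreath]
  have key := RegularWreathProduct.pow_left_of_right_eq_one hr m 1
  rw [← map_pow, hpow, map_one, RegularWreathProduct.one_left, Pi.one_apply, h] at key
  have hlift : FreeGroup.lift (FreeGroup.of : A × B → _) (FreeGroup.mk W) = FreeGroup.mk W :=
    FreeGroup.lift_of_apply _
  rw [hlift] at key
  exact hW1 ((pow_eq_one_iff_left hm).1 key.symm)

/-- Nontrivial elements of the Cartesian subgroup are detected by homomorphisms to finite groups
that map the Cartesian subgroup to a `p`-group. -/
theorem exists_hom_ne_one_of_mem_cartesianSubgroup [Finite A] [Finite B] (p : ℕ) (hp : p.Prime)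
    {v : Monoid.Coprod A B} (hv : v ∈ cartesianSubgroup A B) (hv1 : v ≠ 1) :
    ∃ (H : Type) (_ : Group H) (_ : Finite H) (φ : Monoid.Coprod A B →* H) (m : ℕ),
      φ v ≠ 1 ∧ ∀ u ∈ cartesianSubgroup A B, φ u ^ p ^ m = 1 := by
  have : Fact p.Prime := ⟨hp⟩
  obtain ⟨W, hW, hne, h⟩ := exists_left_toWreath_eq_lift_mk hv hv1
  obtain ⟨P, _, _, t, hP, ht⟩ := FreeGroup.exists_isPGroup_lift_mk_ne_one p hW hne
  obtain ⟨m, hm⟩ := IsPGroup.iff_card.1 hP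
  let e : P ≀ᵣ (A × B) ≃* Shrink.{0} (P ≀ᵣ (A × B)) := Shrink.mulEquiv.symm
  refine ⟨Shrink.{0} (P ≀ᵣ (A × B)), inferInstance, inferInstance,
    e.toMonoidHom.comp (Monoid.Coprod.toWreath t), m, ?_, fun u hu => ?_⟩
  · intro h1
    have h2 : Monoid.Coprod.toWreath t v = 1 := e.map_eq_one_iff.1 h1
    rw [← h, h2] at ht
    exact ht rfl
  · rw [← map_pow, MonoidHom.comp_apply, map_pow,
      RegularWreathProduct.pow_eq_one_of_right_eq_one, map_one]
    · rwa [Monoid.Coprod.right_toWreath]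
    · intro d
      rw [← hm, pow_card_eq_one']

end Wreath

/-- Lemma 1: if `G = A ∗ B` with `A`, `B` finite, `w 0, ..., w (k-1)` are nontrivial
elements of the Cartesian subgroup, `p` is a prime and `N` a positive integer, then
there is a homomorphism of `G` onto a finite group under which each `w i` maps to a
`p`-element of order greater than `p ^ N`. -/
theorem coprod_exists_hom_pElement_large_order (A B : Type*) [Group A] [Group B]
    [Finite A] [Finite B] (k : ℕ) (w : Fin k → Monoid.Coprod A B)
    (hwC : ∀ i, w i ∈ cartesianSubgroup A B) (hw1 : ∀ i, w i ≠ 1)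
    (p : ℕ) (hp : p.Prime) (N : ℕ) (hN : 0 < N) :
    ∃ (H : Type) (_ : Group H) (_ : Finite H) (φ : Monoid.Coprod A B →* H),
      Function.Surjective φ ∧
      ∀ i, (∃ t : ℕ, orderOf (φ (w i)) = p ^ t) ∧ p ^ N < orderOf (φ (w i)) := by
  have key (i : Fin k) := exists_hom_ne_one_of_mem_cartesianSubgroup p hp
    ((cartesianSubgroup A B).pow_mem (hwC i) (p ^ N))
    (pow_ne_one_of_mem_cartesianSubgroup (hwC i) (hw1 i) (pow_pos hp.pos N).ne')
  choose H _ _ φ m hφ hm using key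
  let Φ : Monoid.Coprod A B →* (∀ i, H i) := MonoidHom.pi φ
  refine ⟨Φ.range, inferInstance, inferInstance, Φ.rangeRestrict, Φ.rangeRestrict_surjective,
    fun i => ?_⟩
  have hord : orderOf (Φ.rangeRestrict (w i)) = orderOf (Φ (w i)) :=
    (Subgroup.orderOf_coe _).symm
  have hdvd : orderOf (Φ (w i)) ∣ p ^ ∑ j, m j := by
    refine orderOf_dvd_of_pow_eq_one (funext fun j => ?_)
    obtain ⟨c, hc⟩ := pow_dvd_pow p (Finset.single_le_sum (fun _ _ => Nat.zero_le _)
      (Finset.mem_univ j) : m j ≤ ∑ j, m j)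
    change φ j (w i) ^ p ^ ∑ j, m j = 1
    rw [hc, pow_mul, hm j _ (hwC i), one_pow]
  obtain ⟨s, -, hs⟩ := (Nat.dvd_prime_pow hp).1 hdvd
  rw [hord, hs]
  refine ⟨⟨s, rfl⟩, Nat.pow_lt_pow_right hp.one_lt (not_le.1 fun hsN => hφ i ?_)⟩
  have h1 : Φ (w i) ^ p ^ N = 1 := orderOf_dvd_iff_pow_eq_one.1 (hs ▸ pow_dvd_pow p hsN)
  rw [map_pow]
  exact congrFun h1 i
end

section
/- Let G = A ∗ B be the free product of two finite groups A and B, and let u_1, ..., u_m be nontrivial elements of the Cartesian subgroup C of G such that no two of them belong to conjugate cyclic subgroups (i.e. for i ≠ j there is no element z ∈ G and no g ∈ G with u_i ∈ ⟨z⟩ and u_j ∈ g⟨z⟩g⁻¹). Suppose moreover that for each i one has u_i = (u_i')^{m_i} where u_i' ∈ G is not a proper power and, if m_i > 1, then (u_i')^{m'} ∉ C for every positive divisor m' of m_i with m' ≠ m_i. Let π be a finite set of prime numbers. Then there exists a homomorphism φ of G onto a finite group such that the orders of φ(u_1), ..., φ(u_m) are pairwise different and no prime p ∈ π divides the order of any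 φ(u_i). -/
/-- An element is not a proper power if it can be written as `v ^ k` with `k` a positive
integer only for `k = 1`. -/
def IsNotProperPower {G : Type*} [Group G] (u : G) : Prop :=
  ∀ (v : G) (k : ℕ), 0 < k → u = v ^ k → k = 1

namespace FreeGroup

theorem toWord_mk_of_isReduced {α : Type*} [DecidableEq α] {L : List (α × Bool)}
    (h : IsReduced L) : (mk L).toWord = L := by
  rw [toWord_mk, h.reduce_eq]

/-- A free group with a nontrivial central element has at most one generator. -/
theorem subsingleton_of_central {α : Type*} {w : FreeGroup α} (hw : w ≠ 1)
    (hc : ∀ g, Commute g w) : Subsingleton α := by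
  classical
  by_contra hs
  rw [not_subsingleton_iff_nontrivial] at hs
  have hW : w.toWord ≠ [] := fun h => hw (toWord_eq_nil_iff.1 h)
  obtain ⟨c, W', hcW⟩ := List.exists_cons_of_ne_nil hW
  obtain ⟨x, hx⟩ := exists_ne c.1
  obtain ⟨d, V, hV⟩ : ∃ d V, w.toWord = V ++ [d] :=
    ⟨_, _, (List.dropLast_append_getLast hW).symm⟩
  have hred : IsReduced w.toWord := isReduced_toWord
  have h1 : IsReduced ((x, d.2) :: w.toWord) := by
    rw [hcW] at hred ⊢
    exact isReduced_cons_cons.2 ⟨fun h => absurd h hx, hred⟩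
  have h2 : IsReduced (w.toWord ++ [(x, d.2)]) := by
    rw [hV] at hred ⊢
    exact IsReduced.append_overlap hred (by simp [IsReduced]) (by simp)
  have key := hc (mk [(x, d.2)])
  have e1 : (mk [(x, d.2)] * w).toWord = (x, d.2) :: w.toWord := by
    conv_lhs => rw [← mk_toWord (x := w)]
    rw [mul_mk, toWord_mk_of_isReduced]
    · rfl
    · exact h1
  have e2 : (w * mk [(x, d.2)]).toWord = w.toWord ++ [(x, d.2)] := by
    conv_lhs => rw [← mk_toWord (x := w)]
    rw [mul_mk, toWord_mk_of_isReduced h2]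
  rw [key.eq, e2, hcW] at e1
  simp only [List.cons_append, List.cons.injEq] at e1
  exact hx (by rw [e1.1])

theorem isCyclic_of_subsingleton (α : Type*) [Subsingleton α] : IsCyclic (FreeGroup α) := by
  rcases isEmpty_or_nonempty α with h | ⟨⟨a⟩⟩
  · infer_instance
  · refine ⟨of a, fun g => ?_⟩
    change g ∈ Subgroup.zpowers (of a)
    induction g using FreeGroup.induction_on with
    | C1 => exact one_mem _
    | of x => rw [Subsingleton.elim x a]; exact Subgroup.mem_zpowers _
    | inv_of x hx => exact inv_mem hx
    | mul x y hx hy => exact mul_mem hx hy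

theorem isCyclic_centralizer {α : Type*} {w : FreeGroup α} (hw : w ≠ 1) :
    IsCyclic (Subgroup.centralizer {w}) := by
  have hmem : w ∈ Subgroup.centralizer {w} := by simp [Subgroup.mem_centralizer_iff]
  let e := IsFreeGroup.toFreeGroup (Subgroup.centralizer {w})
  have : Subsingleton (IsFreeGroup.Generators (Subgroup.centralizer {w})) := by
    refine subsingleton_of_central (w := e ⟨w, hmem⟩) ?_ fun g => ?_
    · rw [Ne, EmbeddingLike.map_eq_one_iff, Subtype.ext_iff]
      exact hw
    · obtain ⟨g, rfl⟩ := e.surjective g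
      refine Commute.map (Subtype.ext ?_ : g * _ = _ * g) e
      have := Subgroup.mem_centralizer_iff.1 g.2 w rfl
      exact this.symm
  have := isCyclic_of_subsingleton (IsFreeGroup.Generators (Subgroup.centralizer {w}))
  exact isCyclic_of_injective e.toMonoidHom e.injective

end FreeGroup

section Holonomy

open Monoid.Coprod
variable {A B H P : Type*} [Group A] [Group B] [Group H] [Group P]

/-- `A ∗ B` acts on `H × P` through `f`: `B` by right translations of `H`, and `A` by right
translations of `H` conjugated by the labelling `lam`. -/
def holPerm (f : Monoid.Coprod A B →* H) (lam : H → P) :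
    Monoid.Coprod A B →* Equiv.Perm (H × P) :=
  let T : H →* Equiv.Perm (H × P) :=
    { toFun := fun g => (Equiv.mulRight g⁻¹).prodCongr (Equiv.refl P)
      map_one' := by ext x <;> simp
      map_mul' := fun g g' => by ext x <;> simp [mul_assoc] }
  let D : Equiv.Perm (H × P) := Equiv.prodShear (Equiv.refl H) fun h => Equiv.mulRight (lam h)⁻¹
  lift ((MulAut.conj D⁻¹).toMonoidHom.comp ((T.comp f).comp inl)) ((T.comp f).comp inr)

/-- The `P`-component of the translate of `(h, 1)` by `g⁻¹` under `holPerm`. -/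
def hol (f : Monoid.Coprod A B →* H) (lam : H → P) (g : Monoid.Coprod A B) (h : H) : P :=
  (holPerm f lam g⁻¹ (h, 1)).2

variable (f : Monoid.Coprod A B →* H) (lam : H → P)

theorem holPerm_inl_inv (a : A) (h : H) (q : P) :
    holPerm f lam (inl a)⁻¹ (h, q) = (h * f (inl a), q * ((lam h)⁻¹ * lam (h * f (inl a)))) := by
  rw [← map_inv]
  simp [holPerm, Equiv.Perm.inv_def, mul_assoc]

theorem holPerm_inr_inv (b : B) (h : H) (q : P) :
    holPerm f lam (inr b)⁻¹ (h, q) = (h * f (inr b), q) := by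
  rw [← map_inv]
  simp [holPerm]

theorem holPerm_inv_apply (g : Monoid.Coprod A B) (h : H) (q : P) :
    holPerm f lam g⁻¹ (h, q) = (h * f g, q * hol f lam g h) := by
  suffices ∃ c : H → P, ∀ h q, holPerm f lam g⁻¹ (h, q) = (h * f g, q * c h) by
    obtain ⟨c, hc⟩ := this
    rw [hol, hc, hc, one_mul]
  induction g using Monoid.Coprod.induction_on with
  | inl a => exact ⟨_, holPerm_inl_inv f lam a⟩
  | inr b => exact ⟨1, fun h q => by rw [holPerm_inr_inv, Pi.one_apply, mul_one]⟩
  | mul x y hx hy =>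
    obtain ⟨c, hc⟩ := hx
    obtain ⟨d, hd⟩ := hy
    refine ⟨fun h => c h * d (h * f x), fun h q => ?_⟩
    rw [mul_inv_rev, map_mul, Equiv.Perm.mul_apply, hc, hd, map_mul]
    simp [mul_assoc]

@[simp] theorem hol_inl (a : A) (h : H) :
    hol f lam (inl a) h = (lam h)⁻¹ * lam (h * f (inl a)) := by
  rw [hol, holPerm_inl_inv, one_mul]

@[simp] theorem hol_inr (b : B) (h : H) : hol f lam (inr b) h = 1 := by
  rw [hol, holPerm_inr_inv]

theorem hol_mul (x y : Monoid.Coprod A B) (h : H) :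
    hol f lam (x * y) h = hol f lam x h * hol f lam y (h * f x) := by
  have := holPerm_inv_apply f lam (x * y) h 1
  rw [mul_inv_rev, map_mul, Equiv.Perm.mul_apply, holPerm_inv_apply, holPerm_inv_apply] at this
  simpa using (congrArg Prod.snd this).symm

@[simp] theorem hol_one (h : H) : hol f lam 1 h = 1 := by
  simpa using hol_inl f lam 1 h

theorem hol_comp {Q : Type*} [Group Q] (ψ : P →* Q) (g : Monoid.Coprod A B) (h : H) :
    hol f (ψ ∘ lam) g h = ψ (hol f lam g h) := by
  induction g using Monoid.Coprod.induction_on generalizing h with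
  | inl a => simp
  | inr b => simp
  | mul x y hx hy => simp [hol_mul, hx, hy]

/-- The restriction of `hol` at the identity to the kernel of `f` is a homomorphism. -/
def holKer : f.ker →* P where
  toFun g := hol f lam g 1
  map_one' := hol_one f lam 1
  map_mul' x y := by
    have : f x = 1 := x.2
    simp [hol_mul, this]

theorem ker_holPerm_le : (holPerm f lam).ker ≤ f.ker := by
  intro g hg
  rw [← inv_mem_iff] at hg
  have := holPerm_inv_apply f lam g 1 1
  rw [MonoidHom.mem_ker.1 hg] at this
  simpa using (congrArg Prod.fst this).symm

theorem holPerm_inv_pow_apply {g : Monoid.Coprod A B} (hg : f g = 1) (n : ℕ) (h : H) (q : P) :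
    holPerm f lam (g ^ n)⁻¹ (h, q) = (h, q * hol f lam g h ^ n) := by
  induction n generalizing q with
  | zero => simp
  | succ n ih =>
    rw [pow_succ', mul_inv_rev, map_mul, Equiv.Perm.mul_apply,
      holPerm_inv_apply f lam g, hg, mul_one, ih, pow_succ', mul_assoc]

/-- Membership of powers in the kernel of `holPerm` is read off from `hol`. -/
theorem pow_mem_ker_holPerm_iff {g : Monoid.Coprod A B} (hg : f g = 1) (n : ℕ) :
    g ^ n ∈ (holPerm f lam).ker ↔ ∀ h, hol f lam g h ^ n = 1 := by
  rw [← inv_mem_iff, MonoidHom.mem_ker]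
  refine ⟨fun hk h => ?_, fun hk => Equiv.ext fun ⟨h, q⟩ => ?_⟩
  · simpa [hk] using (congrArg Prod.snd (holPerm_inv_pow_apply f lam hg n h 1)).symm
  · rw [holPerm_inv_pow_apply f lam hg, hk, mul_one, Equiv.Perm.one_apply]

universe u v w₁ w₂ in
/-- `hol` depends only on finitely many labels, in a way independent of the labelling. -/
theorem exists_finite_support_hol {A : Type u} {B : Type v} [Group A] [Group B]
    (g : Monoid.Coprod A B) : ∃ S : Set (Monoid.Coprod A B), S.Finite ∧
      ∀ (H : Type w₁) (P : Type w₂) [Group H] [Group P] (f : Monoid.Coprod A B →* H) (lam : H → P)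
        (h : H) (Q : Subgroup P), (∀ s ∈ S, lam (h * f s) ∈ Q) → hol f lam g h ∈ Q := by
  induction g using Monoid.Coprod.induction_on with
  | inl a =>
    refine ⟨{1, inl a}, by simp, fun H P _ _ f lam h Q hQ => ?_⟩
    rw [hol_inl]
    exact mul_mem (inv_mem (by simpa using hQ 1 (by simp))) (hQ _ (by simp))
  | inr b => exact ⟨∅, by simp, fun H P _ _ f lam h Q hQ => by simp⟩
  | mul x y hx hy =>
    obtain ⟨S, hS, hx⟩ := hx
    obtain ⟨T, hT, hy⟩ := hy
    refine ⟨S ∪ Set.image (x * ·) T, hS.union (hT.image _), fun H P _ _ f lam h Q hQ => ?_⟩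
    rw [hol_mul]
    refine mul_mem (hx _ _ _ _ _ _ fun s hs => hQ s (Or.inl hs))
      (hy _ _ _ _ _ _ fun s hs => ?_)
    rw [mul_assoc, ← map_mul]
    exact hQ _ (Or.inr ⟨s, hs, rfl⟩)

end Holonomy

section Words

open Monoid.Coprod
variable {A B : Type*} [Group A] [Group B]

/-- The element `a₁ b₁ ⋯ aₙ bₙ` of `A ∗ B`. -/
def altWord (L : List (A × B)) : Monoid.Coprod A B :=
  (L.map fun x => inl x.1 * inr x.2).prod

@[simp] theorem altWord_nil : altWord ([] : List (A × B)) = 1 := rfl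

@[simp] theorem altWord_cons (x : A × B) (L : List (A × B)) :
    altWord (x :: L) = inl x.1 * inr x.2 * altWord L := by simp [altWord]

@[simp] theorem altWord_append (L M : List (A × B)) :
    altWord (L ++ M) = altWord L * altWord M := by simp [altWord]

theorem exists_eq_altWord (g : Monoid.Coprod A B) : ∃ L : List (A × B), g = altWord L := by
  induction g using Monoid.Coprod.induction_on with
  | inl a => exact ⟨[(a, 1)], by simp⟩
  | inr b => exact ⟨[(1, b)], by simp⟩
  | mul x y hx hy =>
    obtain ⟨L, rfl⟩ := hx
    obtain ⟨M, rfl⟩ := hy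
    exact ⟨L ++ M, by simp⟩

/-- Every nontrivial element of the Cartesian subgroup is conjugate to a cyclically reduced
word. -/
theorem exists_conj_altWord {g : Monoid.Coprod A B} (hg : g ∈ cartesianSubgroup A B)
    (hg1 : g ≠ 1) : ∃ (k : Monoid.Coprod A B) (L : List (A × B)), L ≠ [] ∧
      (∀ x ∈ L, x.1 ≠ 1 ∧ x.2 ≠ 1) ∧ g = k * altWord L * k⁻¹ := by
  classical
  have hex : ∃ n, ∃ (k : Monoid.Coprod A B) (L : List (A × B)), L.length = n ∧
      g = k * altWord L * k⁻¹ := by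
    obtain ⟨L, hL⟩ := exists_eq_altWord g
    exact ⟨_, 1, L, rfl, by simpa using hL⟩
  obtain ⟨k, L, hlen, rfl⟩ := Nat.find_spec hex
  have hmin : ∀ (k' : Monoid.Coprod A B) (M : List (A × B)),
      k * altWord L * k⁻¹ = k' * altWord M * k'⁻¹ → L.length ≤ M.length := by
    intro k' M h
    rw [hlen]
    exact Nat.find_min' hex ⟨k', M, rfl, h⟩
  refine ⟨k, L, ?_, ?_, rfl⟩
  · rintro rfl
    simp at hg1
  intro x hx
  by_contra hne
  obtain ⟨a, b⟩ := x
  obtain ⟨L₁, L₂, rfl⟩ := List.append_of_mem hx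
  have hab : a = 1 ∨ b = 1 := by simp only at hne; tauto
  have hrot : k * altWord (L₁ ++ (a, b) :: L₂) * k⁻¹ =
      (k * altWord L₁) * altWord ((a, b) :: (L₂ ++ L₁)) * (k * altWord L₁)⁻¹ := by
    simp only [altWord_append, altWord_cons]
    group
  have hlen' : (L₁ ++ (a, b) :: L₂).length = (L₂ ++ L₁).length + 1 := by
    simp; omega
  rw [hrot, hlen'] at hmin
  rw [hrot] at hg hg1
  generalize L₂ ++ L₁ = M at *
  generalize k * altWord L₁ = k' at *
  rcases hab with rfl | rfl
  · rcases M.eq_nil_or_concat with rfl | ⟨M', c, rfl⟩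
    · refine hg1 ?_
      have : (toProd (k' * altWord [((1 : A), b)] * k'⁻¹)) = 1 := hg
      rw [map_mul, map_mul, map_inv, conj_eq_one_iff] at this
      have hb : b = 1 := by simpa using congrArg Prod.snd this
      simp [hb]
    · have := hmin (k' * inr b) (M' ++ [(c.1, c.2 * b)]) (by
        simp only [altWord_append, altWord_cons, altWord_nil, map_mul, List.concat_eq_append,
          map_one]
        group)
      simp at this
  · rcases M with _ | ⟨c, M'⟩
    · refine hg1 ?_
      have : (toProd (k' * altWord [(a, (1 : B))] * k'⁻¹)) = 1 := hg
      rw [map_mul, map_mul, map_inv, conj_eq_one_iff] at this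
      have ha : a = 1 := by simpa using congrArg Prod.fst this
      simp [ha]
    · have := hmin k' ((a * c.1, c.2) :: M') (by
        simp only [altWord_cons, map_mul, map_one]
        group)
      simp at this

/-- The labels met along the path spelled by a word in the Cayley graph of `A × B`. -/
def pathWord : A × B → List (A × B) → List ((A × B) × Bool)
  | _, [] => []
  | h, x :: L => (h, false) :: (h * (x.1, 1), true) :: pathWord (h * x) L

theorem length_pathWord (h : A × B) (L : List (A × B)) : (pathWord h L).length = 2 * L.length := by
  induction L generalizing h with
  | nil => rfl
  | cons x L ih => simp [pathWord, ih]; omega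

theorem hol_altWord (h : A × B) (L : List (A × B)) :
    hol toProd FreeGroup.of (altWord L) h = FreeGroup.mk (pathWord h L) := by
  induction L generalizing h with
  | nil => simp [pathWord, FreeGroup.one_eq_mk]
  | cons x L ih =>
    have e : h * toProd (inl x.1 * inr x.2 : Monoid.Coprod A B) = h * x := by
      simp
    rw [altWord_cons, hol_mul, e, ih, hol_mul, hol_inl, hol_inr, pathWord, mul_one, FreeGroup.of,
      FreeGroup.inv_mk, FreeGroup.of, FreeGroup.mul_mk, FreeGroup.mul_mk]
    simp [FreeGroup.invRev]

theorem isChain_pathWord (h : A × B) {L : List (A × B)} (hL : ∀ x ∈ L, x.1 ≠ 1 ∧ x.2 ≠ 1) :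
    (pathWord h L).IsChain fun x y => x.1 ≠ y.1 := by
  induction L generalizing h with
  | nil => exact List.isChain_nil
  | cons x L ih =>
    have hx := hL x (by simp)
    have hrest := ih (h * x) fun y hy => hL y (by simp [hy])
    refine List.isChain_cons_cons.2 ⟨?_, ?_⟩
    · simp [Prod.ext_iff, hx.1]
    · rcases L with _ | ⟨y, L⟩
      · exact List.isChain_singleton _
      · refine List.isChain_cons_cons.2 ⟨?_, hrest⟩
        simp [Prod.ext_iff, hx.2.symm]

theorem norm_hol_altWord [DecidableEq (A × B)] (h : A × B) {L : List (A × B)}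
    (hL : ∀ x ∈ L, x.1 ≠ 1 ∧ x.2 ≠ 1) :
    (hol toProd FreeGroup.of (altWord L) h).norm = 2 * L.length := by
  rw [hol_altWord, FreeGroup.norm, FreeGroup.toWord_mk_of_isReduced, length_pathWord]
  exact (isChain_pathWord h hL).imp fun x y hxy h => absurd h hxy

/-- The embedding of the Cartesian subgroup in a free group. -/
def cartesianEmbedding (A B : Type*) [Group A] [Group B] :
    cartesianSubgroup A B →* FreeGroup (A × B) :=
  holKer (toProd : Monoid.Coprod A B →* A × B) FreeGroup.of

theorem hol_conj_ne_one {k : Monoid.Coprod A B} {L : List (A × B)}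
    (hmem : k * altWord L * k⁻¹ ∈ cartesianSubgroup A B)
    {P : Type*} [Group P] (ψ : FreeGroup (A × B) →* P)
    {h : A × B} (hψ : ψ (FreeGroup.mk (pathWord (h * toProd k) L)) ≠ 1) :
    hol toProd (ψ ∘ FreeGroup.of) (k * altWord L * k⁻¹) h ≠ 1 := by
  have hw : toProd (altWord L) = 1 := by
    have : toProd (k * altWord L * k⁻¹) = 1 := hmem
    rwa [map_mul, map_mul, map_inv, conj_eq_one_iff] at this
  have e : hol toProd (ψ ∘ FreeGroup.of) (k * k⁻¹) h = 1 := by simp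
  rw [hol_mul] at e
  rw [hol_mul, hol_mul, map_mul, hw, mul_one, eq_inv_of_mul_eq_one_right e, Ne,
    conj_eq_one_iff, hol_comp, hol_altWord]
  exact hψ

theorem cartesianEmbedding_injective : Function.Injective (cartesianEmbedding A B) := by
  classical
  rw [injective_iff_map_eq_one]
  rintro ⟨g, hg⟩ h1
  by_contra hne
  obtain ⟨k, L, hL0, hL, rfl⟩ := exists_conj_altWord hg fun h => hne (Subtype.ext h)
  refine hol_conj_ne_one (h := 1) (hmem := hg) (ψ := MonoidHom.id _) ?_ h1
  rw [MonoidHom.id_apply, ← hol_altWord]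
  intro h'
  have := norm_hol_altWord (1 * toProd k) hL
  rw [h', FreeGroup.norm_one] at this
  have := List.length_pos_iff.2 hL0
  omega

theorem exists_zpowers_eq_centralizer {u : Monoid.Coprod A B} (hu : u ∈ cartesianSubgroup A B)
    (hu1 : u ≠ 1) : ∃ z ∈ cartesianSubgroup A B,
      ∀ g ∈ cartesianSubgroup A B, Commute g u ↔ g ∈ Subgroup.zpowers z := by
  let e := cartesianEmbedding A B
  have hinj : Function.Injective e := cartesianEmbedding_injective
  let u' : cartesianSubgroup A B := ⟨u, hu⟩
  have hne : e u' ≠ 1 := by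
    rw [Ne, map_eq_one_iff e hinj, Subtype.ext_iff]
    exact hu1
  have := FreeGroup.isCyclic_centralizer hne
  let e' : Subgroup.centralizer {u'} →* Subgroup.centralizer {e u'} :=
    (e.comp (Subgroup.subtype _)).codRestrict _ fun x => by
      have := Subgroup.mem_centralizer_iff.1 x.2 u' rfl
      rw [Subgroup.mem_centralizer_iff]
      rintro _ rfl
      simp only [MonoidHom.comp_apply, Subgroup.subtype_apply, ← map_mul, this]
  have : IsCyclic (Subgroup.centralizer {u'}) := isCyclic_of_injective e' fun x y h =>
    Subtype.ext (hinj (congrArg Subtype.val h))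
  obtain ⟨z, hz⟩ := this.exists_generator
  refine ⟨z, z.1.2, fun g hg => ⟨fun h => ?_, ?_⟩⟩
  · obtain ⟨n, hn⟩ := Subgroup.mem_zpowers_iff.1 (hz ⟨⟨g, hg⟩, by
      rw [Subgroup.mem_centralizer_iff]
      rintro _ rfl
      exact Subtype.ext h.symm⟩)
    refine Subgroup.mem_zpowers_iff.2 ⟨n, ?_⟩
    simpa using congrArg (fun x : Subgroup.centralizer {u'} => (x.1 : Monoid.Coprod A B)) hn
  · intro h
    obtain ⟨n, rfl⟩ := Subgroup.mem_zpowers_iff.1 h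
    refine Commute.zpow_left ?_ n
    have := Subgroup.mem_centralizer_iff.1 z.2 u' rfl
    exact (congrArg Subtype.val this).symm

theorem eq_one_of_pow_eq_one {u : Monoid.Coprod A B} (hu : u ∈ cartesianSubgroup A B)
    {n : ℕ} (hn : n ≠ 0) (h : u ^ n = 1) : u = 1 := by
  have h' : cartesianEmbedding A B ⟨u, hu⟩ ^ n = 1 := by
    rw [← map_pow, map_eq_one_iff _ cartesianEmbedding_injective]
    exact Subtype.ext h
  rw [pow_eq_one_iff_left hn, map_eq_one_iff _ cartesianEmbedding_injective] at h'
  exact congrArg Subtype.val h'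

end Words

section Unipotent

/-- The group of upper unitriangular matrices. -/
def unitriangular (n : ℕ) (R : Type*) [CommRing R] : Subgroup (Matrix (Fin n) (Fin n) R)ˣ where
  carrier := {x | (x : Matrix (Fin n) (Fin n) R).BlockTriangular id ∧
    ∀ i, (x : Matrix (Fin n) (Fin n) R) i i = 1}
  one_mem' := ⟨Matrix.blockTriangular_one, fun i => by simp⟩
  mul_mem' := by
    rintro x y ⟨hx, hx'⟩ ⟨hy, hy'⟩
    refine ⟨hx.mul hy, fun i => ?_⟩
    rw [Units.val_mul, Matrix.mul_apply, Finset.sum_eq_single i, hx', hy', one_mul]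
    · intro j _ hj
      rcases lt_or_gt_of_ne hj with h | h
      · rw [hx h, zero_mul]
      · rw [hy h, mul_zero]
    · simp
  inv_mem' := by
    rintro x ⟨hx, hx'⟩
    have hi : ((x⁻¹ : (Matrix (Fin n) (Fin n) R)ˣ) : Matrix (Fin n) (Fin n) R).BlockTriangular
        id := by
      let := x.invertible
      rw [Matrix.coe_units_inv]
      exact Matrix.blockTriangular_inv_of_blockTriangular hx
    refine ⟨hi, fun i => ?_⟩
    have h1 : ((x : Matrix (Fin n) (Fin n) R) * (x⁻¹ : (Matrix (Fin n) (Fin n) R)ˣ)) i i = 1 := by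
      rw [Units.mul_inv, Matrix.one_apply_eq]
    rw [Matrix.mul_apply, Finset.sum_eq_single i, hx', one_mul] at h1
    · exact h1
    · intro j _ hj
      rcases lt_or_gt_of_ne hj with h | h
      · rw [hx h, zero_mul]
      · rw [hi h, mul_zero]
    · simp

theorem isPGroup_unitriangular (p n : ℕ) [hp : Fact p.Prime] :
    IsPGroup p (unitriangular (n + 1) (ZMod p)) := by
  rintro ⟨x, hx, hx'⟩
  refine ⟨n + 1, ?_⟩
  rw [Subtype.ext_iff, Units.ext_iff]
  simp only [SubgroupClass.coe_pow, Units.val_pow_eq_pow_val, OneMemClass.coe_one, Units.val_one]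
  have hnil : ((x : Matrix (Fin (n + 1)) (Fin (n + 1)) (ZMod p)) - 1) ^ (n + 1) = 0 := by
    have h := Matrix.aeval_self_charpoly (x : Matrix (Fin (n + 1)) (Fin (n + 1)) (ZMod p))
    rw [Matrix.charpoly_of_isUpperTriangular _ hx] at h
    simpa [hx'] using h
  have h := sub_pow_char_pow_of_commute (p := p) (n + 1)
    (Commute.one_right (x : Matrix (Fin (n + 1)) (Fin (n + 1)) (ZMod p)))
  rw [pow_eq_zero_of_le (Nat.lt_pow_self hp.out.one_lt).le hnil, one_pow] at h
  exact (sub_eq_zero.1 h.symm)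

/-- A nontrivial word in a free group without equal adjacent letters survives in a finite
`p`-group. -/
theorem exists_isPGroup_mk_ne_one {X : Type*} (p : ℕ) [hp : Fact p.Prime] {l : List (X × Bool)}
    (hl : l ≠ []) (hc : l.IsChain fun x y => x.1 ≠ y.1) :
    ∃ (P : Type) (_ : Group P) (_ : Finite P) (ψ : FreeGroup X →* P), IsPGroup p P ∧
      ψ (FreeGroup.mk l) ≠ 1 := by
  classical
  set n := l.length with hn
  let N : X → Matrix (Fin (n + 1)) (Fin (n + 1)) (ZMod p) := fun x => Matrix.of fun i j =>
    if i.val + 1 = j.val ∧ ∃ e, l[i.val]? = some (x, e) then 1 else 0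
  have hNN : ∀ x, N x * N x = 0 := by
    intro x
    ext i j
    rw [Matrix.mul_apply, Matrix.zero_apply]
    refine Finset.sum_eq_zero fun k _ => ?_
    simp only [N, Matrix.of_apply]
    split_ifs with h1 h2
    · exfalso
      obtain ⟨hik, e, he⟩ := h1
      obtain ⟨-, e', he'⟩ := h2
      rw [← hik] at he'
      obtain ⟨h3, h4⟩ := List.getElem?_eq_some_iff.1 he
      obtain ⟨h5, h6⟩ := List.getElem?_eq_some_iff.1 he'
      have := List.isChain_iff_getElem.1 hc i.val h5
      rw [h4, h6] at this
      exact this rfl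
    all_goals simp
  let U : X → (Matrix (Fin (n + 1)) (Fin (n + 1)) (ZMod p))ˣ := fun x =>
    ⟨1 + N x, 1 - N x, by simp [mul_sub, add_mul, hNN], by simp [mul_add, sub_mul, hNN]⟩
  have hU : ∀ x, U x ∈ unitriangular (n + 1) (ZMod p) := by
    refine fun x => ⟨fun i j hij => ?_, fun i => ?_⟩
    · have h1 : j < i := hij
      have h2 : ¬ (i.val + 1 = j.val) := by rw [Fin.lt_def] at h1; omega
      simp [U, N, h1.ne', h2]
    · simp [U, N]
  let ψ : FreeGroup X →* unitriangular (n + 1) (ZMod p) := FreeGroup.lift fun x => ⟨U x, hU x⟩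
  refine ⟨_, inferInstance, inferInstance, ψ, isPGroup_unitriangular p n, ?_⟩
  let M : List (X × Bool) → Matrix (Fin (n + 1)) (Fin (n + 1)) (ZMod p) := fun w =>
    ((ψ (FreeGroup.mk w) : (Matrix (Fin (n + 1)) (Fin (n + 1)) (ZMod p))ˣ) : Matrix _ _ _)
  have hM : ∀ w x, ∃ c : ZMod p, c ≠ 0 ∧ M (w ++ [x]) = M w * (1 + c • N x.1) := by
    rintro w ⟨x, e⟩
    have h1 : M (w ++ [(x, e)]) = M w * M [(x, e)] := by
      simp only [M, ← FreeGroup.mul_mk, map_mul, Subgroup.coe_mul, Units.val_mul]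
    rcases e with _ | _
    · refine ⟨-1, by simp, ?_⟩
      have h2 : FreeGroup.mk [(x, false)] = (FreeGroup.of x)⁻¹ := by
        simp [FreeGroup.of, FreeGroup.invRev]
      rw [h1]
      congr 1
      simp only [M, h2, map_inv, ψ, FreeGroup.lift_apply_of]
      change 1 - N x = _
      simp [sub_eq_add_neg]
    · refine ⟨1, one_ne_zero, ?_⟩
      have h2 : FreeGroup.mk [(x, true)] = FreeGroup.of x := rfl
      rw [h1]
      congr 1
      simp only [M, h2, ψ, FreeGroup.lift_apply_of]
      change 1 + N x = _
      simp
  have key : ∀ m ≤ n, (∀ j : Fin (n + 1), m < j.val → M (l.take m) 0 j = 0) ∧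
      ∀ j : Fin (n + 1), j.val = m → M (l.take m) 0 j ≠ 0 := by
    intro m
    induction m with
    | zero =>
      refine fun _ => ⟨fun j hj => ?_, fun j hj => ?_⟩
      · have : (0 : Fin (n + 1)) ≠ j := by rintro rfl; simp at hj
        have h0 : M [] = 1 := by simp [M, ← FreeGroup.one_eq_mk]
        simp [h0, this]
      · have : j = 0 := Fin.ext hj
        have h0 : M [] = 1 := by simp [M, ← FreeGroup.one_eq_mk]
        simp [h0, this]
    | succ m ih =>
      intro hm
      obtain ⟨ih1, ih2⟩ := ih (by omega)
      have hml : m < l.length := by omega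
      obtain ⟨c, hc0, hcM⟩ := hM (l.take m) l[m]
      rw [← List.take_concat_get' l m hml] 
      have hj : ∀ j : Fin (n + 1), M (l.take m ++ [l[m]]) 0 j =
          M (l.take m) 0 j + c * ∑ i, M (l.take m) 0 i * N l[m].1 i j := by
        intro j
        rw [hcM, mul_add, mul_one, mul_smul_comm, Matrix.add_apply, Matrix.smul_apply,
          Matrix.mul_apply, smul_eq_mul]
      refine ⟨fun j hmj => ?_, fun j hmj => ?_⟩
      · rw [hj, ih1 j (by omega), zero_add, Finset.sum_eq_zero, mul_zero]
        intro i _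
        by_cases hi : i.val + 1 = j.val
        · rw [ih1 i (by omega), zero_mul]
        · simp [N, hi]
      · rw [hj, ih1 j (by omega), zero_add, Finset.sum_eq_single ⟨m, by omega⟩]
        · refine mul_ne_zero hc0 (mul_ne_zero (ih2 _ rfl) ?_)
          have : ∃ e, l[m]? = some (l[m].1, e) := ⟨l[m].2, by simp [hml]⟩
          simp only [N, Matrix.of_apply]
          rw [if_pos ⟨hmj.symm, this⟩]
          exact one_ne_zero
        · intro i _ hi
          have : ¬ (i.val + 1 = j.val) := fun h => hi (Fin.ext (by simp; omega))
          simp [N, this]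
        · simp
  intro h
  have h0 : M l = 1 := by simp [M, h]
  have h1 := (key n le_rfl).2 (Fin.last n) rfl
  rw [List.take_of_length_le hn.ge, h0, Matrix.one_apply_ne] at h1
  · exact h1 rfl
  · have := List.length_pos_iff.2 hl
    intro h2
    have := congrArg Fin.val h2
    simp at this
    omega

end Unipotent

section Admissible

open Monoid.Coprod
variable {A B : Type*} [Group A] [Group B]

/-- Normal subgroups of finite index in `A ∗ B` contained in the Cartesian subgroup with index
a power of `p`. -/
structure IsAdmissible (p : ℕ) (N : Subgroup (Monoid.Coprod A B)) : Prop where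
  normal : N.Normal
  finiteIndex : N.FiniteIndex
  le : N ≤ cartesianSubgroup A B
  pow_mem : ∀ c ∈ cartesianSubgroup A B, ∃ k, c ^ p ^ k ∈ N

theorem IsAdmissible.inf {p : ℕ} {N M : Subgroup (Monoid.Coprod A B)} (hN : IsAdmissible p N)
    (hM : IsAdmissible p M) : IsAdmissible p (N ⊓ M) where
  normal := by
    have := hN.normal
    have := hM.normal
    infer_instance
  finiteIndex := by
    have := hN.finiteIndex
    have := hM.finiteIndex
    infer_instance
  le := inf_le_left.trans hN.le
  pow_mem c hc := by
    obtain ⟨k, hk⟩ := hN.pow_mem c hc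
    obtain ⟨l, hl⟩ := hM.pow_mem c hc
    refine ⟨k + l, ?_, ?_⟩
    · rw [pow_add, pow_mul]
      exact Subgroup.pow_mem _ hk _
    · rw [pow_add, mul_comm, pow_mul]
      exact Subgroup.pow_mem _ hl _

theorem isAdmissible_cartesianSubgroup [Finite A] [Finite B] (p : ℕ) :
    IsAdmissible p (cartesianSubgroup A B) where
  normal := MonoidHom.normal_ker _
  finiteIndex := Subgroup.finiteIndex_ker _
  le := le_rfl
  pow_mem c hc := ⟨0, by simpa using hc⟩

theorem isAdmissible_ker_holPerm {H P : Type*} [Group H] [Group P] [Finite H] [Finite P] {p : ℕ}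
    [Fact p.Prime] (hP : IsPGroup p P) {f : Monoid.Coprod A B →* H} (hf : IsAdmissible p f.ker)
    (lam : H → P) : IsAdmissible p (holPerm f lam).ker where
  normal := MonoidHom.normal_ker _
  finiteIndex := Subgroup.finiteIndex_ker _
  le := (ker_holPerm_le f lam).trans hf.le
  pow_mem c hc := by
    obtain ⟨k, hk⟩ := hf.pow_mem c hc
    obtain ⟨l, hl⟩ := IsPGroup.iff_card.1 hP
    refine ⟨k + l, ?_⟩
    rw [pow_add, pow_mul, pow_mem_ker_holPerm_iff f lam hk, ← hl]
    exact fun h => pow_card_eq_one'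

/-- The Cartesian subgroup is residually a finite `p`-group, through quotients of `A ∗ B`. -/
theorem exists_isAdmissible_notMem [Finite A] [Finite B] (p : ℕ) [Fact p.Prime]
    {g : Monoid.Coprod A B} (hg : g ∈ cartesianSubgroup A B) (hg1 : g ≠ 1) :
    ∃ N, IsAdmissible p N ∧ g ∉ N := by
  obtain ⟨k, L, hL0, hL, rfl⟩ := exists_conj_altWord hg hg1
  have hne : pathWord (1 * toProd k) L ≠ [] := by
    rw [Ne, ← List.length_eq_zero_iff, length_pathWord]
    have := List.length_pos_iff.2 hL0
    omega
  obtain ⟨P, _, _, ψ, hP, hψ⟩ := exists_isPGroup_mk_ne_one p hne (isChain_pathWord _ hL)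
  refine ⟨_, isAdmissible_ker_holPerm (f := (toProd : Monoid.Coprod A B →* A × B)) hP
    (isAdmissible_cartesianSubgroup p) (ψ ∘ FreeGroup.of), fun h => hol_conj_ne_one hg ψ hψ ?_⟩
  have := (pow_mem_ker_holPerm_iff (toProd : Monoid.Coprod A B →* A × B) (ψ ∘ FreeGroup.of) hg
    1).1 (by rwa [pow_one]) 1
  rwa [pow_one] at this

theorem exists_isAdmissible_forall {ι : Type*} [Finite A] [Finite B] {p : ℕ} {S : Set ι}
    (hS : S.Finite) {T : ι → Set (Monoid.Coprod A B)}
    (h : ∀ i ∈ S, ∃ N, IsAdmissible p N ∧ ∀ x ∈ T i, x ∉ N) :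
    ∃ N, IsAdmissible p N ∧ ∀ i ∈ S, ∀ x ∈ T i, x ∉ N := by
  induction S, hS using Set.Finite.induction_on with
  | empty => exact ⟨_, isAdmissible_cartesianSubgroup p, by simp⟩
  | @insert a S _ _ ih =>
    obtain ⟨N, hN, hN'⟩ := ih fun i hi => h i (Set.mem_insert_of_mem _ hi)
    obtain ⟨M, hM, hM'⟩ := h a (Set.mem_insert _ _)
    refine ⟨N ⊓ M, hN.inf hM, ?_⟩
    rintro i (rfl | hi) x hx hx'
    · exact hM' x hx hx'.2
    · exact hN' i hi x hx hx'.1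

/-- Cyclic subgroups that are their own centralizers in the Cartesian subgroup are separable. -/
theorem exists_isAdmissible_forall_zpowers [Finite A] [Finite B] (p : ℕ) [Fact p.Prime]
    {z : Monoid.Coprod A B} (hzC : z ∈ cartesianSubgroup A B)
    (hz : ∀ g ∈ cartesianSubgroup A B, Commute g z → g ∈ Subgroup.zpowers z)
    {S : Set (Monoid.Coprod A B)} (hS : S.Finite) (hSz : ∀ s ∈ S, s ∉ Subgroup.zpowers z) :
    ∃ N, IsAdmissible p N ∧ ∀ s ∈ S, ∀ i : ℤ, s * z ^ i ∉ N := by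
  suffices ∀ s ∈ S, ∃ N, IsAdmissible p N ∧ ∀ x ∈ Set.range fun i : ℤ => s * z ^ i, x ∉ N by
    simpa only [Set.forall_mem_range] using exists_isAdmissible_forall hS this
  intro s hs
  by_cases hsC : s ∈ cartesianSubgroup A B
  · have hne : s * z * s⁻¹ * z⁻¹ ≠ 1 := fun h => hSz s hs (hz s hsC (by
      rw [mul_inv_eq_one, mul_inv_eq_iff_eq_mul] at h
      exact h))
    obtain ⟨N, hN, hN'⟩ := exists_isAdmissible_notMem p
      (mul_mem (mul_mem (mul_mem hsC hzC) (inv_mem hsC)) (inv_mem hzC)) hne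
    refine ⟨N, hN, ?_⟩
    rintro _ ⟨i, rfl⟩ h
    have := hN.normal
    refine hN' ?_
    have h1 := mul_mem h (hN.normal.conj_mem _ (inv_mem h) z)
    convert h1 using 1
    group
  · refine ⟨_, isAdmissible_cartesianSubgroup p, ?_⟩
    rintro _ ⟨i, rfl⟩ h
    exact hsC ((Subgroup.mul_mem_cancel_right _ (zpow_mem hzC i)).1 h)

/-- There is a finite `p`-group with a product of two elements of order `p` not of order `p`. -/
theorem exists_isPGroup_mul_pow_ne_one (p : ℕ) [hp : Fact p.Prime] :
    ∃ (P : Type) (_ : Group P) (_ : Finite P) (a b : P), IsPGroup p P ∧ a ^ p = 1 ∧ b ^ p = 1 ∧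
      (a * b) ^ p ≠ 1 := by
  classical
  obtain ⟨Z, _, hcard⟩ : ∃ (Z : Type) (_ : Group Z), Nat.card Z = p :=
    ⟨Multiplicative (ZMod p), inferInstance, Nat.card_zmod p⟩
  have : Finite Z := Nat.finite_of_card_ne_zero (hcard ▸ hp.out.ne_zero)
  have : Nontrivial Z := (Finite.one_lt_card_iff_nontrivial).1 (hcard ▸ hp.out.one_lt)
  obtain ⟨c, hc⟩ := exists_ne (1 : Z)
  have hZ : ∀ x : Z, x ^ p = 1 := fun x => hcard ▸ pow_card_eq_one'
  have hC : ∀ x : Monoid.Coprod Z Z, x ^ p ∈ cartesianSubgroup Z Z := fun x => by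
    rw [cartesianSubgroup, MonoidHom.mem_ker, map_pow]
    ext1 <;> simp [hZ]
  have hne : (inl c * inr c : Monoid.Coprod Z Z) ^ p ≠ 1 := by
    have : (inl c * inr c : Monoid.Coprod Z Z) ^ p = altWord (List.replicate p (c, c)) := by
      simp [altWord]
    rw [this]
    intro h
    have h1 := norm_hol_altWord (1 : Z × Z) (L := List.replicate p (c, c)) fun x hx => by
      rw [List.eq_of_mem_replicate hx]
      exact ⟨hc, hc⟩
    rw [h, hol_one, FreeGroup.norm_one, List.length_replicate] at h1
    have := hp.out.pos
    omega
  obtain ⟨N, hN, hN'⟩ := exists_isAdmissible_notMem p (hC _) hne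
  have := hN.normal
  have := hN.finiteIndex
  refine ⟨Monoid.Coprod Z Z ⧸ N, inferInstance, inferInstance, (inl c : Monoid.Coprod Z Z),
    (inr c : Monoid.Coprod Z Z), ?_, ?_, ?_, ?_⟩
  · intro x
    obtain ⟨x, rfl⟩ := QuotientGroup.mk_surjective x
    obtain ⟨k, hk⟩ := hN.pow_mem _ (hC x)
    refine ⟨k + 1, ?_⟩
    rw [pow_succ', pow_mul, ← QuotientGroup.mk_pow, ← QuotientGroup.mk_pow,
      QuotientGroup.eq_one_iff]
    exact hk
  · rw [← QuotientGroup.mk_pow, ← map_pow, hZ]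
    simp
  · rw [← QuotientGroup.mk_pow, ← map_pow, hZ]
    simp
  · rw [← QuotientGroup.mk_mul, ← QuotientGroup.mk_pow, Ne, QuotientGroup.eq_one_iff]
    exact hN'

end Admissible

section Support

open Monoid.Coprod
variable {A B : Type*} [Group A] [Group B]

theorem altWord_pow (L : List (A × B)) (n : ℕ) :
    altWord L ^ n = altWord (List.replicate n L).flatten := by
  induction n with
  | zero => simp
  | succ n ih => rw [pow_succ', ih, List.replicate_succ, List.flatten_cons, altWord_append]

theorem norm_hol_altWord_zpow [DecidableEq (A × B)] {L : List (A × B)}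
    (hL : ∀ x ∈ L, x.1 ≠ 1 ∧ x.2 ≠ 1) (hC : altWord L ∈ cartesianSubgroup A B) (j : ℤ) :
    (hol toProd FreeGroup.of (altWord L ^ j) 1).norm = 2 * (j.natAbs * L.length) := by
  have hnat (n : ℕ) : (hol toProd FreeGroup.of (altWord L ^ n) 1).norm = 2 * (n * L.length) := by
    rw [altWord_pow, norm_hol_altWord, List.length_flatten]
    · simp
    · intro x hx
      obtain ⟨M, hM, hx⟩ := List.mem_flatten.1 hx
      exact hL x (List.eq_of_mem_replicate hM ▸ hx)
  obtain ⟨n, rfl | rfl⟩ := j.eq_nat_or_neg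
  · simpa using hnat n
  · have : hol toProd FreeGroup.of (altWord L ^ (-(n : ℤ))) 1 =
        (hol toProd FreeGroup.of (altWord L ^ n) 1)⁻¹ := by
      rw [zpow_neg, zpow_natCast]
      exact map_inv (cartesianEmbedding A B) ⟨altWord L ^ n, pow_mem hC n⟩
    rw [this, FreeGroup.norm_inv_eq, hnat]
    simp

/-- The prefixes of `altWord L` whose labels are met by `hol`. -/
def positions : List (A × B) → List (Monoid.Coprod A B)
  | [] => []
  | x :: L => 1 :: inl x.1 :: (positions L).map (inl x.1 * inr x.2 * ·)

theorem exists_of_mem_positions {L : List (A × B)} {s : Monoid.Coprod A B}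
    (hs : s ∈ positions L) : ∃ L₁ x L₂, L = L₁ ++ x :: L₂ ∧
      (s = altWord L₁ ∨ s = altWord L₁ * inl x.1) := by
  induction L generalizing s with
  | nil => simp [positions] at hs
  | cons x L ih =>
    simp only [positions, List.mem_cons, List.mem_map] at hs
    obtain rfl | rfl | ⟨s, hs, rfl⟩ := hs
    · exact ⟨[], x, L, rfl, by simp⟩
    · exact ⟨[], x, L, rfl, by simp⟩
    · obtain ⟨L₁, y, L₂, rfl, h | h⟩ := ih hs
      · exact ⟨x :: L₁, y, L₂, rfl, Or.inl (by simp [h])⟩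
      · exact ⟨x :: L₁, y, L₂, rfl, Or.inr (by simp [h, mul_assoc])⟩

theorem hol_altWord_eq_one {H P : Type*} [Group H] [Group P] (f : Monoid.Coprod A B →* H)
    (lam : H → P) (L : List (A × B)) (h : H) (hL : ∀ s ∈ positions L, lam (h * f s) = 1) :
    hol f lam (altWord L) h = 1 := by
  induction L generalizing h with
  | nil => simp
  | cons x L ih =>
    simp only [positions, List.forall_mem_cons, List.forall_mem_map] at hL
    have h0 : lam h = 1 := by simpa using hL.1
    rw [altWord_cons, hol_mul, ih, hol_mul, hol_inl, hol_inr, hL.2.1, h0]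
    · simp
    · intro s hs
      rw [mul_assoc, ← map_mul]
      exact hL.2.2 s hs

/-- For a cyclically reduced `y`, the value of `hol` at `y` is the inverse of the initial label
when the other labels met are trivial, and these other labels lie outside the powers of `y`. -/
theorem exists_finite_hol_eq_inv {L : List (A × B)} (hL0 : L ≠ [])
    (hL : ∀ x ∈ L, x.1 ≠ 1 ∧ x.2 ≠ 1) (hC : altWord L ∈ cartesianSubgroup A B) :
    ∃ S : Set (Monoid.Coprod A B), S.Finite ∧ (∀ s ∈ S, s ∉ Subgroup.zpowers (altWord L)) ∧
      ∀ {H P : Type*} [Group H] [Group P] (f : Monoid.Coprod A B →* H) (lam : H → P) (h : H),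
        (∀ s ∈ S, lam (h * f s) = 1) → hol f lam (altWord L) h = (lam h)⁻¹ := by
  classical
  refine ⟨{s | s ∈ (positions L).tail}, List.finite_toSet _, fun s hs hmem => ?_, ?_⟩
  · obtain ⟨j, rfl⟩ := Subgroup.mem_zpowers_iff.1 hmem
    have hnorm := norm_hol_altWord_zpow hL hC j
    obtain ⟨L₁, x, L₂, rfl, h⟩ : ∃ L₁ x L₂, L = L₁ ++ x :: L₂ ∧
        ((L₁ ≠ [] ∧ altWord L ^ j = altWord L₁) ∨ altWord L ^ j = altWord L₁ * inl x.1) := by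
      rcases L with _ | ⟨x, L⟩
      · exact absurd rfl hL0
      simp only [positions, List.tail_cons, Set.mem_ofPred_eq, List.mem_cons, List.mem_map] at hs
      obtain h | ⟨s, hs, h⟩ := hs
      · exact ⟨[], x, L, rfl, Or.inr (by rw [h, altWord_nil, one_mul])⟩
      · obtain ⟨L₁, y, L₂, e, h' | h'⟩ := exists_of_mem_positions hs
        · exact ⟨x :: L₁, y, L₂, by simp [e], Or.inl ⟨by simp, by rw [← h, h', altWord_cons]⟩⟩
        · exact ⟨x :: L₁, y, L₂, by simp [e], Or.inr (by
            rw [← h, h', altWord_cons, mul_assoc _ (altWord L₁)])⟩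
    have hlen : (L₁ ++ x :: L₂).length = L₁.length + 1 + L₂.length := by simp; omega
    rw [hlen] at hnorm
    obtain ⟨h0, h⟩ | h := h
    · rw [h, norm_hol_altWord 1 fun y hy => hL y (by simp [hy])] at hnorm
      have hpos := List.length_pos_iff.2 h0
      rcases Nat.eq_zero_or_pos j.natAbs with hj | hj
      · rw [hj] at hnorm; omega
      · nlinarith
    · have e : hol toProd FreeGroup.of (altWord L₁ * inl x.1) (1 : A × B) =
          hol toProd FreeGroup.of (altWord (L₁ ++ [x])) 1 := by
        simp [hol_mul]
      rw [h, e, norm_hol_altWord 1 (fun y hy => hL y (by simp at hy ⊢; tauto)),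
        List.length_append, List.length_singleton] at hnorm
      rcases Nat.eq_zero_or_pos j.natAbs with hj | hj
      · rw [hj] at hnorm; omega
      have h2 : L₂ = [] := by
        rw [← List.length_eq_zero_iff]
        nlinarith
      subst h2
      have hx := zpow_mem hC j
      rw [h] at hx
      have hC' : altWord L₁ * inl x.1 * inr x.2 ∈ cartesianSubgroup A B := by
        simpa [mul_assoc] using hC
      rw [Subgroup.mul_mem_cancel_left _ hx] at hC'
      have : toProd (inr x.2 : Monoid.Coprod A B) = 1 := hC'
      exact (hL x (by simp)).2 (by simpa using congrArg Prod.snd this)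
  · intro H P _ _ f lam h hlam
    rcases L with _ | ⟨x, L⟩
    · exact absurd rfl hL0
    simp only [positions, List.tail_cons, Set.mem_ofPred_eq, List.forall_mem_cons,
      List.forall_mem_map] at hlam
    rw [altWord_cons, hol_mul, hol_altWord_eq_one, hol_mul, hol_inl, hol_inr, hlam.1]
    · simp
    · intro s hs
      rw [mul_assoc, ← map_mul]
      exact hlam.2 s hs

end Support

section Separation

open Monoid.Coprod
variable {A B : Type*} [Group A] [Group B]

theorem hol_pow_mem {H P : Type*} [Group H] [Group P] (f : Monoid.Coprod A B →* H) (lam : H → P)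
    (g : Monoid.Coprod A B) (h : H) (Q : Subgroup P)
    (hQ : ∀ i : ℕ, hol f lam g (h * f (g ^ i)) ∈ Q) (n : ℕ) : hol f lam (g ^ n) h ∈ Q := by
  induction n with
  | zero => simp
  | succ n ih =>
    rw [pow_succ, hol_mul]
    exact mul_mem ih (hQ n)

theorem exists_pos_forall_mul_pow_mul_inv_notMem {G : Type*} [Group G] {y z : G} {S : Set G}
    (hS : S.Finite) (hnc : ∀ (g : G) (i j : ℤ), i ≠ 0 → y ^ i ≠ g * z ^ j * g⁻¹) :
    ∃ t : ℕ, 0 < t ∧ ∀ s ∈ S, ∀ s' ∈ S, s * y ^ t * s'⁻¹ ∉ Subgroup.zpowers z := by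
  have hfin : (⋃ s ∈ S, ⋃ s' ∈ S,
      {t : ℕ | s * y ^ t * s'⁻¹ ∈ Subgroup.zpowers z}).Finite := by
    refine hS.biUnion fun s _ => hS.biUnion fun s' _ => Set.Subsingleton.finite ?_
    intro t ht t' ht'
    by_contra hne
    obtain ⟨k, hk⟩ := Subgroup.mem_zpowers_iff.1 (mul_mem ht (inv_mem ht'))
    refine hnc s⁻¹ (t - t' : ℤ) k (sub_ne_zero.2 (by exact_mod_cast hne)) ?_
    rw [hk, zpow_sub, zpow_natCast, zpow_natCast]
    group
  obtain ⟨t, ht⟩ := (hfin.insert 0).exists_notMem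
  simp only [Set.mem_insert_iff, Set.mem_iUnion, not_or, not_exists] at ht
  exact ⟨t, Nat.pos_of_ne_zero ht.1, fun s hs s' hs' h => ht.2 s hs s' hs' h⟩

open Classical in
/-- The value of `hol` at a power of `y`, for a labelling supported at `1` and `f (y ^ t)`. -/
theorem hol_pow_orderOf {H P : Type*} [Group H] [Finite H] [Group P] (f : Monoid.Coprod A B →* H)
    (a b : P) (y : Monoid.Coprod A B) (t : ℕ) (ht : f y ^ t ≠ 1) (lam : H → P)
    (hlam : ∀ h, lam h = if h = 1 then a⁻¹ else if h = f y ^ t then b⁻¹ else 1)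
    (hy : ∀ n : ℕ, hol f lam y (f y ^ n) = (lam (f y ^ n))⁻¹) :
    hol f lam (y ^ orderOf (f y)) 1 = a * b := by
  have ho : 0 < orderOf (f y) := orderOf_pos _
  have hlt : t % orderOf (f y) < orderOf (f y) := Nat.mod_lt _ ho
  have h0 : t % orderOf (f y) ≠ 0 := fun h => ht (by rw [← pow_mod_orderOf, h, pow_zero])
  rw [← pow_mod_orderOf] at hlam
  generalize t % orderOf (f y) = t at *
  have key : ∀ n < orderOf (f y),
      hol f lam (y ^ (n + 1)) 1 = if n < t then a else a * b := by
    intro n hn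
    induction n with
    | zero =>
      rw [zero_add, pow_one, if_pos (Nat.pos_of_ne_zero h0)]
      simpa [hlam] using hy 0
    | succ n ih =>
      have h1 : f y ^ (n + 1) ≠ 1 := pow_ne_one_of_lt_orderOf n.succ_ne_zero hn
      have h2 : f y ^ (n + 1) = f y ^ t ↔ n + 1 = t :=
        ⟨fun h => pow_injOn_Iio_orderOf hn hlt h, fun h => by rw [h]⟩
      rw [pow_succ, hol_mul, ih (by omega), one_mul, map_pow, hy, hlam, if_neg h1]
      simp only [h2]
      rcases lt_trichotomy (n + 1) t with h | h | h
      · rw [if_pos (by omega), if_neg h.ne, if_pos h, inv_one, mul_one]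
      · rw [if_pos (by omega), if_pos h, if_neg (by omega), inv_inv]
      · rw [if_neg (by omega), if_neg h.ne', if_neg (by omega), inv_one, mul_one]
  have := key (orderOf (f y) - 1) (by omega)
  rwa [Nat.sub_add_cancel ho, if_neg (by omega)] at this

/-- A cyclically reduced `y` and an element `z`, both generating their centralizers in the
Cartesian subgroup and without common conjugate powers, have powers which are separated by an
admissible subgroup. -/
theorem exists_isAdmissible_not_pow_mem_iff [Finite A] [Finite B] (p : ℕ) [Fact p.Prime]
    {z : Monoid.Coprod A B} (hzC : z ∈ cartesianSubgroup A B)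
    (hz : ∀ g ∈ cartesianSubgroup A B, Commute g z → g ∈ Subgroup.zpowers z)
    {L : List (A × B)} (hL0 : L ≠ []) (hL : ∀ x ∈ L, x.1 ≠ 1 ∧ x.2 ≠ 1)
    (hyC : altWord L ∈ cartesianSubgroup A B)
    (hy : ∀ g ∈ cartesianSubgroup A B, Commute g (altWord L) →
      g ∈ Subgroup.zpowers (altWord L))
    (hnc : ∀ (g : Monoid.Coprod A B) (i j : ℤ), i ≠ 0 → altWord L ^ i ≠ g * z ^ j * g⁻¹) :
    ∃ N, IsAdmissible p N ∧ ∃ m : ℕ, ¬ (z ^ m ∈ N ↔ altWord L ^ m ∈ N) := by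
  classical
  by_contra! hcon
  obtain ⟨Sy, hSy, hSyz, hSyhol⟩ := exists_finite_hol_eq_inv hL0 hL hyC
  generalize altWord L = y at *
  obtain ⟨Sz, hSz, hSzhol⟩ := exists_finite_support_hol z
  obtain ⟨t, ht0, ht⟩ := exists_pos_forall_mul_pow_mul_inv_notMem hSz hnc
  have hyt : y ^ t ≠ 1 := fun h => hnc 1 t 0 (by exact_mod_cast ht0.ne') (by simpa using h)
  obtain ⟨P, _, _, a, b, hP, ha, hb, hab⟩ := exists_isPGroup_mul_pow_ne_one p
  obtain ⟨N₁, hN₁, h1⟩ := exists_isAdmissible_forall_zpowers p hzC hz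
    (S := Set.image2 (fun s s' => s * y ^ t * s'⁻¹) Sz Sz) (hSz.image2 _ hSz) (by
      rintro _ ⟨s, hs, s', hs', rfl⟩
      exact ht s hs s' hs')
  obtain ⟨N₂, hN₂, h2⟩ := exists_isAdmissible_forall_zpowers p hyC hy hSy hSyz
  obtain ⟨N₃, hN₃, h3⟩ := exists_isAdmissible_notMem p (pow_mem hyC t) hyt
  have hN := (hN₁.inf hN₂).inf hN₃
  replace h1 : ∀ s ∈ Sz, ∀ s' ∈ Sz, ∀ i : ℤ, s * y ^ t * s'⁻¹ * z ^ i ∉ N₁ ⊓ N₂ ⊓ N₃ :=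
    fun s hs s' hs' i h => h1 _ ⟨s, hs, s', hs', rfl⟩ i h.1.1
  replace h2 : ∀ s ∈ Sy, ∀ i : ℤ, s * y ^ i ∉ N₁ ⊓ N₂ ⊓ N₃ := fun s hs i h => h2 s hs i h.1.2
  replace h3 : y ^ t ∉ N₁ ⊓ N₂ ⊓ N₃ := fun h => h3 h.2
  generalize N₁ ⊓ N₂ ⊓ N₃ = N at *
  have := hN.normal
  have := hN.finiteIndex
  obtain ⟨H, _, _, f, rfl⟩ : ∃ (H : Type _) (_ : Group H) (_ : Finite H)
      (f : Monoid.Coprod A B →* H), f.ker = N :=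
    ⟨_ ⧸ N, inferInstance, inferInstance, QuotientGroup.mk' N, QuotientGroup.ker_mk' N⟩
  simp only [MonoidHom.mem_ker] at h1 h2 h3
  let lam : H → P := fun h => if h = 1 then a⁻¹ else if h = f y ^ t then b⁻¹ else 1
  have hyo : f (y ^ orderOf (f y)) = 1 := by rw [map_pow, pow_orderOf_eq_one]
  have hzo : f (z ^ orderOf (f y)) = 1 := (hcon _ hN _).2 hyo
  have hker := isAdmissible_ker_holPerm hP hN lam
  refine hab ?_
  have hholy : hol f lam (y ^ orderOf (f y)) 1 = a * b := by
    refine hol_pow_orderOf f a b y t (by rwa [← map_pow]) lam (fun _ => rfl) fun n => ?_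
    refine hSyhol f lam _ fun s hs => ?_
    have e1 : f y ^ n * f s ≠ 1 := fun h => h2 s hs n (by
      rw [map_mul, zpow_natCast, map_pow, ← mul_eq_one_comm.1 h] )
    have e2 : f y ^ n * f s ≠ f y ^ t := fun h => h2 s hs (n - t : ℤ) (by
      have : f s = (f y ^ n)⁻¹ * f y ^ t := eq_inv_mul_of_mul_eq h
      rw [map_mul, map_zpow, zpow_sub, zpow_natCast, zpow_natCast, this]
      group)
    simp only [lam, if_neg e1, if_neg e2]
  rw [← hholy]
  refine (pow_mem_ker_holPerm_iff f lam hyo p).1 ?_ 1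
  rw [← pow_mul, ← hcon _ hker, pow_mul, pow_mem_ker_holPerm_iff f lam hzo]
  intro h
  obtain ⟨c, hc, hmem⟩ : ∃ c : P, c ^ p = 1 ∧
      ∀ i : ℕ, ∀ s ∈ Sz, lam (h * f (z ^ i) * f s) ∈ Subgroup.zpowers c := by
    by_cases hex : ∃ i : ℕ, ∃ s ∈ Sz, h * f (z ^ i) * f s = 1
    · obtain ⟨i, s, hs, hi⟩ := hex
      refine ⟨a, ha, fun j s' hs' => ?_⟩
      have e : h * f (z ^ j) * f s' ≠ f y ^ t := fun hj => h1 s hs s' hs' (i - j : ℤ) (by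
        have hW : f y ^ t = h * f z ^ j * f s' := by rw [← hj, map_pow]
        rw [map_pow, mul_eq_one_iff_eq_inv] at hi
        rw [map_mul, map_mul, map_mul, map_zpow, map_inv, map_pow, hW, zpow_sub, zpow_natCast,
          zpow_natCast, ← inv_eq_iff_eq_inv.2 hi]
        group)
      simp only [lam, if_neg e]
      split_ifs <;> simp
    · push Not at hex
      refine ⟨b, hb, fun j s' hs' => ?_⟩
      simp only [lam, if_neg (hex j s' hs')]
      split_ifs <;> simp
  obtain ⟨k, hk⟩ := Subgroup.mem_zpowers_iff.1 (hol_pow_mem f lam z h (Subgroup.zpowers c)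
    (fun i => hSzhol _ _ f lam _ _ (hmem i)) (orderOf (f y)))
  rw [← hk, ← zpow_natCast, zpow_comm, zpow_natCast, hc, one_zpow]

end Separation

section Assembly

open Monoid.Coprod
variable {A B : Type*} [Group A] [Group B]

theorem IsAdmissible.mem_of_zpow_mem {p : ℕ} (hp : p.Prime) {N : Subgroup (Monoid.Coprod A B)}
    (hN : IsAdmissible p N) {x : Monoid.Coprod A B} (hx : x ∈ cartesianSubgroup A B) {b : ℤ}
    (hb : ¬ p ∣ b.natAbs) (hxb : x ^ b ∈ N) : x ∈ N := by
  obtain ⟨k, hk⟩ := hN.pow_mem x hx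
  have hcop : IsCoprime ((p ^ k : ℕ) : ℤ) b := by
    rw [Int.isCoprime_iff_gcd_eq_one, Int.gcd_eq_natAbs, Int.natAbs_natCast]
    exact Nat.Coprime.pow_left k ((Nat.Prime.coprime_iff_not_dvd hp).2 hb)
  obtain ⟨r, s, hrs⟩ := hcop
  rw [← zpow_one x, ← hrs, zpow_add, mul_comm r, mul_comm s, zpow_mul, zpow_mul, zpow_natCast]
  exact mul_mem (zpow_mem hk r) (zpow_mem hxb s)

/-- Root extraction in the Cartesian subgroup. -/
theorem exists_zpow_eq_of_mem {u : Monoid.Coprod A B} (hu : u ∈ cartesianSubgroup A B)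
    (hu1 : u ≠ 1) : ∃ z ∈ cartesianSubgroup A B, ∃ b : ℤ, b ≠ 0 ∧ z ^ b = u ∧
      ∀ g ∈ cartesianSubgroup A B, Commute g z → g ∈ Subgroup.zpowers z := by
  obtain ⟨z, hzC, hz⟩ := exists_zpowers_eq_centralizer hu hu1
  obtain ⟨b, rfl⟩ := Subgroup.mem_zpowers_iff.1 ((hz u hu).1 (Commute.refl u))
  refine ⟨z, hzC, b, ?_, rfl, fun g hg h => (hz g hg).1 (h.zpow_right b)⟩
  rintro rfl
  exact hu1 (zpow_zero z)

theorem exists_ne_zero_forall_prime_not_dvd [Finite A] [Finite B] {u v : Monoid.Coprod A B}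
    (hu : u ∈ cartesianSubgroup A B) (hv : v ∈ cartesianSubgroup A B) (hu1 : u ≠ 1) (hv1 : v ≠ 1)
    (hcyc : ¬ ∃ (z g : Monoid.Coprod A B), u ∈ Subgroup.zpowers z ∧
      g⁻¹ * v * g ∈ Subgroup.zpowers z) :
    ∃ d : ℕ, d ≠ 0 ∧ ∀ p : ℕ, p.Prime → ¬ p ∣ d →
      ∃ N, IsAdmissible p N ∧ ∃ m : ℕ, ¬ (u ^ m ∈ N ↔ v ^ m ∈ N) := by
  have hnormal : (cartesianSubgroup A B).Normal := MonoidHom.normal_ker _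
  obtain ⟨z, hzC, b, hb, rfl, hz⟩ := exists_zpow_eq_of_mem hu hu1
  obtain ⟨w, hwC, c, hc, rfl, hw⟩ := exists_zpow_eq_of_mem hv hv1
  have hw1 : w ≠ 1 := by
    rintro rfl
    exact hv1 (one_zpow c)
  obtain ⟨k, L, hL0, hL, rfl⟩ := exists_conj_altWord hwC hw1
  have hyC : altWord L ∈ cartesianSubgroup A B := by
    have := hnormal.conj_mem _ hwC k⁻¹
    simpa [mul_assoc] using this
  have hy : ∀ g ∈ cartesianSubgroup A B, Commute g (altWord L) →
      g ∈ Subgroup.zpowers (altWord L) := by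
    intro g hg hcomm
    obtain ⟨n, hn⟩ := Subgroup.mem_zpowers_iff.1
      (hw (k * g * k⁻¹) (hnormal.conj_mem _ hg k) ((Commute.conj_iff k).2 hcomm))
    refine Subgroup.mem_zpowers_iff.2 ⟨n, ?_⟩
    rw [conj_zpow] at hn
    exact mul_left_cancel (mul_right_cancel hn)
  have hnc : ∀ (g : Monoid.Coprod A B) (i j : ℤ), i ≠ 0 →
      altWord L ^ i ≠ g * z ^ j * g⁻¹ := by
    intro g i j hi h
    have h' : (k * altWord L * k⁻¹) ^ i = (k * g) * z ^ j * (k * g)⁻¹ := by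
      rw [conj_zpow, h]
      group
    generalize k * altWord L * k⁻¹ = w at *
    generalize k * g = g at *
    have hwi : w ^ i ≠ 1 := by
      intro h1
      refine hw1 (eq_one_of_pow_eq_one hwC (Int.natAbs_ne_zero.2 hi) ?_)
      rcases Int.natAbs_eq i with e | e <;> rw [e] at h1 <;> simpa using h1
    obtain ⟨o, -, ho⟩ := exists_zpowers_eq_centralizer (zpow_mem hwC i) hwi
    have h1 := (ho w hwC).1 ((Commute.refl w).zpow_right i)
    have h2 := (ho (g * z * g⁻¹) (hnormal.conj_mem _ hzC g)).1 (by
      rw [h', Commute.conj_iff]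
      exact (Commute.refl z).zpow_right j)
    obtain ⟨r, hr⟩ := Subgroup.mem_zpowers_iff.1 (zpow_mem h1 c)
    obtain ⟨s, hs⟩ := Subgroup.mem_zpowers_iff.1 (zpow_mem h2 b)
    refine hcyc ⟨g⁻¹ * o * g⁻¹⁻¹, g, Subgroup.mem_zpowers_iff.2 ⟨s, ?_⟩,
      Subgroup.mem_zpowers_iff.2 ⟨r, ?_⟩⟩
    · rw [conj_zpow, hs, conj_zpow]
      group
    · rw [conj_zpow, hr, inv_inv]
  refine ⟨b.natAbs * c.natAbs, by simp [hb, hc], fun p hp hpd => ?_⟩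
  have : Fact p.Prime := ⟨hp⟩
  have hpb : ¬ p ∣ b.natAbs := fun h => hpd (h.mul_right _)
  have hpc : ¬ p ∣ c.natAbs := fun h => hpd (h.mul_left _)
  obtain ⟨N, hN, m, hm⟩ := exists_isAdmissible_not_pow_mem_iff p hzC hz hL0 hL hyC hy hnc
  refine ⟨N, hN, m, ?_⟩
  have key : ∀ {x : Monoid.Coprod A B} {e : ℤ}, x ∈ cartesianSubgroup A B → ¬ p ∣ e.natAbs →
      ((x ^ e) ^ m ∈ N ↔ x ^ m ∈ N) := by
    intro x e hx he
    rw [← zpow_natCast (x ^ e), zpow_comm, zpow_natCast]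
    exact ⟨hN.mem_of_zpow_mem hp (pow_mem hx m) he, fun h => zpow_mem h e⟩
  have := hN.normal
  rwa [key hzC hpb, key hwC hpc, conj_pow, this.mem_comm_iff, inv_mul_cancel_left]

theorem mem_of_forall_pow_mem_iInf {ι : Type*} [Finite ι] {p : ι → ℕ} (hp : ∀ q, (p q).Prime)
    (hinj : Function.Injective p) {N : ι → Subgroup (Monoid.Coprod A B)}
    (hN : ∀ q, IsAdmissible (p q) (N q)) {u v : Monoid.Coprod A B}
    (hu : u ∈ cartesianSubgroup A B) (hv : v ∈ cartesianSubgroup A B)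
    (huv : ∀ n : ℕ, u ^ n ∈ ⨅ q, N q → v ^ n ∈ ⨅ q, N q) (q : ι) (m : ℕ) (h : u ^ m ∈ N q) :
    v ^ m ∈ N q := by
  classical
  have := Fintype.ofFinite ι
  choose k hk using fun q => (hN q).pow_mem u hu
  let R := ∏ r ∈ Finset.univ.erase q, p r ^ k r
  refine (hN q).mem_of_zpow_mem (hp q) (pow_mem hv m) (b := R) ?_ ?_
  · rw [Int.natAbs_natCast, Prime.dvd_finsetProd_iff (hp q).prime]
    rintro ⟨r, hr, hdvd⟩
    exact (Finset.mem_erase.1 hr).1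
      (hinj ((Nat.prime_dvd_prime_iff_eq (hp q) (hp r)).1 ((hp q).dvd_of_dvd_pow hdvd))).symm
  · rw [zpow_natCast, ← pow_mul]
    refine Subgroup.mem_iInf.1 (huv _ (Subgroup.mem_iInf.2 fun r => ?_)) q
    by_cases hr : r = q
    · rw [hr, pow_mul]
      exact pow_mem h R
    · obtain ⟨t, ht⟩ := Finset.dvd_prod_of_mem (fun r => p r ^ k r)
        (Finset.mem_erase.2 ⟨hr, Finset.mem_univ r⟩)
      rw [show R = p r ^ k r * t from ht, mul_left_comm, pow_mul]
      exact pow_mem (hk r) _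

theorem exists_prime_eq_of_dvd {ι : Type*} [Finite ι] {p : ι → ℕ} (hp : ∀ q, (p q).Prime)
    {N : ι → Subgroup (Monoid.Coprod A B)} (hN : ∀ q, IsAdmissible (p q) (N q))
    {u : Monoid.Coprod A B} (hu : u ∈ cartesianSubgroup A B) {r n : ℕ} (hr : r.Prime)
    (hn : ∀ l : ℕ, u ^ l ∈ ⨅ q, N q → n ∣ l) (hrn : r ∣ n) : ∃ q, r = p q := by
  have := Fintype.ofFinite ι
  choose k hk using fun q => (hN q).pow_mem u hu
  have hdvd := hrn.trans (hn (∏ q, p q ^ k q) (Subgroup.mem_iInf.2 fun q => by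
    obtain ⟨t, ht⟩ := Finset.dvd_prod_of_mem (fun q => p q ^ k q) (Finset.mem_univ q)
    rw [ht, pow_mul]
    exact pow_mem (hk q) t))
  obtain ⟨q, -, hq⟩ := (Prime.dvd_finsetProd_iff hr.prime _).1 hdvd
  exact ⟨q, (Nat.prime_dvd_prime_iff_eq hr (hp q)).1 (hr.dvd_of_dvd_pow hq)⟩

theorem exists_injective_prime {ι : Type*} [Finite ι] (d : ι → ℕ) (hd : ∀ q, d q ≠ 0)
    (π : Finset ℕ) : ∃ p : ι → ℕ, Function.Injective p ∧
      ∀ q, (p q).Prime ∧ p q ∉ π ∧ ∀ r, ¬ p q ∣ d r := by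
  have := Fintype.ofFinite ι
  have hinf : ({p : ℕ | p.Prime} \ (↑(π ∪ (∏ r, d r).divisors) : Set ℕ)).Infinite :=
    Nat.infinite_setOfPred_prime.sdiff (Finset.finite_toSet _)
  refine ⟨fun q => hinf.natEmbedding _ (Fintype.equivFin ι q), fun q r h => ?_, fun q => ?_⟩
  · exact (Fintype.equivFin ι).injective
      (Fin.val_injective ((hinf.natEmbedding _).injective (Subtype.ext h)))
  · obtain ⟨h1, h2⟩ := (hinf.natEmbedding _ (Fintype.equivFin ι q)).2
    simp only [Finset.mem_coe, Finset.mem_union, Nat.mem_divisors, not_or, not_and_or] at h2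
    refine ⟨h1, h2.1, fun r hr => ?_⟩
    rcases h2.2 with h | h
    · exact h (hr.trans (Finset.dvd_prod_of_mem d (Finset.mem_univ r)))
    · exact h (Finset.prod_ne_zero_iff.2 fun r _ => hd r)

end Assembly

/-- Lemma 3: if `G = A ∗ B` with `A`, `B` finite, `u 0, ..., u (m-1)` are nontrivial
elements of the Cartesian subgroup no two of which lie in conjugate cyclic subgroups,
each `u i` is `(u' i) ^ (e i)` with `u' i` not a proper power and, when `e i > 1`,
no power `(u' i) ^ m'` with `m'` a proper positive divisor of `e i` lies in the
Cartesian subgroup, and `π` is a finite set of primes, then there is a homomorphism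
of `G` onto a finite group under which the `u i` get pairwise different orders, none
of which is divisible by a prime of `π`. -/
theorem coprod_exists_hom_distinct_orders (A B : Type*) [Group A] [Group B]
    [Finite A] [Finite B] (m : ℕ) (u : Fin m → Monoid.Coprod A B)
    (huC : ∀ i, u i ∈ cartesianSubgroup A B) (hu1 : ∀ i, u i ≠ 1)
    (hcyc : ∀ i j, i ≠ j →
      ¬ ∃ (z g : Monoid.Coprod A B), u i ∈ Subgroup.zpowers z ∧
        g⁻¹ * u j * g ∈ Subgroup.zpowers z)
    (u' : Fin m → Monoid.Coprod A B) (e : Fin m → ℕ)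
    (hpow : ∀ i, u i = (u' i) ^ (e i))
    (hnpp : ∀ i, IsNotProperPower (u' i))
    (hdiv : ∀ i, 1 < e i → ∀ m' : ℕ, 0 < m' → m' ∣ e i → m' ≠ e i →
      (u' i) ^ m' ∉ cartesianSubgroup A B)
    (π : Finset ℕ) (hπ : ∀ p ∈ π, p.Prime) :
    ∃ (H : Type) (_ : Group H) (_ : Finite H) (φ : Monoid.Coprod A B →* H),
      Function.Surjective φ ∧
      (∀ i j, i ≠ j → orderOf (φ (u i)) ≠ orderOf (φ (u j))) ∧
      ∀ p ∈ π, ∀ i, ¬ p ∣ orderOf (φ (u i)) := by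
  choose d hd hsep using fun q : {q : Fin m × Fin m // q.1 ≠ q.2} =>
    exists_ne_zero_forall_prime_not_dvd (huC q.1.1) (huC q.1.2) (hu1 q.1.1) (hu1 q.1.2)
      (hcyc q.1.1 q.1.2 q.2)
  obtain ⟨p, hinj, hp⟩ := exists_injective_prime d hd π
  choose N hN n hn using fun q => hsep q (p q) (hp q).1 ((hp q).2.2 q)
  have hp' := fun q => (hp q).1
  let K := ⨅ q, N q
  have : K.Normal := Subgroup.normal_iInf_normal fun q => (hN q).normal
  have : K.FiniteIndex := Subgroup.finiteIndex_iInf fun q => (hN q).finiteIndex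
  let φ : Monoid.Coprod A B →* Shrink.{0} (Monoid.Coprod A B ⧸ K) :=
    (Shrink.mulEquiv.symm.toMonoidHom).comp (QuotientGroup.mk' K)
  have hφ : ∀ (x : Monoid.Coprod A B) (l : ℕ), orderOf (φ x) ∣ l ↔ x ^ l ∈ K := fun x l => by
    rw [orderOf_dvd_iff_pow_eq_one, ← map_pow, MonoidHom.comp_apply, MulEquiv.toMonoidHom_eq_coe,
      MonoidHom.coe_coe, map_eq_one_iff _ (MulEquiv.injective _), ← MonoidHom.mem_ker,
      QuotientGroup.ker_mk']
  refine ⟨_, inferInstance, Finite.of_equiv _ (equivShrink _), φ,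
    Shrink.mulEquiv.symm.surjective.comp (QuotientGroup.mk'_surjective K), ?_, ?_⟩
  · intro i j hij h
    refine hn ⟨(i, j), hij⟩ ⟨?_, ?_⟩
    · exact mem_of_forall_pow_mem_iInf hp' hinj hN (huC i) (huC j)
        (fun l hl => (hφ _ _).1 (h ▸ (hφ _ _).2 hl)) _ _
    · exact mem_of_forall_pow_mem_iInf hp' hinj hN (huC j) (huC i)
        (fun l hl => (hφ _ _).1 (h ▸ (hφ _ _).2 hl)) _ _
  · intro r hr i hri
    obtain ⟨q, rfl⟩ := exists_prime_eq_of_dvd hp' hN (huC i) (hπ r hr)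
      (fun l hl => (hφ _ _).2 hl) hri
    exact (hp q).2.1 hr
end

section
/- Let G = A ∗ B be the free product of two finite groups A and B, let w be a nontrivial element of the Cartesian subgroup C of G, and let k_1, ..., k_l be integers with pairwise different absolute values. Then there exists a homomorphism φ of G onto a finite group such that the orders of φ(w^{k_1}), ..., φ(w^{k_l}) are pairwise different. -/
/-- The image of a letter `a ∈ A` or `b ∈ B` in `A × B`. -/
def letterToProd {A B : Type*} [Group A] [Group B] : A ⊕ B → A × B :=
  Sum.elim (fun a => (a, 1)) (fun b => (1, b))

/-- The element of the free product represented by a list of letters. -/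
def wordProd {A B : Type*} [Group A] [Group B] (l : List (A ⊕ B)) : Monoid.Coprod A B :=
  (l.map (Sum.elim Monoid.Coprod.inl Monoid.Coprod.inr)).prod

/-- A word is reduced if its letters are nontrivial and alternate between `A` and `B`. -/
def IsReducedWord {A B : Type*} [Group A] [Group B] (l : List (A ⊕ B)) : Prop :=
  l.IsChain (fun x y => x.isLeft ≠ y.isLeft) ∧ ∀ x ∈ l, letterToProd x ≠ 1

theorem exists_isReducedWord {A B : Type*} [Group A] [Group B] (g : Monoid.Coprod A B) :
    ∃ l : List (A ⊕ B), IsReducedWord l ∧ wordProd l = g := by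
  induction g using Monoid.Coprod.induction_on' with
  | one => exact ⟨[], by simp [IsReducedWord], rfl⟩
  | inl_mul a x ih =>
    obtain ⟨l, ⟨hl, hn⟩, rfl⟩ := ih
    by_cases ha : a = 1
    · exact ⟨l, ⟨hl, hn⟩, by simp [ha]⟩
    rcases l with _ | ⟨a' | b', l⟩
    · exact ⟨[.inl a], by simp [IsReducedWord, letterToProd, ha], by simp [wordProd]⟩
    · rw [List.isChain_cons] at hl
      by_cases h : a * a' = 1
      · exact ⟨l, ⟨hl.2, fun x hx => hn x (by simp [hx])⟩, by
          simp [wordProd, ← mul_assoc, ← map_mul, h]⟩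
      · refine ⟨.inl (a * a') :: l, ⟨List.isChain_cons.2 ⟨by simpa using hl.1, hl.2⟩, ?_⟩, by
          simp [wordProd, ← mul_assoc]⟩
        rintro x (_ | ⟨_, hx⟩)
        · simpa [letterToProd] using h
        · exact hn x (List.mem_cons_of_mem _ hx)
    · refine ⟨.inl a :: .inr b' :: l, ⟨List.isChain_cons.2 ⟨by simp, hl⟩, ?_⟩, by simp [wordProd]⟩
      rintro x (_ | ⟨_, hx⟩)
      · simpa [letterToProd] using ha
      · exact hn x hx
  | inr_mul b x ih =>
    obtain ⟨l, ⟨hl, hn⟩, rfl⟩ := ih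
    by_cases hb : b = 1
    · exact ⟨l, ⟨hl, hn⟩, by simp [hb]⟩
    rcases l with _ | ⟨a' | b', l⟩
    · exact ⟨[.inr b], by simp [IsReducedWord, letterToProd, hb], by simp [wordProd]⟩
    · refine ⟨.inr b :: .inl a' :: l, ⟨List.isChain_cons.2 ⟨by simp, hl⟩, ?_⟩, by simp [wordProd]⟩
      rintro x (_ | ⟨_, hx⟩)
      · simpa [letterToProd] using hb
      · exact hn x hx
    · rw [List.isChain_cons] at hl
      by_cases h : b * b' = 1
      · exact ⟨l, ⟨hl.2, fun x hx => hn x (by simp [hx])⟩, by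
          simp [wordProd, ← mul_assoc, ← map_mul, h]⟩
      · refine ⟨.inr (b * b') :: l, ⟨List.isChain_cons.2 ⟨by simpa using hl.1, hl.2⟩, ?_⟩, by
          simp [wordProd, ← mul_assoc]⟩
        rintro x (_ | ⟨_, hx⟩)
        · simpa [letterToProd] using h
        · exact hn x (List.mem_cons_of_mem _ hx)

section Representation

variable {Q k : Type*} [CommRing k]

/-- Vectors vanishing on the levels below `j`. -/
def VanishesBelow {n : ℕ} (j : ℕ) (f : Fin n → Q → k) : Prop :=
  ∀ i : Fin n, (i : ℕ) < j → f i = 0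

theorem VanishesBelow.add {n j : ℕ} {f g : Fin n → Q → k} (hf : VanishesBelow j f)
    (hg : VanishesBelow j g) : VanishesBelow j (f + g) := fun i hi => by
  simp [hf i hi, hg i hi]

theorem VanishesBelow.sub {n j : ℕ} {f g : Fin n → Q → k} (hf : VanishesBelow j f)
    (hg : VanishesBelow j g) : VanishesBelow j (f - g) := fun i hi => by
  simp [hf i hi, hg i hi]

theorem VanishesBelow.mono {n j j' : ℕ} {f : Fin n → Q → k} (hf : VanishesBelow j f)
    (h : j' ≤ j) : VanishesBelow j' f := fun i hi => hf i (by omega)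

theorem pow_eq_zero_of_vanishesBelow {n : ℕ} {T : Module.End k (Fin n → Q → k)}
    (hT : ∀ j f, VanishesBelow j f → VanishesBelow (j + 1) (T f)) : T ^ n = 0 := by
  have key : ∀ j f, VanishesBelow j ((T ^ j) f) := by
    intro j
    induction j with
    | zero => intro f i hi; omega
    | succ j ih => intro f; rw [pow_succ']; exact hT _ _ (ih f)
  refine LinearMap.ext fun f => funext fun i => key n f i i.2

variable [Group Q]

/-- The action of `Q` on `n` copies of `Q → k` by left translation. -/
def levelTranslate (k : Type*) [CommRing k] (Q : Type*) [Group Q] (n : ℕ) :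
    Q →* Module.End k (Fin n → Q → k) where
  toFun g :=
    { toFun f i q := f i (g⁻¹ * q)
      map_add' _ _ := rfl
      map_smul' _ _ := rfl }
  map_one' := by ext; simp
  map_mul' g h := by
    refine LinearMap.ext fun f => ?_
    ext i q
    simp [mul_assoc]

open Classical in
/-- The operator sending the basis vector `c i` of level `i` to the basis vector `1` of level
`i + 1`, and all other basis vectors to zero. -/
noncomputable def levelShift (k : Type*) [CommRing k] {Q : Type*} [Group Q] (n : ℕ) (c : ℕ → Q) :
    Module.End k (Fin n → Q → k) where
  toFun f i q := if q = 1 ∧ 0 < (i : ℕ) then f ⟨i - 1, by omega⟩ (c (i - 1)) else 0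
  map_add' f g := by
    ext i q
    by_cases h : q = 1 ∧ 0 < (i : ℕ) <;> simp [h]
  map_smul' r f := by
    ext i q
    by_cases h : q = 1 ∧ 0 < (i : ℕ) <;> simp [h]

theorem levelShift_mul_self {n : ℕ} {c : ℕ → Q} (hc : ∀ i, c i ≠ 1) :
    levelShift k n c * levelShift k n c = 0 := by
  refine LinearMap.ext fun f => ?_
  ext i q
  simp [levelShift, hc]

/-- The unit `1 + X`, where `X` is the shift operator. -/
noncomputable def levelUnit (k : Type*) [CommRing k] {Q : Type*} [Group Q] (n : ℕ) {c : ℕ → Q}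
    (hc : ∀ i, c i ≠ 1) : (Module.End k (Fin n → Q → k))ˣ where
  val := 1 + levelShift k n c
  inv := 1 - levelShift k n c
  val_inv := by simp [mul_sub, add_mul, levelShift_mul_self hc]
  inv_val := by simp [sub_mul, mul_add, levelShift_mul_self hc]

/-- The representation of `A ∗ B` in which `A` acts by translations, and `B` acts by translations
conjugated by the unit `1 + X`. -/
noncomputable def coprodRep (k : Type*) [CommRing k] {A B : Type*} [Group A] [Group B] (n : ℕ)
    {c : ℕ → A × B} (hc : ∀ i, c i ≠ 1) :
    Monoid.Coprod A B →* (Module.End k (Fin n → A × B → k))ˣ :=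
  Monoid.Coprod.lift
    ((levelTranslate k (A × B) n).toHomUnits.comp (MonoidHom.inl A B))
    ((MulAut.conj (levelUnit k n hc)).toMonoidHom.comp
      ((levelTranslate k (A × B) n).toHomUnits.comp (MonoidHom.inr A B)))

theorem VanishesBelow.levelTranslate {n j : ℕ} {f : Fin n → Q → k} (hf : VanishesBelow j f)
    (g : Q) : VanishesBelow j (levelTranslate k Q n g f) := fun i hi => by
  ext q
  simp [_root_.levelTranslate, hf i hi]

theorem VanishesBelow.levelShift {n j : ℕ} {f : Fin n → Q → k} (hf : VanishesBelow j f)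
    (c : ℕ → Q) : VanishesBelow (j + 1) (levelShift k n c f) := fun i hi => by
  ext q
  have : 0 < (i : ℕ) → f ⟨i - 1, by omega⟩ = 0 := fun h => hf _ (by simp; omega)
  by_cases h : q = 1 ∧ 0 < (i : ℕ)
  · simp [_root_.levelShift, this h.2]
  · simp [_root_.levelShift, h]

/-- The representation agrees with the translation action up to operators raising the level. -/
theorem coprodRep_sub_vanishesBelow {A B : Type*} [Group A] [Group B] {n : ℕ}
    {c : ℕ → A × B} (hc : ∀ i, c i ≠ 1) (g : Monoid.Coprod A B) (j : ℕ)
    (f : Fin n → A × B → k) (hf : VanishesBelow j f) :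
    VanishesBelow (j + 1) ((coprodRep k n hc g : Module.End k (Fin n → A × B → k)) f -
      levelTranslate k (A × B) n (Monoid.Coprod.toProd g) f) := by
  induction g using Monoid.Coprod.induction_on' generalizing j f with
  | one => intro i _; simp
  | inl_mul a x ih =>
    have h := (ih j f hf).levelTranslate (a, 1)
    simpa [coprodRep] using h
  | inr_mul b x ih =>
    have h := ih j f hf
    have htx := hf.levelTranslate (Monoid.Coprod.toProd x)
    have hx : VanishesBelow j
        ((coprodRep k n hc x : Module.End k (Fin n → A × B → k)) f) := by
      simpa using (h.mono (Nat.le_succ j)).add htx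
    have h1 := h.levelTranslate (1, b)
    have h2 := (hx.levelShift c).levelTranslate (1, b)
    have h3 :=
      ((hx.sub ((hx.levelShift c).mono (Nat.le_succ j))).levelTranslate (1, b)).levelShift c
    have h4 := (h1.sub h2).add h3
    convert h4 using 1
    simp [coprodRep, levelUnit]
    abel

theorem exists_pow_prime_pow_coprodRep_eq_one {p : ℕ} [Fact p.Prime] {A B : Type*} [Group A]
    [Group B] {n : ℕ} {c : ℕ → A × B} (hc : ∀ i, c i ≠ 1) {w : Monoid.Coprod A B}
    (hw : w ∈ cartesianSubgroup A B) : coprodRep (ZMod p) n hc w ^ p ^ n = 1 := by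
  set T : Module.End (ZMod p) (Fin n → A × B → ZMod p) := (coprodRep (ZMod p) n hc w) - 1 with hT
  have hT0 : T ^ n = 0 := pow_eq_zero_of_vanishesBelow fun j f hf => by
    have := coprodRep_sub_vanishesBelow hc w j f hf
    rw [(MonoidHom.mem_ker).1 hw] at this
    simpa [hT] using this
  have hTp : T ^ p ^ n = 0 :=
    pow_eq_zero_of_le (Nat.lt_pow_self (Fact.out : p.Prime).one_lt).le hT0
  have h := congrArg (Polynomial.aeval T)
    (add_pow_char_pow (Polynomial.X : Polynomial (ZMod p)) 1 p n)
  ext1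
  rw [map_pow, map_add, map_add, map_pow, Polynomial.aeval_X, hTp] at h
  simpa [hT] using h

/-- The vector `f` is supported on levels at most `t`, and its coefficient at the basis vector `1`
of level `t` is nonzero. -/
def HasLeadingOne {n : ℕ} (t : ℕ) (f : Fin n → Q → k) : Prop :=
  ∀ i : Fin n, (t < i → f i = 0) ∧ (i = t → f i 1 ≠ 0)

theorem HasLeadingOne.step {n t : ℕ} {c : ℕ → Q} {f : Fin n → Q → k} (hf : HasLeadingOne t f)
    (ε : kˣ) :
    HasLeadingOne (t + 1) (levelTranslate k Q n (c t) f +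
      (ε : k) • levelShift k n c (levelTranslate k Q n (c t) f)) := by
  refine fun i => ⟨fun hi => ?_, fun hi => ?_⟩
  · ext q
    have h : f ⟨i - 1, by omega⟩ = 0 := (hf _).1 (by simp; omega)
    simp [levelTranslate, levelShift, h, (hf i).1 (by omega)]
  · have h := (hf ⟨i - 1, by omega⟩).2 (by simp; omega)
    have hi' : (i : ℕ) - 1 = t := by omega
    have hpos : 0 < (i : ℕ) := by omega
    simp only [hi'] at h
    simp [levelTranslate, levelShift, (hf i).1 (by omega), hi', hpos, h]

/-- The basis vector `1` of level zero. -/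
noncomputable def baseVector (k : Type*) [CommRing k] (Q : Type*) [Group Q] (n : ℕ) :
    Fin (n + 1) → Q → k :=
  open Classical in Pi.single 0 (Pi.single 1 1)

theorem levelShift_baseVector {n : ℕ} {c : ℕ → Q} (hc : ∀ i, c i ≠ 1) :
    levelShift k (n + 1) c (baseVector k Q n) = 0 := by
  classical
  ext i q
  simp only [levelShift, baseVector, LinearMap.coe_mk, AddHom.coe_mk, Pi.zero_apply,
    ite_eq_right_iff]
  intro _
  rw [Pi.single_apply]
  split_ifs <;> simp [hc]

theorem hasLeadingOne_baseVector [Nontrivial k] (n : ℕ) :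
    HasLeadingOne 0 (baseVector k Q n) := by
  classical
  refine fun i => ⟨fun hi => ?_, fun hi => ?_⟩
  · exact Pi.single_eq_of_ne (by rintro rfl; simp at hi) _
  · obtain rfl : i = 0 := Fin.ext hi
    simp [baseVector]

theorem hasLeadingOne_coprodRep [Nontrivial k] {A B : Type*} [Group A] [Group B] {n : ℕ}
    {c : ℕ → A × B} (hc : ∀ i, c i ≠ 1) {l : List (A ⊕ B)}
    (hl : l.IsChain (fun x y => x.isLeft ≠ y.isLeft))
    (hcl : ∀ x l', x :: l' <:+ l → c l'.length = letterToProd x) (s : Bool)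
    (hs : ∀ y ∈ l.head?, y.isLeft ≠ s) :
    HasLeadingOne l.length
      (((if s then 1 else (levelUnit k (n + 1) hc)⁻¹) * coprodRep k (n + 1) hc (wordProd l) :
        (Module.End k (Fin (n + 1) → A × B → k))ˣ).val (baseVector k (A × B) n)) := by
  induction l generalizing s with
  | nil =>
    change HasLeadingOne 0 _
    convert hasLeadingOne_baseVector (k := k) (Q := A × B) n using 1
    cases s <;> simp [wordProd, levelUnit, levelShift_baseVector hc]
  | cons x l ih =>
    rw [List.isChain_cons] at hl
    have hx := hcl x l List.suffix_rfl
    have ih := ih hl.2 (fun y l' h => hcl y l' (h.trans (List.suffix_cons _ _))) x.isLeft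
      (fun y hy => (hl.1 y hy).symm)
    have hs : s = !x.isLeft := Bool.eq_not.2 (hs x rfl).symm
    subst hs
    rcases x with a | b
    · have := ih.step (c := c) (-1)
      rw [hx] at this
      change HasLeadingOne (l.length + 1) _
      convert this using 1
      simp [wordProd, coprodRep, letterToProd, levelUnit, sub_eq_add_neg]
    · have := ih.step (c := c) 1
      rw [hx] at this
      change HasLeadingOne (l.length + 1) _
      convert this using 1
      simp [wordProd, coprodRep, letterToProd, levelUnit]

end Representation

theorem exists_letter_sequence {A B : Type*} [Group A] [Group B] {l : List (A ⊕ B)} (hne : l ≠ [])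
    (hl : ∀ x ∈ l, letterToProd x ≠ 1) :
    ∃ c : ℕ → A × B, (∀ i, c i ≠ 1) ∧
      ∀ x l', x :: l' <:+ l → c l'.length = letterToProd x := by
  refine ⟨fun i => letterToProd (l.reverse.getD i (l.head hne)), fun i => hl _ ?_, ?_⟩
  · rw [List.getD_eq_getElem?_getD]
    rcases h : l.reverse[i]? with _ | y
    · simp
    · simpa using List.mem_of_getElem? h
  · rintro x l' ⟨l₁, rfl⟩
    simp [List.getD_eq_getElem?_getD]

universe u v

/-- Free products of finite groups are residually finite, through quotients in which the Cartesian
subgroup has `p`-power exponent. -/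
theorem exists_finite_hom_ne_one {A : Type u} {B : Type v} [Group A] [Group B] [Finite A]
    [Finite B] (p : ℕ) [Fact p.Prime] {g : Monoid.Coprod A B} (hg : g ≠ 1) :
    ∃ (H : Type (max u v)) (_ : Group H) (_ : Finite H) (φ : Monoid.Coprod A B →* H),
      φ g ≠ 1 ∧ ∃ n, ∀ w ∈ cartesianSubgroup A B, φ w ^ p ^ n = 1 := by
  obtain ⟨l, ⟨hl, hn⟩, rfl⟩ := exists_isReducedWord g
  have hne : l ≠ [] := by rintro rfl; exact hg rfl
  obtain ⟨c, hc, hcl⟩ := exists_letter_sequence hne hn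
  have : Finite (Module.End (ZMod p) (Fin (l.length + 1) → A × B → ZMod p)) :=
    DFunLike.finite _
  refine ⟨_, inferInstance, inferInstance, coprodRep (ZMod p) (l.length + 1) hc, fun h => ?_,
    _, fun w hw => exists_pow_prime_pow_coprodRep_eq_one hc hw⟩
  have key := hasLeadingOne_coprodRep (k := ZMod p) (n := l.length) hc hl hcl
    (!(l.head hne).isLeft)
    (by simpa only [List.head?_eq_some_head hne, Option.mem_some_iff, forall_eq'] using
      Bool.self_ne_not _)
  rw [h] at key
  apply (key (Fin.last _)).2 rfl
  have h2 : Fin.last l.length ≠ 0 := by simpa [Fin.ext_iff] using hne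
  cases (l.head hne).isLeft <;>
    simp [levelUnit, levelShift_baseVector hc] <;> simp [baseVector, h2]

theorem orderOf_eq_zero_of_mem_cartesianSubgroup {A B : Type*} [Group A] [Group B] [Finite A]
    [Finite B] {w : Monoid.Coprod A B} (hw : w ∈ cartesianSubgroup A B) (hw1 : w ≠ 1) :
    orderOf w = 0 := by
  by_contra h0
  obtain ⟨p, hp, hpp⟩ := Nat.exists_infinite_primes (orderOf w + 1)
  have := Fact.mk hpp
  obtain ⟨H, _, _, φ, hφ, n, hn⟩ := exists_finite_hom_ne_one p hw1
  obtain ⟨j, -, hj⟩ := (Nat.dvd_prime_pow hpp).1 (orderOf_dvd_of_pow_eq_one (hn w hw))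
  have hj0 : j ≠ 0 := by
    rintro rfl
    exact hφ (orderOf_eq_one_iff.1 (by simpa using hj))
  have hd : p ∣ orderOf w := (dvd_pow_self p hj0).trans (hj ▸ orderOf_map_dvd φ w)
  have := Nat.le_of_dvd (Nat.pos_of_ne_zero h0) hd
  omega

theorem exists_finite_hom_dvd_orderOf {A : Type u} {B : Type v} [Group A] [Group B] [Finite A]
    [Finite B] {w : Monoid.Coprod A B} (hw : w ∈ cartesianSubgroup A B) (hw1 : w ≠ 1) (N : ℕ)
    (hN : N ≠ 0) :
    ∃ (H : Type (max u v)) (_ : Group H) (_ : Finite H) (φ : Monoid.Coprod A B →* H),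
      N ∣ orderOf (φ w) := by
  induction N using Nat.recOnPosPrimePosCoprime with
  | zero => exact absurd rfl hN
  | one => exact ⟨PUnit, inferInstance, inferInstance, 1, one_dvd _⟩
  | prime_pow p s hp hs =>
    have := Fact.mk hp
    have hg : w ^ p ^ (s - 1) ≠ 1 := fun h => by
      have := orderOf_dvd_of_pow_eq_one h
      rw [orderOf_eq_zero_of_mem_cartesianSubgroup hw hw1, zero_dvd_iff] at this
      exact pow_ne_zero _ hp.ne_zero this
    obtain ⟨H, _, _, φ, hφ, n, hn⟩ := exists_finite_hom_ne_one p hg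
    refine ⟨H, inferInstance, inferInstance, φ, ?_⟩
    obtain ⟨j, -, hj⟩ := (Nat.dvd_prime_pow hp).1 (orderOf_dvd_of_pow_eq_one (hn w hw))
    rw [hj]
    refine pow_dvd_pow p ?_
    by_contra hlt
    apply hφ
    rw [map_pow, ← orderOf_dvd_iff_pow_eq_one, hj]
    exact pow_dvd_pow p (by omega)
  | coprime a b ha hb hab iha ihb =>
    obtain ⟨H, _, _, φ, hφ⟩ := iha (by omega)
    obtain ⟨K, _, _, ψ, hψ⟩ := ihb (by omega)
    refine ⟨H × K, inferInstance, inferInstance, φ.prod ψ, ?_⟩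
    rw [MonoidHom.prod_apply, Prod.orderOf_mk]
    exact hab.mul_dvd_of_dvd_of_dvd (hφ.trans (Nat.dvd_lcm_left _ _))
      (hψ.trans (Nat.dvd_lcm_right _ _))

theorem orderOf_zpow_eq_div_gcd {G : Type*} [Group G] [Finite G] (x : G) (m : ℤ) :
    orderOf (x ^ m) = orderOf x / (orderOf x).gcd m.natAbs := by
  rw [← orderOf_pow]
  rcases Int.natAbs_eq m with h | h
  · conv_lhs => rw [h, zpow_natCast]
  · conv_lhs => rw [h, zpow_neg, zpow_natCast, orderOf_inv]

/-- Powers of `x` with exponents of different absolute values have different orders as soon as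
the order of `x` is divisible by a factorial that exceeds the exponents. -/
theorem orderOf_zpow_ne_of_factorial_dvd {G : Type*} [Group G] [Finite G] {x : G} {K : ℕ}
    (hK : (K + 1).factorial ∣ orderOf x) {a b : ℤ} (ha : a.natAbs ≤ K) (hb : b.natAbs ≤ K)
    (hab : a.natAbs ≠ b.natAbs) : orderOf (x ^ a) ≠ orderOf (x ^ b) := by
  have hpos := orderOf_pos x
  have hlt : K < orderOf x :=
    (Nat.self_le_factorial (K + 1)).trans (Nat.le_of_dvd hpos hK)
  have hgcd : ∀ m : ℕ, m ≤ K → m ≠ 0 → (orderOf x).gcd m = m := fun m hm h0 =>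
    Nat.gcd_eq_right ((Nat.dvd_factorial (Nat.pos_of_ne_zero h0) (by omega)).trans hK)
  rw [orderOf_zpow_eq_div_gcd, orderOf_zpow_eq_div_gcd]
  intro h
  have h' : (orderOf x).gcd a.natAbs = (orderOf x).gcd b.natAbs := by
    rw [← Nat.div_div_self (Nat.gcd_dvd_left (orderOf x) a.natAbs) hpos.ne', h,
      Nat.div_div_self (Nat.gcd_dvd_left (orderOf x) b.natAbs) hpos.ne']
  rcases eq_or_ne a.natAbs 0 with ha0 | ha0 <;> rcases eq_or_ne b.natAbs 0 with hb0 | hb0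
  · omega
  · rw [ha0, Nat.gcd_zero_right, hgcd _ hb hb0] at h'; omega
  · rw [hb0, Nat.gcd_zero_right, hgcd _ ha ha0] at h'; omega
  · rw [hgcd _ ha ha0, hgcd _ hb hb0] at h'; omega

/-- Lemma 4: if `G = A ∗ B` with `A`, `B` finite, `w` is a nontrivial element of the
Cartesian subgroup, and `k 0, ..., k (l-1)` are integers with pairwise different
absolute values, then there is a homomorphism of `G` onto a finite group under which
the elements `w ^ (k i)` get pairwise different orders. -/
theorem coprod_exists_hom_distinct_orders_of_powers (A B : Type*) [Group A] [Group B]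
    [Finite A] [Finite B] (w : Monoid.Coprod A B)
    (hwC : w ∈ cartesianSubgroup A B) (hw1 : w ≠ 1)
    (l : ℕ) (k : Fin l → ℤ) (hk : ∀ i j, i ≠ j → |k i| ≠ |k j|) :
    ∃ (H : Type) (_ : Group H) (_ : Finite H) (φ : Monoid.Coprod A B →* H),
      Function.Surjective φ ∧
      ∀ i j, i ≠ j → orderOf (φ (w ^ (k i))) ≠ orderOf (φ (w ^ (k j))) := by
  obtain ⟨H, _, _, φ, hφ⟩ :=
    exists_finite_hom_dvd_orderOf hwC hw1 (∑ i, (k i).natAbs + 1).factorial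
      (Nat.factorial_ne_zero _)
  let e : Shrink.{0} φ.range ≃* φ.range := Shrink.mulEquiv
  have hinj : Function.Injective (φ.range.subtype.comp e.toMonoidHom) :=
    φ.range.subtype_injective.comp e.injective
  refine ⟨Shrink.{0} φ.range, inferInstance, inferInstance,
    e.symm.toMonoidHom.comp φ.rangeRestrict,
    e.symm.surjective.comp φ.rangeRestrict_surjective, fun i j hij => ?_⟩
  have hle : ∀ i, (k i).natAbs ≤ ∑ i, (k i).natAbs := fun i =>
    Finset.single_le_sum (f := fun i => (k i).natAbs) (fun _ _ => Nat.zero_le _)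
      (Finset.mem_univ i)
  have hne : (k i).natAbs ≠ (k j).natAbs := fun h => hk i j hij (by
    rw [Int.abs_eq_natAbs, Int.abs_eq_natAbs, h])
  rw [← orderOf_injective _ hinj, ← orderOf_injective _ hinj (_ : Shrink.{0} φ.range)]
  simpa using orderOf_zpow_ne_of_factorial_dvd hφ (hle i) (hle j) hne
end
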